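/- arXiv:2307.10081 — 2 statements merged into one kernel-verified Lean document; each statement's English description precedes it below -/
import Mathlib

section
/- There exists C > 0 such that Spreader has a winning strategy in the containment game on Z_strong against Container of strength q = 3, for some finite initial occupied set, with spreading function g(t) = ⌈C·t^{6/7}⌉; in particular 3 ∉ q(Z_strong, t ↦ ⌈C·t^{6/7}⌉). -/
open Set

/-- The number of vertices Container of strength `q` may delete at turn `t`:
`⌊t·q⌋ − ⌊(t−1)·q⌋`. -/
noncomputable def budget (q : ℝ) (t : ℕ) : ℕ :=
  (⌊(t : ℝ) * q⌋ - ⌊((t : ℝ) - 1) * q⌋).toNat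

/-- The cumulative deleted sets determined by a Container strategy `σ`
(mapping the history `[B 0, …, B t]` of occupied sets to the set of vertices deleted
at turn `t + 1`) against the occupied sets `B`. -/
def delSets {V : Type*} (σ : List (Set V) → Set V) (B : ℕ → Set V) : ℕ → Set V
  | 0 => ∅
  | t + 1 => delSets σ B t ∪ σ ((List.range (t + 1)).map B)

/-- Spreader's moves are legal with spread function `g` against cumulative deleted
sets `F`: occupied sets increase, at most `g (t + 1)` vertices are newly occupied at
turn `t + 1`, and each newly occupied vertex is undeleted and adjacent (with respect
to `adj`) to a previously occupied vertex. -/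
def SpreaderLegal {V : Type*} (adj : V → V → Prop) (g : ℕ → ℕ∞)
    (F B : ℕ → Set V) : Prop :=
  ∀ t : ℕ,
    B t ⊆ B (t + 1) ∧
    (B (t + 1) \ B t).encard ≤ g (t + 1) ∧
    ∀ v ∈ B (t + 1) \ B t, v ∉ F (t + 1) ∧ ∃ u ∈ B t, adj u v

/-- The Container strategy `σ` plays legally along occupied sets `B`: at every turn it
deletes only unoccupied vertices, and at most the budget of them. -/
def ContainerLegal {V : Type*} (q : ℝ) (σ : List (Set V) → Set V)
    (B : ℕ → Set V) : Prop :=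
  ∀ t : ℕ,
    σ ((List.range (t + 1)).map B) ∩ B t = ∅ ∧
    (σ ((List.range (t + 1)).map B)).encard ≤ (budget q (t + 1) : ℕ∞)

/-- Container of strength `q` wins the containment game on the graph `adj` with spread
function `g` and initial occupied set `B₀`, deleting only vertices of `A`: it has a
strategy which, against every legal Spreader play, is itself legal, deletes only
vertices of `A`, and forces the occupied set to eventually stabilize. -/
def ContainerWinsIn {V : Type*} (adj : V → V → Prop) (q : ℝ) (g : ℕ → ℕ∞)
    (B₀ : Set V) (A : Set V) : Prop :=
  ∃ σ : List (Set V) → Set V,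
    ∀ B : ℕ → Set V, B 0 = B₀ → SpreaderLegal adj g (delSets σ B) B →
      ContainerLegal q σ B ∧
      (∀ t : ℕ, σ ((List.range (t + 1)).map B) ⊆ A) ∧
      ∃ T : ℕ, ∀ t : ℕ, T ≤ t → B t = B T

/-- Container of strength `q` wins the containment game `(adj, q, g)` with initial
occupied set `B₀`. -/
def ContainerWins {V : Type*} (adj : V → V → Prop) (q : ℝ) (g : ℕ → ℕ∞)
    (B₀ : Set V) : Prop :=
  ContainerWinsIn adj q g B₀ Set.univ

/-- `q(G, g)`: the set of strengths `q > 0` for which Container wins the containment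
game `(adj, q, g)` from every finite initial occupied set. -/
def qSet {V : Type*} (adj : V → V → Prop) (g : ℕ → ℕ∞) : Set ℝ :=
  {q | 0 < q ∧ ∀ B₀ : Set V, B₀.Finite → ContainerWins adj q g B₀}

/-- The occupied sets determined by a Spreader strategy `τ` (mapping the history
`[F 1, …, F (t + 1)]` of cumulative deleted sets to the set of vertices newly occupied
at turn `t + 1`) against deleted sets `F`, starting from `B₀`. -/
def occSets {V : Type*} (τ : List (Set V) → Set V) (B₀ : Set V)
    (F : ℕ → Set V) : ℕ → Set V
  | 0 => B₀
  | t + 1 => occSets τ B₀ F t ∪ τ ((List.range (t + 1)).map fun i => F (i + 1))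

/-- The sequence `F` of cumulative deleted sets is a legal play of Container of
strength `q` against occupied sets `B`. -/
def ContainerSeqLegal {V : Type*} (q : ℝ) (F B : ℕ → Set V) : Prop :=
  F 0 = ∅ ∧ ∀ t : ℕ,
    F t ⊆ F (t + 1) ∧
    (F (t + 1) \ F t).encard ≤ (budget q (t + 1) : ℕ∞) ∧
    (F (t + 1) \ F t) ∩ B t = ∅

/-- Spreader wins the containment game `(adj, q, g)` with initial occupied set `B₀`:
it has a strategy which, against every legal Container play, is itself legal and
occupies new vertices at arbitrarily late times. -/
def SpreaderWins {V : Type*} (adj : V → V → Prop) (q : ℝ) (g : ℕ → ℕ∞)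
    (B₀ : Set V) : Prop :=
  ∃ τ : List (Set V) → Set V,
    ∀ F : ℕ → Set V, ContainerSeqLegal q F (occSets τ B₀ F) →
      SpreaderLegal adj g F (occSets τ B₀ F) ∧
      ∀ T : ℕ, ∃ t : ℕ, T ≤ t ∧ occSets τ B₀ F t ≠ occSets τ B₀ F T

/-- The strongly connected grid `ℤ ⊠ ℤ`. -/
def adjStrong (p q : ℤ × ℤ) : Prop :=
  max |p.1 - q.1| |p.2 - q.2| = 1

/-- The vertices of the eighth plane: `{(x, y) ∈ ℤ² : 0 ≤ x ≤ y}`. -/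
abbrev ZEighth : Type := {p : ℤ × ℤ // 0 ≤ p.1 ∧ p.1 ≤ p.2}

/-- The edges of the eighth plane: `(x, y) ~ (x + i, y + 1)` for `i ∈ {0, 1}`. -/
def adjEighth (p q : ZEighth) : Prop :=
  (q.val.2 = p.val.2 + 1 ∧ (q.val.1 = p.val.1 ∨ q.val.1 = p.val.1 + 1)) ∨
  (p.val.2 = q.val.2 + 1 ∧ (p.val.1 = q.val.1 ∨ p.val.1 = q.val.1 + 1))

open Set

namespace Contain

open Classical in
theorem grow_aux (f : ℤ → ℤ) (hf : Monotone f) (c : ℤ) (I A : Finset ℤ)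
    (hI : ∀ x, x ∈ I ↔ f x = c) (hAI : A ⊆ I) (hA : A.Nonempty) :
    min I.card (A.card + 1) ≤ (I.filter (fun x => x ∈ A ∨ x - 1 ∈ A ∨ x + 1 ∈ A)).card := by
  have hsub : A ⊆ I.filter (fun x => x ∈ A ∨ x - 1 ∈ A ∨ x + 1 ∈ A) := by
    intro x hx
    rw [Finset.mem_filter]
    exact ⟨hAI hx, Or.inl hx⟩
  by_cases hEq : A = I
  · have := Finset.card_le_card hsub
    rw [hEq] at this ⊢
    omega
  · have : ∃ y ∈ I, y ∉ A := by
      by_contra hcon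
      push Not at hcon
      exact hEq (Finset.Subset.antisymm hAI hcon)
    obtain ⟨y, hyI, hyA⟩ := this
    obtain ⟨x, hxA⟩ := hA
    have key : ∃ w ∈ I, w ∉ A ∧ (w - 1 ∈ A ∨ w + 1 ∈ A) := by
      rcases lt_or_ge x y with hxy | hxy
      · have hne : (A.filter (fun w => w < y)).Nonempty := ⟨x, by simp [hxA, hxy]⟩
        set m := (A.filter (fun w => w < y)).max' hne with hm
        have hmem := Finset.max'_mem _ hne
        rw [← hm, Finset.mem_filter] at hmem
        refine ⟨m + 1, ?_, ?_, Or.inl (by simpa using hmem.1)⟩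
        · rw [hI]
          have h1 := (hI m).1 (hAI hmem.1)
          have h2 := (hI y).1 hyI
          have h3 : f m ≤ f (m + 1) := hf (by omega)
          have h4 : f (m + 1) ≤ f y := hf (by omega)
          omega
        · intro hmA
          rcases eq_or_ne (m + 1) y with h | h
          · exact hyA (h ▸ hmA)
          · have : m + 1 ≤ m := Finset.le_max' _ _ (by
              rw [Finset.mem_filter]; exact ⟨hmA, by omega⟩)
            omega
      · have hxy' : y < x := lt_of_le_of_ne hxy (fun h => hyA (h ▸ hxA))
        have hne : (A.filter (fun w => y < w)).Nonempty := ⟨x, by simp [hxA, hxy']⟩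
        set m := (A.filter (fun w => y < w)).min' hne with hm
        have hmem := Finset.min'_mem _ hne
        rw [← hm, Finset.mem_filter] at hmem
        refine ⟨m - 1, ?_, ?_, Or.inr (by simpa using hmem.1)⟩
        · rw [hI]
          have h1 := (hI m).1 (hAI hmem.1)
          have h2 := (hI y).1 hyI
          have h3 : f (m - 1) ≤ f m := hf (by omega)
          have h4 : f y ≤ f (m - 1) := hf (by omega)
          omega
        · intro hmA
          rcases eq_or_ne (m - 1) y with h | h
          · exact hyA (h ▸ hmA)
          · have : m ≤ m - 1 := Finset.min'_le _ _ (by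
              rw [Finset.mem_filter]; exact ⟨hmA, by omega⟩)
            omega
    obtain ⟨w, hwI, hwA, hadj⟩ := key
    have hsub2 : insert w A ⊆ I.filter (fun x => x ∈ A ∨ x - 1 ∈ A ∨ x + 1 ∈ A) := by
      intro v hv
      rcases Finset.mem_insert.1 hv with h | h
      · subst h
        rw [Finset.mem_filter]
        exact ⟨hwI, Or.inr hadj⟩
      · exact hsub h
    have := Finset.card_le_card hsub2
    rw [Finset.card_insert_of_notMem hwA] at this
    omega

open Classical in
theorem grow_step (f : ℤ → ℤ) (hf : Monotone f) (c : ℤ) (I R R' : Finset ℤ) (del : ℤ → Prop)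
    (hI : ∀ x, x ∈ I ↔ f x = c) (hR : (R ∩ I).Nonempty)
    (hR' : ∀ x ∈ I, (x ∈ R ∨ x - 1 ∈ R ∨ x + 1 ∈ R) → ¬ del x → x ∈ R') :
    min I.card ((R ∩ I).card + 1) ≤ (R' ∩ I).card + (I.filter del).card := by
  refine le_trans (grow_aux f hf c I (R ∩ I) hI Finset.inter_subset_right hR) ?_
  refine le_trans (Finset.card_le_card ?_) (Finset.card_union_le _ _)
  intro x hx
  simp only [Finset.mem_filter, Finset.mem_inter, Finset.mem_union] at hx ⊢
  by_cases hd : del x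
  · exact Or.inr ⟨hx.1, hd⟩
  · refine Or.inl ⟨hR' x hx.1 ?_ hd, hx.1⟩
    tauto

open Classical in
theorem keep_step (I R R' : Finset ℤ) (del : ℤ → Prop)
    (hR' : ∀ x ∈ I, (x ∈ R ∨ x - 1 ∈ R ∨ x + 1 ∈ R) → ¬ del x → x ∈ R') :
    (R ∩ I).card ≤ (R' ∩ I).card + (I.filter del).card := by
  refine le_trans (Finset.card_le_card ?_) (Finset.card_union_le _ _)
  intro x hx
  simp only [Finset.mem_filter, Finset.mem_inter, Finset.mem_union] at hx ⊢
  by_cases hd : del x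
  · exact Or.inr ⟨hx.2, hd⟩
  · exact Or.inl ⟨hR' x hx.2 (Or.inl hx.1) hd, hx.2⟩

structure Zoning where
  zt : ℤ → ℤ
  zt_mono : Monotone zt
  zf : ℤ → Finset ℤ
  mem_zf : ∀ x z, x ∈ zf z ↔ zt x = z
  bt : ℤ → ℤ
  bt_mono : Monotone bt
  bf : ℤ → Finset ℤ
  mem_bf : ∀ x b, x ∈ bf b ↔ bt x = b
  bt_zt : ∀ x y, bt x = bt y → zt x = zt y
  ell : ℤ → ℕ
  ell_pos : ∀ z, 1 ≤ ell z
  bf_card : ∀ x, (bf (bt x)).card ≤ ell (zt x)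
  nb_card : ∀ z, ((zf z).image bt).card ≤ ell z ^ 2
  zf_card : ∀ z, (zf z).card ≤ ell z ^ 3

namespace Zoning
def hh (Z : Zoning) (z : ℤ) : ℕ := Z.ell z + 3 * Z.ell z ^ 2
def tt (Z : Zoning) (z : ℤ) : ℕ := 3 * Z.hh z + 1
end Zoning

/-- no deletion in column `x` in the `h` rows following row `r` -/
def clr (F : Set (ℤ × ℤ)) (r : ℤ) (h : ℕ) (x : ℤ) : Prop :=
  ∀ i : ℕ, i < h → (x, r + 1 + i) ∉ F

theorem clr_zero (F : Set (ℤ × ℤ)) (r : ℤ) (x : ℤ) : clr F r 0 x := by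
  intro i hi; omega

theorem clr_mono {F : Set (ℤ × ℤ)} {r : ℤ} {h k : ℕ} {x : ℤ} (hk : k ≤ h) (hc : clr F r h x) :
    clr F r k x := fun i hi => hc i (by omega)

theorem clr_sub {F F' : Set (ℤ × ℤ)} (hF : F ⊆ F') {r : ℤ} {h : ℕ} {x : ℤ}
    (hc : clr F' r h x) : clr F r h x := fun i hi hx => hc i hi (hF hx)

theorem clr_succ {F : Set (ℤ × ℤ)} {r : ℤ} {h : ℕ} {x : ℤ} :
    clr F r (h + 1) x ↔ (x, r + 1) ∉ F ∧ clr F (r + 1) h x := by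
  constructor
  · intro hc
    refine ⟨by simpa using hc 0 (by omega), ?_⟩
    intro i hi
    have := hc (i + 1) (by omega)
    rw [show r + 1 + 1 + (i : ℤ) = r + 1 + ((i + 1 : ℕ) : ℤ) by push_cast; ring]
    exact this
  · rintro ⟨h0, h1⟩ i hi
    rcases i with _ | i
    · simpa using h0
    · have := h1 i (by omega)
      rw [show r + 1 + ((i + 1 : ℕ) : ℤ) = r + 1 + 1 + (i : ℤ) by push_cast; ring]
      exact this

theorem clr_new {F F' : Set (ℤ × ℤ)} {Nw : Finset (ℤ × ℤ)} (hN : ∀ p ∈ F', p ∈ F ∨ p ∈ Nw)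
    {r : ℤ} {h : ℕ} {x : ℤ} (hx : ∀ p ∈ Nw, p.1 ≠ x) (hc : clr F r h x) : clr F' r h x := by
  intro i hi hm
  rcases hN _ hm with h1 | h1
  · exact hc i hi h1
  · exact hx _ h1 rfl

open Classical in
theorem exists_best (F : Set (ℤ × ℤ)) (r : ℤ) (A : Finset ℤ) (hA : A.Nonempty) :
    ∃ x ∈ A, ∀ h, ∀ y ∈ A, clr F r h y → clr F r h x := by
  induction hA using Finset.Nonempty.cons_induction with
  | singleton a => exact ⟨a, by simp, by intro h y hy; simp at hy; subst hy; exact id⟩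
  | cons a s ha hs ih =>
    obtain ⟨x, hx, hbest⟩ := ih
    by_cases hc : ∀ h, clr F r h a → clr F r h x
    · refine ⟨x, by simp [hx], ?_⟩
      intro h y hy
      rcases Finset.mem_cons.1 hy with rfl | hy
      · exact hc h
      · exact hbest h y hy
    · push Not at hc
      obtain ⟨h0, h1, h2⟩ := hc
      refine ⟨a, by simp, ?_⟩
      intro h y hy hcl
      rcases Finset.mem_cons.1 hy with rfl | hy
      · exact hcl
      · have := hbest h y hy hcl
        rcases le_total h h0 with hle | hle
        · exact clr_mono hle h1
        · exact absurd (clr_mono hle this) h2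

open Classical in
theorem exists_top (F : Set (ℤ × ℤ)) (r : ℤ) (T : ℕ) : ∀ A : Finset ℤ,
    ∃ H ⊆ A, H.card ≤ T ∧
      ∀ h, min T (A.filter (fun x => clr F r h x)).card ≤ (H.filter (fun x => clr F r h x)).card := by
  induction T with
  | zero => intro A; exact ⟨∅, by simp, by simp, by simp⟩
  | succ T ih =>
    intro A
    rcases A.eq_empty_or_nonempty with rfl | hA
    · exact ⟨∅, by simp, by simp, by simp⟩
    obtain ⟨x, hx, hb⟩ := exists_best F r A hA
    obtain ⟨H, hHA, hHc, hH⟩ := ih (A.erase x)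
    have hxH : x ∉ H := fun h => by simpa using hHA h
    refine ⟨insert x H, ?_, ?_, ?_⟩
    · intro y hy
      rcases Finset.mem_insert.1 hy with rfl | hy
      · exact hx
      · exact Finset.mem_of_mem_erase (hHA hy)
    · rw [Finset.card_insert_of_notMem hxH]; omega
    · intro h
      have := hH h
      by_cases hcx : clr F r h x
      · rw [Finset.filter_insert, if_pos hcx, Finset.card_insert_of_notMem (by simp [hxH])]
        have h2 : (A.filter (fun x => clr F r h x)).card ≤
            ((A.erase x).filter (fun x => clr F r h x)).card + 1 := by
          rw [Finset.filter_erase]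
          have := Finset.pred_card_le_card_erase (s := A.filter (fun x => clr F r h x)) (a := x)
          omega
        omega
      · have : (A.filter (fun x => clr F r h x)) = ∅ := by
          rw [Finset.filter_eq_empty_iff]
          intro y hy hc
          exact hcx (hb h y hy hc)
        rw [this]; simp

open Classical in
def HoldOK (Z : Zoning) (z : ℤ) (F : Set (ℤ × ℤ)) (r : ℤ) (A H : Finset ℤ) : Prop :=
  H ⊆ A ∧
  (∀ h, ∀ y ∈ A, clr F r h y → ∃ x ∈ H, Z.bt x = Z.bt y ∧ clr F r h x) ∧
  (∀ h, min (Z.tt z) (A.filter (fun x => clr F r h x)).card ≤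
      (H.filter (fun x => clr F r h x)).card) ∧
  H.card ≤ Z.ell z ^ 2 + Z.tt z

open Classical in
theorem exists_hold (Z : Zoning) (z : ℤ) (F : Set (ℤ × ℤ)) (r : ℤ) (A : Finset ℤ)
    (hA : A ⊆ Z.zf z) : ∃ H, HoldOK Z z F r A H := by
  obtain ⟨H1, h1, h2, h3⟩ := exists_top F r (Z.tt z) A
  have hb : ∀ b ∈ A.image Z.bt, ∃ x ∈ A, Z.bt x = b ∧
      ∀ h, ∀ y ∈ A, Z.bt y = b → clr F r h y → clr F r h x := by
    intro b hb
    obtain ⟨y, hy, rfl⟩ := Finset.mem_image.1 hb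
    obtain ⟨x, hx, hbest⟩ := exists_best F r (A.filter (fun w => Z.bt w = Z.bt y))
      ⟨y, by simp [hy]⟩
    rw [Finset.mem_filter] at hx
    refine ⟨x, hx.1, hx.2, ?_⟩
    intro h w hw hwb hc
    exact hbest h w (by simp [hw, hwb]) hc
  choose! g hg1 hg2 hg3 using hb
  refine ⟨H1 ∪ (A.image Z.bt).image g, ?_, ?_, ?_, ?_⟩
  · intro x hx
    rcases Finset.mem_union.1 hx with hx | hx
    · exact h1 hx
    · obtain ⟨b, hb, rfl⟩ := Finset.mem_image.1 hx
      exact hg1 b hb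
  · intro h y hy hc
    have hyb : Z.bt y ∈ A.image Z.bt := Finset.mem_image_of_mem _ hy
    refine ⟨g (Z.bt y), Finset.mem_union_right _ (Finset.mem_image_of_mem _ hyb), hg2 _ hyb, ?_⟩
    exact hg3 _ hyb h y hy rfl hc
  · intro h
    refine le_trans (h3 h) (Finset.card_le_card ?_)
    exact Finset.filter_subset_filter _ Finset.subset_union_left
  · have e1 : ((A.image Z.bt).image g).card ≤ Z.ell z ^ 2 :=
      le_trans Finset.card_image_le (le_trans (Finset.card_le_card
        (Finset.image_subset_image hA)) (Z.nb_card z))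
    have e2 := Finset.card_union_le H1 ((A.image Z.bt).image g)
    omega

open Classical in
theorem hold_step (Z : Zoning) (z : ℤ) (F F' : Set (ℤ × ℤ)) (r : ℤ) (A H : Finset ℤ)
    (hF : F ⊆ F') (Nw : Finset (ℤ × ℤ)) (hN : ∀ p ∈ F', p ∈ F ∨ p ∈ Nw)
    (hA : A ⊆ Z.zf z) (hno : ∀ p ∈ Nw, Z.zt p.1 ≠ z) (hok : HoldOK Z z F r A H) :
    HoldOK Z z F' (r + 1) (A.filter (fun x => (x, r + 1) ∉ F'))
      (H.filter (fun x => (x, r + 1) ∉ F')) := by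
  obtain ⟨h1, h2, h3, h4⟩ := hok
  have key : ∀ x ∈ A, ∀ h, (clr F r h x ↔ clr F' r h x) := by
    intro x hx h
    refine ⟨clr_new hN ?_, clr_sub hF⟩
    intro p hp he
    exact hno p hp (by rw [he]; exact (Z.mem_zf _ _).1 (hA hx))
  have key2 : ∀ x ∈ A, ∀ h, (clr F r (h + 1) x ↔ (x, r + 1) ∉ F' ∧ clr F' (r + 1) h x) := by
    intro x hx h
    rw [key x hx, clr_succ]
  refine ⟨Finset.filter_subset_filter _ h1, ?_, ?_, ?_⟩
  · intro h y hy hc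
    rw [Finset.mem_filter] at hy
    obtain ⟨x, hx, hb, hcx⟩ := h2 (h + 1) y hy.1 ((key2 y hy.1 h).2 ⟨hy.2, hc⟩)
    have := (key2 x (h1 hx) h).1 hcx
    exact ⟨x, by rw [Finset.mem_filter]; exact ⟨hx, this.1⟩, hb, this.2⟩
  · intro h
    have e : ∀ S ⊆ A, ((S.filter (fun x => (x, r + 1) ∉ F')).filter
        (fun x => clr F' (r + 1) h x)) = S.filter (fun x => clr F r (h + 1) x) := by
      intro S hS
      ext x
      simp only [Finset.mem_filter]
      constructor
      · rintro ⟨⟨a, b⟩, c⟩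
        exact ⟨a, (key2 x (hS a) h).2 ⟨b, c⟩⟩
      · rintro ⟨a, b⟩
        have := (key2 x (hS a) h).1 b
        exact ⟨⟨a, this.1⟩, this.2⟩
    rw [e A le_rfl, e H h1]
    exact h3 (h + 1)
  · exact le_trans (Finset.card_le_card (Finset.filter_subset _ _)) h4

open Classical in
noncomputable def Kc (Z : Zoning) (F : Set (ℤ × ℤ)) (r : ℤ) (z : ℤ) (h : ℕ) : ℕ :=
  ((Z.zf z ×ˢ Finset.range h).filter (fun p => (p.1, r + 1 + (p.2 : ℤ)) ∈ F)).card

open Classical in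
noncomputable def dz (Z : Zoning) (F : Set (ℤ × ℤ)) (r : ℤ) (z : ℤ) : ℕ :=
  ((Z.zf z).filter (fun x => (x, r + 1) ∈ F)).card

noncomputable def nw (Z : Zoning) (Nw : Finset (ℤ × ℤ)) (z : ℤ) : ℕ :=
  (Nw.filter (fun p => Z.zt p.1 = z)).card

theorem Kc_zero (Z : Zoning) (F : Set (ℤ × ℤ)) (r : ℤ) (z : ℤ) : Kc Z F r z 0 = 0 := by
  simp [Kc]

open Classical in
theorem Kc_step (Z : Zoning) (F F' : Set (ℤ × ℤ)) (r : ℤ) (z : ℤ) (h : ℕ)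
    (Nw : Finset (ℤ × ℤ)) (hN : ∀ p ∈ F', p ∈ F ∨ p ∈ Nw) :
    dz Z F' r z + Kc Z F' (r + 1) z h ≤ Kc Z F r z (h + 1) + nw Z Nw z := by
  have e1 : dz Z F' r z + Kc Z F' (r + 1) z h ≤ Kc Z F' r z (h + 1) := by
    unfold dz Kc
    have i1 : (((Z.zf z).filter (fun x => (x, r + 1) ∈ F')).image (fun x => (x, 0))).card =
        ((Z.zf z).filter (fun x => (x, r + 1) ∈ F')).card :=
      Finset.card_image_of_injective _ (fun a b h => by simpa using h)
    have i2 : (((Z.zf z ×ˢ Finset.range h).filter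
        (fun p => (p.1, r + 1 + 1 + (p.2 : ℤ)) ∈ F')).image (fun p : ℤ × ℕ => (p.1, p.2 + 1))).card =
        ((Z.zf z ×ˢ Finset.range h).filter
        (fun p => (p.1, r + 1 + 1 + (p.2 : ℤ)) ∈ F')).card :=
      Finset.card_image_of_injective _ (fun a b h => by
        rcases a with ⟨a1, a2⟩; rcases b with ⟨b1, b2⟩; simp at h ⊢; exact h)
    rw [← i1, ← i2, ← Finset.card_union_of_disjoint]
    · apply Finset.card_le_card
      intro p hp
      simp only [Finset.mem_union, Finset.mem_image, Finset.mem_filter, Finset.mem_product,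
        Finset.mem_range] at hp ⊢
      rcases hp with ⟨x, ⟨hx, hxF⟩, rfl⟩ | ⟨q, ⟨⟨hq1, hq2⟩, hqF⟩, rfl⟩
      · exact ⟨⟨hx, by omega⟩, by simpa using hxF⟩
      · refine ⟨⟨hq1, by omega⟩, ?_⟩
        rw [show r + 1 + ((q.2 + 1 : ℕ) : ℤ) = r + 1 + 1 + (q.2 : ℤ) by push_cast; ring]
        exact hqF
    · rw [Finset.disjoint_left]
      intro p hp hq
      simp only [Finset.mem_image] at hp hq
      obtain ⟨x, _, rfl⟩ := hp
      obtain ⟨q, _, hq⟩ := hq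
      simp at hq
  refine le_trans e1 ?_
  have e2 : (Z.zf z ×ˢ Finset.range (h + 1)).filter (fun p => (p.1, r + 1 + (p.2 : ℤ)) ∈ F') ⊆
      (Z.zf z ×ˢ Finset.range (h + 1)).filter (fun p => (p.1, r + 1 + (p.2 : ℤ)) ∈ F) ∪
      (Z.zf z ×ˢ Finset.range (h + 1)).filter (fun p => (p.1, r + 1 + (p.2 : ℤ)) ∈ Nw) := by
    intro p hp
    simp only [Finset.mem_union, Finset.mem_filter] at hp ⊢
    rcases hN _ hp.2 with h | h
    · exact Or.inl ⟨hp.1, h⟩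
    · exact Or.inr ⟨hp.1, h⟩
  refine le_trans (Finset.card_le_card e2) (le_trans (Finset.card_union_le _ _) ?_)
  have e3 : ((Z.zf z ×ˢ Finset.range (h + 1)).filter
      (fun p => (p.1, r + 1 + (p.2 : ℤ)) ∈ Nw)).card ≤ nw Z Nw z := by
    unfold nw
    apply Finset.card_le_card_of_injOn (fun p : ℤ × ℕ => (p.1, r + 1 + (p.2 : ℤ)))
    · intro p hp
      simp only [Finset.coe_filter, Set.mem_ofPred_eq, Finset.mem_product] at hp ⊢
      exact ⟨hp.2, (Z.mem_zf _ _).1 hp.1.1⟩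
    · intro p _ q _ h
      rcases p with ⟨p1, p2⟩; rcases q with ⟨q1, q2⟩
      simp at h ⊢
      exact h
  unfold Kc
  omega

theorem sum_nw_le (Z : Zoning) (Nw : Finset (ℤ × ℤ)) (Zs : Finset ℤ) :
    ∑ z ∈ Zs, nw Z Nw z ≤ Nw.card := by
  unfold nw
  rw [← Finset.card_biUnion]
  · apply Finset.card_le_card
    intro p hp
    simp only [Finset.mem_biUnion, Finset.mem_filter] at hp
    obtain ⟨_, _, h, _⟩ := hp
    exact h
  · intro x _ y _ hxy
    rw [Function.onFun, Finset.disjoint_left]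
    intro p hp hq
    simp only [Finset.mem_filter] at hp hq
    exact hxy (hp.2.symm.trans hq.2)

end Contain

open Set

namespace Contain

structure ZD where
  A : Finset ℤ
  H : Finset ℤ
  c : ℤ → ℕ
  age : ℕ
  del : ℕ
  ex : Prop

open Classical in
noncomputable def hit (F : Set (ℤ × ℤ)) (r : ℤ) (x : ℤ) : ℕ := if (x, r + 1) ∈ F then 1 else 0

open Classical in
theorem sum_hit (F : Set (ℤ × ℤ)) (r : ℤ) (c : ℤ → ℕ) (I : Finset ℤ) :
    ∑ x ∈ I, (c x + hit F r x) = ∑ x ∈ I, c x + (I.filter (fun x => (x, r + 1) ∈ F)).card := by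
  rw [Finset.sum_add_distrib]
  congr 1
  unfold hit
  rw [Finset.card_filter]

def al (c : ℤ → ℕ) (S : Finset ℤ) : Finset ℤ := S.filter (fun x => c x = 0)

theorem mem_al {c : ℤ → ℕ} {S : Finset ℤ} {x : ℤ} : x ∈ al c S ↔ x ∈ S ∧ c x = 0 := by
  simp [al]

theorem al_hit (F : Set (ℤ × ℤ)) (r : ℤ) (c : ℤ → ℕ) (S : Finset ℤ) (x : ℤ) :
    x ∈ al (fun x => c x + hit F r x) S ↔ x ∈ al c S ∧ (x, r + 1) ∉ F := by
  simp only [mem_al, hit]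
  split_ifs with h <;> simp [h]

theorem card_le_al (c : ℤ → ℕ) (S I : Finset ℤ) (h : S ⊆ I) :
    S.card ≤ (al c S).card + ∑ x ∈ I, c x := by
  have h1 : S.card = (al c S).card + (S.filter (fun x => ¬ c x = 0)).card :=
    (Finset.card_filter_add_card_filter_not _).symm
  have h2 : (S.filter (fun x => ¬ c x = 0)).card ≤ ∑ x ∈ S.filter (fun x => ¬ c x = 0), c x := by
    rw [Finset.card_eq_sum_ones]
    apply Finset.sum_le_sum
    intro x hx
    rw [Finset.mem_filter] at hx
    omega
  have h3 : ∑ x ∈ S.filter (fun x => ¬ c x = 0), c x ≤ ∑ x ∈ I, c x :=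
    Finset.sum_le_sum_of_subset (fun x hx => h (Finset.mem_filter.1 hx).1)
  omega

open Classical in
noncomputable def badB (Z : Zoning) (z : ℤ) (F : Set (ℤ × ℤ)) (r : ℤ) (A H : Finset ℤ) (c : ℤ → ℕ)
    (h : ℕ) : Finset ℤ :=
  ((Z.zf z).image Z.bt).filter (fun b => (∃ x ∈ al c A, Z.bt x = b ∧ clr F r h x) ∧
    ¬ ∃ x ∈ al c H, Z.bt x = b ∧ clr F r h x)

def alt1 (F : Set (ℤ × ℤ)) (r : ℤ) (A H : Finset ℤ) (c : ℤ → ℕ) (h : ℕ) : Prop :=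
  ∀ x ∈ al c A, clr F r h x → x ∈ H

open Classical in
structure NE (Z : Zoning) (z : ℤ) (F : Set (ℤ × ℤ)) (r : ℤ) (R : Finset ℤ) (n : ℕ)
    (A H : Finset ℤ) (c : ℤ → ℕ) (i : ℕ) : Prop where
  hHA : H ⊆ A
  hA : A ⊆ Z.zf z
  J : n + ∑ x ∈ Z.zf z, c x ≤ A.card
  I1 : ∀ x ∈ al c H, x ∈ R
  I2 : i ≤ Z.ell z → ∀ y ∈ al c H, min (Z.bf (Z.bt y)).card (1 + i) ≤
    (R ∩ Z.bf (Z.bt y)).card + ∑ x ∈ Z.bf (Z.bt y), c x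
  I3 : i ≤ Z.ell z → (badB Z z F r A H c (Z.ell z - i)).card ≤ 3 * i
  I4 : alt1 F r A H c (Z.hh z - i) ∨
    Z.tt z ≤ ((al c H).filter (fun x => clr F r (Z.hh z - i) x)).card + 3 * i
  I5 : Z.ell z ≤ i → alt1 F r A H c (Z.hh z - i) ∨ A.card ≤ (R ∩ Z.zf z).card + ∑ x ∈ Z.zf z, c x ∨
    A.card + (i - Z.ell z) ≤ (R ∩ Z.zf z).card + ∑ x ∈ Z.zf z, c x + 3 * Z.ell z ^ 2

theorem zf_sum_bf (Z : Zoning) (z : ℤ) (f : ℤ → ℕ) :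
    ∑ b ∈ (Z.zf z).image Z.bt, ∑ x ∈ Z.bf b, f x = ∑ x ∈ Z.zf z, f x := by
  rw [← Finset.sum_fiberwise_of_maps_to (g := Z.bt) (t := (Z.zf z).image Z.bt)
    (fun x hx => Finset.mem_image_of_mem _ hx)]
  apply Finset.sum_congr rfl
  intro b hb
  apply Finset.sum_congr _ (fun _ _ => rfl)
  obtain ⟨y, hy, rfl⟩ := Finset.mem_image.1 hb
  ext x
  rw [Z.mem_bf, Finset.mem_filter, Z.mem_zf]
  constructor
  · intro h
    exact ⟨(Z.bt_zt _ _ h).trans ((Z.mem_zf _ _).1 hy), h⟩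
  · exact fun h => h.2

open Classical in
theorem card_sum_bf (Z : Zoning) (z : ℤ) (S : Finset ℤ) :
    (S ∩ Z.zf z).card = ∑ b ∈ (Z.zf z).image Z.bt, (S ∩ Z.bf b).card := by
  have := zf_sum_bf Z z (fun x => if x ∈ S then 1 else 0)
  simp only [← Finset.card_filter] at this
  rw [Finset.inter_comm, ← Finset.filter_mem_eq_inter, ← this]
  apply Finset.sum_congr rfl
  intro b _
  rw [Finset.inter_comm, ← Finset.filter_mem_eq_inter]

/-- the fire lemma: state at age `ell`. -/
theorem fire_ell (Z : Zoning) (z : ℤ) (F : Set (ℤ × ℤ)) (r : ℤ) (R : Finset ℤ)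
    (A H : Finset ℤ) (c : ℤ → ℕ) (hA : A ⊆ Z.zf z)
    (I2 : ∀ y ∈ al c H, min (Z.bf (Z.bt y)).card (1 + Z.ell z) ≤
      (R ∩ Z.bf (Z.bt y)).card + ∑ x ∈ Z.bf (Z.bt y), c x) (hHA : H ⊆ A)
    (I3 : (badB Z z F r A H c 0).card ≤ 3 * Z.ell z) :
    A.card ≤ (R ∩ Z.zf z).card + ∑ x ∈ Z.zf z, c x + 3 * Z.ell z ^ 2 := by
  classical
  have e1 : A.card = ∑ b ∈ (Z.zf z).image Z.bt, (A ∩ Z.bf b).card := by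
    rw [← card_sum_bf, Finset.inter_eq_left.2 hA]
  rw [e1, card_sum_bf, ← zf_sum_bf, ← Finset.sum_add_distrib]
  have e2 : ∑ b ∈ (Z.zf z).image Z.bt, (if b ∈ badB Z z F r A H c 0 then Z.ell z else 0) ≤
      3 * Z.ell z ^ 2 := by
    rw [← Finset.sum_filter, Finset.sum_const, smul_eq_mul]
    have : (((Z.zf z).image Z.bt).filter (fun b => b ∈ badB Z z F r A H c 0)).card ≤ 3 * Z.ell z :=
      le_trans (Finset.card_le_card (fun b hb => (Finset.mem_filter.1 hb).2)) I3
    nlinarith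
  refine le_trans ?_ (Nat.add_le_add_left e2 _)
  rw [← Finset.sum_add_distrib]
  apply Finset.sum_le_sum
  intro b hb
  obtain ⟨w, hw, rfl⟩ := Finset.mem_image.1 hb
  have hwz := (Z.mem_zf _ _).1 hw
  have hcard : (Z.bf (Z.bt w)).card ≤ Z.ell z := hwz ▸ Z.bf_card w
  have hle : (A ∩ Z.bf (Z.bt w)).card ≤ (Z.bf (Z.bt w)).card :=
    Finset.card_le_card Finset.inter_subset_right
  by_cases h1 : ∃ y ∈ al c H, Z.bt y = Z.bt w
  · obtain ⟨y, hy, hyw⟩ := h1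
    have := I2 y hy
    rw [hyw] at this
    omega
  · by_cases h2 : ∃ x ∈ al c A, Z.bt x = Z.bt w
    · have : Z.bt w ∈ badB Z z F r A H c 0 := by
        unfold badB
        rw [Finset.mem_filter]
        refine ⟨hb, ?_, ?_⟩
        · obtain ⟨x, hx, hxw⟩ := h2
          exact ⟨x, hx, hxw, clr_zero _ _ _⟩
        · rintro ⟨x, hx, hxw, _⟩
          exact h1 ⟨x, hx, hxw⟩
      rw [if_pos this]
      omega
    · have h3 := card_le_al c (A ∩ Z.bf (Z.bt w)) (Z.bf (Z.bt w)) Finset.inter_subset_right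
      have h4 : al c (A ∩ Z.bf (Z.bt w)) = ∅ := by
        rw [Finset.eq_empty_iff_forall_notMem]
        intro x hx
        rw [mem_al, Finset.mem_inter, Z.mem_bf] at hx
        exact h2 ⟨x, mem_al.2 ⟨hx.1.1, hx.2⟩, hx.1.2⟩
      rw [h4] at h3
      simp at h3
      omega

theorem NE_exact {Z : Zoning} {z : ℤ} {F : Set (ℤ × ℤ)} {r : ℤ} {R : Finset ℤ} {n : ℕ}
    {A H : Finset ℤ} {c : ℤ → ℕ} (h : NE Z z F r R n A H c (Z.hh z)) :
    n ≤ (R ∩ Z.zf z).card := by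
  have J := h.J
  rcases h.I5 (by unfold Zoning.hh; omega) with h1 | h1 | h1
  · have h2 := card_le_al c A _ h.hA
    have h3 : al c A ⊆ R ∩ Z.zf z := by
      intro x hx
      have hx' := mem_al.1 hx
      have : x ∈ H := h1 x hx (by rw [Nat.sub_self]; exact clr_zero _ _ _)
      exact Finset.mem_inter.2 ⟨h.I1 x (mem_al.2 ⟨this, hx'.2⟩), h.hA hx'.1⟩
    have := Finset.card_le_card h3
    omega
  · omega
  · unfold Zoning.hh at h1
    omega

open Classical in
theorem NE_step {Z : Zoning} {z : ℤ} {F F' : Set (ℤ × ℤ)} {r : ℤ} {R R' : Finset ℤ} {n n' : ℕ}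
    {A H : Finset ℤ} {c : ℤ → ℕ} {i : ℕ} (hF : F ⊆ F') (Nw : Finset (ℤ × ℤ))
    (hN : ∀ p ∈ F', p ∈ F ∨ p ∈ Nw) (hN3 : Nw.card ≤ 3) (hi : i < Z.hh z)
    (hR' : ∀ x ∈ Z.zf z, (x ∈ R ∨ x - 1 ∈ R ∨ x + 1 ∈ R) → (x, r + 1) ∉ F' → x ∈ R')
    (hn : n' + dz Z F' r z ≤ n)
    (h : NE Z z F r R n A H c i) :
    NE Z z F' (r + 1) R' n' A H (fun x => c x + hit F' r x) (i + 1) := by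
  have hHA := h.hHA
  have hA := h.hA
  have I1' : ∀ x ∈ al (fun x => c x + hit F' r x) H, x ∈ R' := by
    intro x hx
    rw [al_hit] at hx
    exact hR' x (hA (hHA (mem_al.1 hx.1).1)) (Or.inl (h.I1 x hx.1)) hx.2
  have hdz : ∑ x ∈ Z.zf z, (c x + hit F' r x) = ∑ x ∈ Z.zf z, c x + dz Z F' r z := sum_hit _ _ _ _
  have I2' : i + 1 ≤ Z.ell z → ∀ y ∈ al (fun x => c x + hit F' r x) H,
    min (Z.bf (Z.bt y)).card (1 + (i + 1)) ≤
    (R' ∩ Z.bf (Z.bt y)).card + ∑ x ∈ Z.bf (Z.bt y), (c x + hit F' r x) := by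
    intro hil y hy
    rw [al_hit] at hy
    have h2 := h.I2 (by omega) y hy.1
    have hyz : Z.zt y = z := (Z.mem_zf _ _).1 (hA (hHA (mem_al.1 hy.1).1))
    rw [sum_hit]
    have := grow_step Z.bt Z.bt_mono (Z.bt y) (Z.bf (Z.bt y)) R R' (fun x => (x, r + 1) ∈ F')
      (fun x => Z.mem_bf x _) ⟨y, Finset.mem_inter.2 ⟨h.I1 y hy.1, (Z.mem_bf _ _).2 rfl⟩⟩
      (fun x hx => hR' x ((Z.mem_zf _ _).2 ((Z.bt_zt x y ((Z.mem_bf _ _).1 hx)).trans hyz)))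
    omega
  have halt : alt1 F r A H c (Z.hh z - i) →
      alt1 F' (r + 1) A H (fun x => c x + hit F' r x) (Z.hh z - (i + 1)) := by
    intro h1 x hx hc
    rw [al_hit] at hx
    apply h1 x hx.1
    have : Z.hh z - i = Z.hh z - (i + 1) + 1 := by omega
    rw [this]
    exact clr_sub hF (clr_succ.2 ⟨hx.2, hc⟩)
  have I3' : i + 1 ≤ Z.ell z →
      (badB Z z F' (r + 1) A H (fun x => c x + hit F' r x) (Z.ell z - (i + 1))).card ≤
        3 * (i + 1) := by
    intro hil
    have h3 := h.I3 (by omega)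
    have hsub : badB Z z F' (r + 1) A H (fun x => c x + hit F' r x) (Z.ell z - (i + 1)) ⊆
        badB Z z F r A H c (Z.ell z - i) ∪ Nw.image (fun p => Z.bt p.1) := by
      intro b hb
      by_contra hcon
      rw [Finset.mem_union, not_or] at hcon
      unfold badB at hb hcon
      rw [Finset.mem_filter] at hb hcon
      obtain ⟨hbz, ⟨x, hx, hxb, hxc⟩, hno⟩ := hb
      rw [al_hit] at hx
      have e : Z.ell z - i = Z.ell z - (i + 1) + 1 := by omega
      have hno2 : ¬ ¬ ∃ x ∈ al c H, Z.bt x = b ∧ clr F r (Z.ell z - i) x := by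
        intro hno2
        refine hcon.1 ⟨hbz, ⟨x, hx.1, hxb, ?_⟩, hno2⟩
        rw [e]
        exact clr_sub hF (clr_succ.2 ⟨hx.2, hxc⟩)
      rw [not_not] at hno2
      obtain ⟨y, hy, hyb, hyc⟩ := hno2
      have hyc' : clr F' r (Z.ell z - (i + 1) + 1) y := by
        rw [← e]
        refine clr_new hN ?_ hyc
        intro p hp he
        exact hcon.2 (Finset.mem_image.2 ⟨p, hp, by simp only [he, hyb]⟩)
      rw [clr_succ] at hyc'
      exact hno ⟨y, (al_hit _ _ _ _ _).2 ⟨hy, hyc'.1⟩, hyb, hyc'.2⟩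
    have h4 := Finset.card_le_card hsub
    have h5 := Finset.card_union_le (badB Z z F r A H c (Z.ell z - i)) (Nw.image (fun p => Z.bt p.1))
    have h6 : (Nw.image (fun p => Z.bt p.1)).card ≤ Nw.card := Finset.card_image_le
    omega
  refine ⟨hHA, hA, ?_, I1', I2', I3', ?_, ?_⟩
  · have := h.J
    rw [hdz]; omega
  · rcases h.I4 with h1 | h1
    · exact Or.inl (halt h1)
    · right
      have hsub : (al c H).filter (fun x => clr F r (Z.hh z - i) x) ⊆
          (al (fun x => c x + hit F' r x) H).filter (fun x => clr F' (r + 1) (Z.hh z - (i + 1)) x) ∪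
          Nw.image Prod.fst := by
        intro x hx
        rw [Finset.mem_filter] at hx
        by_cases hxN : x ∈ Nw.image Prod.fst
        · exact Finset.mem_union_right _ hxN
        · apply Finset.mem_union_left
          have hc : clr F' r (Z.hh z - (i + 1) + 1) x := by
            rw [show Z.hh z - (i + 1) + 1 = Z.hh z - i by omega]
            refine clr_new hN ?_ hx.2
            intro p hp he
            exact hxN (Finset.mem_image.2 ⟨p, hp, he⟩)
          rw [clr_succ] at hc
          rw [Finset.mem_filter, al_hit]
          exact ⟨⟨hx.1, hc.1⟩, hc.2⟩
      have h4 := Finset.card_le_card hsub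
      have h5 := Finset.card_union_le ((al (fun x => c x + hit F' r x) H).filter
        (fun x => clr F' (r + 1) (Z.hh z - (i + 1)) x)) (Nw.image Prod.fst)
      have h6 : (Nw.image Prod.fst).card ≤ Nw.card := Finset.card_image_le
      omega
  · intro hil
    rw [hdz]
    rcases Nat.lt_or_ge i (Z.ell z) with hlt | hge
    · right; right
      have he : i + 1 = Z.ell z := by omega
      have := fire_ell Z z F' (r + 1) R' A H (fun x => c x + hit F' r x) hA
        (by have := I2' (by omega); rw [he] at this; exact this) hHA
        (by have := I3' (by omega); rw [he, Nat.sub_self] at this; exact this)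
      rw [hdz] at this
      omega
    · have hk := keep_step (Z.zf z) R R' (fun x => (x, r + 1) ∈ F') hR'
      have hdz' : ((Z.zf z).filter (fun x => (x, r + 1) ∈ F')).card = dz Z F' r z := rfl
      rw [hdz'] at hk
      rcases h.I5 hge with h1 | h1 | h1
      · exact Or.inl (halt h1)
      · right; left; omega
      · rcases h.I4 with h4 | h4
        · exact Or.inl (halt h4)
        · right
          have hne : ((al c H).filter (fun x => clr F r (Z.hh z - i) x)).Nonempty := by
            rw [← Finset.card_pos]
            unfold Zoning.tt at h4
            omega
          obtain ⟨x, hx⟩ := hne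
          rw [Finset.mem_filter] at hx
          have hg := grow_step Z.zt Z.zt_mono z (Z.zf z) R R' (fun x => (x, r + 1) ∈ F')
            (fun x => Z.mem_zf x _) ⟨x, Finset.mem_inter.2 ⟨h.I1 x hx.1, hA (hHA (mem_al.1 hx.1).1)⟩⟩
            hR'
          rw [hdz'] at hg
          have := Finset.card_le_card hA
          omega

open Classical in
theorem NE_init {Z : Zoning} {z : ℤ} {F : Set (ℤ × ℤ)} {r : ℤ} {R : Finset ℤ} {n : ℕ}
    {A H : Finset ℤ} (hA : A ⊆ Z.zf z) (hok : HoldOK Z z F r A H) (hn : n ≤ A.card)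
    (hR : H ⊆ R) : NE Z z F r R n A H (fun _ => 0) 0 := by
  obtain ⟨h1, h2, h3, h4⟩ := hok
  have ea : ∀ S, al (fun _ => 0) S = S := fun S => by simp [al]
  refine ⟨h1, hA, by simpa using hn, ?_, ?_, ?_, ?_, ?_⟩
  · rw [ea]; exact hR
  · intro _ y hy
    rw [ea] at hy
    have : 0 < (R ∩ Z.bf (Z.bt y)).card :=
      Finset.card_pos.2 ⟨y, Finset.mem_inter.2 ⟨hR hy, (Z.mem_bf _ _).2 rfl⟩⟩
    omega
  · intro _
    have : badB Z z F r A H (fun _ => 0) (Z.ell z - 0) = ∅ := by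
      unfold badB
      rw [ea, ea, Finset.filter_eq_empty_iff]
      rintro b _ ⟨⟨y, hy, hyb, hc⟩, hno⟩
      obtain ⟨x, hx, hxb, hxc⟩ := h2 _ y hy hc
      exact hno ⟨x, hx, hxb.trans hyb, hxc⟩
    rw [this]; simp
  · unfold alt1
    rw [ea, ea]
    have := h3 (Z.hh z - 0)
    rcases Nat.lt_or_ge (A.filter (fun x => clr F r (Z.hh z - 0) x)).card (Z.tt z) with hlt | hge
    · left
      intro x hx hc
      have heq : H.filter (fun x => clr F r (Z.hh z - 0) x) = A.filter (fun x => clr F r (Z.hh z - 0) x) :=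
        Finset.eq_of_subset_of_card_le (Finset.filter_subset_filter _ h1) (by omega)
      have : x ∈ H.filter (fun x => clr F r (Z.hh z - 0) x) := by
        rw [heq, Finset.mem_filter]; exact ⟨hx, hc⟩
      exact (Finset.mem_filter.1 this).1
    · right; omega
  · intro hl
    have := Z.ell_pos z
    omega

end Contain

open Set

namespace Contain

open Classical in
def AE (Z : Zoning) (F : Set (ℤ × ℤ)) (r : ℤ) (z : ℤ) (n : ℕ) (S : Finset ℤ) (h : ℕ) : Prop :=
  n ≤ Kc Z F r z h + (S.filter (fun x => clr F r h x)).card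

def PL (Z : Zoning) (F : Set (ℤ × ℤ)) (r : ℤ) (n : ℤ → ℕ) (z : ℤ) (h : ℕ) : Prop :=
  ∃ Ys : Finset ℤ, (∀ y ∈ Ys, y < z) ∧ 3 * h < ∑ y ∈ Ys, (n y - Kc Z F r y h)

def PR (Z : Zoning) (F : Set (ℤ × ℤ)) (r : ℤ) (n : ℤ → ℕ) (z : ℤ) (h : ℕ) : Prop :=
  ∃ Ys : Finset ℤ, (∀ y ∈ Ys, z < y) ∧ 3 * h < ∑ y ∈ Ys, (n y - Kc Z F r y h)

theorem psum_step (Z : Zoning) (F F' : Set (ℤ × ℤ)) (r : ℤ) (n n' : ℤ → ℕ) (h : ℕ)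
    (Nw : Finset (ℤ × ℤ)) (hN : ∀ p ∈ F', p ∈ F ∨ p ∈ Nw) (hN3 : Nw.card ≤ 3)
    (hn : ∀ y, n y ≤ n' y + dz Z F' r y) (Ys : Finset ℤ)
    (hs : 3 * (h + 1) < ∑ y ∈ Ys, (n y - Kc Z F r y (h + 1))) :
    3 * h < ∑ y ∈ Ys, (n' y - Kc Z F' (r + 1) y h) := by
  have h1 : ∑ y ∈ Ys, (n y - Kc Z F r y (h + 1)) ≤
      ∑ y ∈ Ys, ((n' y - Kc Z F' (r + 1) y h) + nw Z Nw y) := by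
    apply Finset.sum_le_sum
    intro y _
    have := Kc_step Z F F' r y h Nw hN
    have := hn y
    omega
  rw [Finset.sum_add_distrib] at h1
  have := sum_nw_le Z Nw Ys
  omega

theorem psum_mono (Z : Zoning) (F : Set (ℤ × ℤ)) (r : ℤ) (n n' : ℤ → ℕ) (h : ℕ)
    (hn : ∀ y, n y ≤ n' y) (Ys : Finset ℤ) :
    ∑ y ∈ Ys, (n y - Kc Z F r y h) ≤ ∑ y ∈ Ys, (n' y - Kc Z F r y h) := by
  apply Finset.sum_le_sum
  intro y _
  have := hn y
  omega

open Classical in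
theorem Kc_succ (Z : Zoning) (F : Set (ℤ × ℤ)) (r : ℤ) (z : ℤ) (h : ℕ) :
    Kc Z F r z (h + 1) ≤ dz Z F r z + Kc Z F (r + 1) z h := by
  unfold dz Kc
  have hsub : (Z.zf z ×ˢ Finset.range (h + 1)).filter (fun p => (p.1, r + 1 + (p.2 : ℤ)) ∈ F) ⊆
      ((Z.zf z).filter (fun x => (x, r + 1) ∈ F)).image (fun x => (x, 0)) ∪
      ((Z.zf z ×ˢ Finset.range h).filter
        (fun p => (p.1, r + 1 + 1 + (p.2 : ℤ)) ∈ F)).image (fun p : ℤ × ℕ => (p.1, p.2 + 1)) := by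
    rintro ⟨x, i⟩ hp
    simp only [Finset.mem_union, Finset.mem_image, Finset.mem_filter, Finset.mem_product,
        Finset.mem_range] at hp ⊢
    rcases i with _ | i
    · left
      exact ⟨x, ⟨hp.1.1, by simpa using hp.2⟩, rfl⟩
    · right
      refine ⟨(x, i), ⟨⟨hp.1.1, by omega⟩, ?_⟩, rfl⟩
      have := hp.2
      rw [show r + 1 + ((i + 1 : ℕ) : ℤ) = r + 1 + 1 + (i : ℤ) by push_cast; ring] at this
      exact this
  refine le_trans (Finset.card_le_card hsub) (le_trans (Finset.card_union_le _ _) ?_)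
  exact Nat.add_le_add Finset.card_image_le Finset.card_image_le

open Classical in
theorem Kc_col (Z : Zoning) (F F' : Set (ℤ × ℤ)) (hF : F ⊆ F') (r : ℤ) (z : ℤ) (h : ℕ)
    (S : Finset ℤ) (hS : S ⊆ Z.zf z) :
    Kc Z F r z h + (S.filter (fun x => clr F r h x)).card ≤
      Kc Z F' r z h + (S.filter (fun x => clr F' r h x)).card := by
  have h1 : (S.filter (fun x => clr F r h x)).card ≤
      (S.filter (fun x => clr F' r h x)).card +
      (S.filter (fun x => clr F r h x ∧ ¬ clr F' r h x)).card := by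
    refine le_trans (Finset.card_le_card ?_) (Finset.card_union_le _ _)
    intro x hx
    simp only [Finset.mem_union, Finset.mem_filter] at hx ⊢
    tauto
  have hw : ∀ x ∈ S.filter (fun x => clr F r h x ∧ ¬ clr F' r h x), ∃ i : ℕ, i < h ∧
      (x, r + 1 + (i : ℤ)) ∈ F' ∧ (x, r + 1 + (i : ℤ)) ∉ F := by
    intro x hx
    simp only [Finset.mem_filter] at hx
    obtain ⟨_, h2, h3⟩ := hx
    unfold clr at h3
    push Not at h3
    obtain ⟨i, hi, hiF⟩ := h3
    exact ⟨i, hi, hiF, h2 i hi⟩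
  choose! g hg1 hg2 hg3 using hw
  have h2 : Kc Z F r z h + ((S.filter (fun x => clr F r h x ∧ ¬ clr F' r h x)).image
      (fun x => (x, g x))).card ≤ Kc Z F' r z h := by
    unfold Kc
    rw [← Finset.card_union_of_disjoint]
    · apply Finset.card_le_card
      intro p hp
      rw [Finset.mem_union, Finset.mem_image] at hp
      rcases hp with hp | ⟨x, hx, rfl⟩
      · rw [Finset.mem_filter] at hp ⊢
        exact ⟨hp.1, hF hp.2⟩
      · rw [Finset.mem_filter, Finset.mem_product, Finset.mem_range]
        exact ⟨⟨hS (Finset.mem_filter.1 hx).1, hg1 x hx⟩, hg2 x hx⟩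
    · rw [Finset.disjoint_left]
      intro p hp hq
      rw [Finset.mem_image] at hq
      obtain ⟨x, hx, rfl⟩ := hq
      rw [Finset.mem_filter] at hp
      exact hg3 x hx hp.2
  rw [Finset.card_image_of_injective _ (fun a b h => (Prod.mk.inj h).1)] at h2
  omega

open Classical in
theorem AE_step (Z : Zoning) (F F' : Set (ℤ × ℤ)) (hF : F ⊆ F') (r : ℤ) (z : ℤ) (h : ℕ)
    (H : Finset ℤ) (c : ℤ → ℕ) (hS : H ⊆ Z.zf z) (n n' : ℕ) (hn : n' + dz Z F' r z ≤ n)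
    (hA : AE Z F r z n (al c H) (h + 1)) :
    AE Z F' (r + 1) z n' (al (fun x => c x + hit F' r x) H) h := by
  unfold AE at *
  have h1 := Kc_col Z F F' hF r z (h + 1) (al c H) (fun x hx => hS (mem_al.1 hx).1)
  have h2 := Kc_succ Z F' r z h
  have h3 : ((al c H).filter (fun x => clr F' r (h + 1) x)) =
      (al (fun x => c x + hit F' r x) H).filter (fun x => clr F' (r + 1) h x) := by
    ext x
    simp only [Finset.mem_filter, al_hit, clr_succ]
    tauto
  rw [h3] at h1
  omega

open Classical in
theorem crit_big (Z : Zoning) (F : Set (ℤ × ℤ)) (r : ℤ) (z : ℤ) (h : ℕ) (A H : Finset ℤ)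
    (hA : A ⊆ Z.zf z) (hok : HoldOK Z z F r A H) (n : ℕ) (hn : n ≤ A.card) (hh : h ≤ Z.hh z)
    (hno : ¬ AE Z F r z n H h) : 3 * h < n - Kc Z F r z h := by
  obtain ⟨h1, h2, h3, h4⟩ := hok
  unfold AE at hno
  have h5 := h3 h
  have h6 : A.card ≤ (A.filter (fun x => clr F r h x)).card + Kc Z F r z h := by
    have := Kc_col Z ∅ F (by simp) r z h A hA
    have e0 : Kc Z ∅ r z h = 0 := by simp [Kc]
    have e1 : A.filter (fun x => clr ∅ r h x) = A := by
      apply Finset.filter_true_of_mem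
      intro x _ i _
      simp
    rw [e0, e1] at this
    omega
  unfold Zoning.tt at h5
  omega

open Classical in
theorem NE_congr {Z : Zoning} {z : ℤ} {F : Set (ℤ × ℤ)} {r : ℤ} {R R' : Finset ℤ} {n : ℕ}
    {A H : Finset ℤ} {c : ℤ → ℕ} {i : ℕ} (h : NE Z z F r R n A H c i)
    (hR : ∀ x ∈ Z.zf z, x ∈ R ↔ x ∈ R') : NE Z z F r R' n A H c i := by
  have e1 : R ∩ Z.zf z = R' ∩ Z.zf z := by
    ext x; simp only [Finset.mem_inter]
    constructor
    · rintro ⟨a, b⟩; exact ⟨(hR x b).1 a, b⟩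
    · rintro ⟨a, b⟩; exact ⟨(hR x b).2 a, b⟩
  refine ⟨h.hHA, h.hA, h.J, ?_, ?_, h.I3, h.I4, ?_⟩
  · intro x hx
    exact (hR x (h.hA (h.hHA (mem_al.1 hx).1))).1 (h.I1 x hx)
  · intro hi y hy
    have hyz := (Z.mem_zf _ _).1 (h.hA (h.hHA (mem_al.1 hy).1))
    have : R' ∩ Z.bf (Z.bt y) = R ∩ Z.bf (Z.bt y) := by
      ext x; simp only [Finset.mem_inter]
      have hb : x ∈ Z.bf (Z.bt y) → x ∈ Z.zf z := fun hx =>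
        (Z.mem_zf _ _).2 ((Z.bt_zt x y ((Z.mem_bf _ _).1 hx)).trans hyz)
      constructor
      · rintro ⟨a, b⟩; exact ⟨(hR x (hb b)).2 a, b⟩
      · rintro ⟨a, b⟩; exact ⟨(hR x (hb b)).1 a, b⟩
    rw [this]
    exact h.I2 hi y hy
  · rw [← e1]; exact h.I5

structure FS where
  R : Finset ℤ
  n : ℤ → ℕ
  D : ℤ → ZD
  Zs : Finset ℤ

open Classical in
structure FI (Z : Zoning) (F : Set (ℤ × ℤ)) (r : ℤ) (S : FS) : Prop where
  supp : ∀ z, 0 < S.n z → z ∈ S.Zs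
  rpos : ∀ x ∈ S.R, 0 < S.n (Z.zt x)
  exn : ∀ z, (S.D z).ex → S.n z = (S.R ∩ Z.zf z).card
  zero : ∀ z, S.n z = 0 → (S.D z).ex
  ne : ∀ z, ¬ (S.D z).ex →
    NE Z z F r S.R (S.n z) (S.D z).A (S.D z).H (S.D z).c (S.D z).age ∧ (S.D z).age < Z.hh z
  E1 : ∀ z, ¬ (S.D z).ex → ∀ h ≤ Z.hh z - (S.D z).age,
    AE Z F r z (S.n z) (al (S.D z).c (S.D z).H) h ∨ (PL Z F r S.n z h ∧ PR Z F r S.n z h)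
  btw : ∀ z, ¬ (S.D z).ex → (∃ x ∈ S.R, Z.zt x < z) ∧ (∃ x ∈ S.R, z < Z.zt x)
  del1 : ∀ z, ¬ (S.D z).ex →
    ¬ HoldOK Z z F r (al (S.D z).c (S.D z).A) (al (S.D z).c (S.D z).H) → 1 ≤ (S.D z).del
  del2 : ∀ z, ¬ (S.D z).ex → (S.D z).del ≤ (S.D z).age
  del3 : ∀ k, 1 ≤ k → (S.Zs.filter (fun z => ¬ (S.D z).ex ∧ (S.D z).del = k)).card ≤ 3
  size : ∀ (W : Finset ℤ) (Hm : ℕ), (∀ z ∈ W, Z.hh z ≤ Hm) →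
    (W.filter (fun z => Z.ell z ^ 2 + Z.tt z < (S.R ∩ Z.zf z).card)).card ≤ 5 * Hm + 4

/-- what we need of the new state in one zone -/
structure ZC (Z : Zoning) (F' : Set (ℤ × ℤ)) (r' : ℤ) (Nw : Finset (ℤ × ℤ)) (S : FS) (Ns : ℤ → ℕ)
    (Rf : Finset ℤ) (z : ℤ) (Q : Finset ℤ) (n' : ℕ) (D' : ZD) : Prop where
  sub : Q ⊆ Rf ∩ Z.zf z
  le : Ns z ≤ n'
  zero : Ns z = 0 → n' = 0 ∧ Q = ∅ ∧ D'.ex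
  exn : D'.ex → n' = Q.card
  ends : 0 < Ns z → ((¬ ∃ y, y < z ∧ 0 < Ns y) ∨ (¬ ∃ y, z < y ∧ 0 < Ns y)) →
    D'.ex ∧ Q = Rf ∩ Z.zf z
  eq : ¬ D'.ex → n' = Ns z
  age : ¬ D'.ex → D'.age < Z.hh z
  btw : ¬ D'.ex → (∃ y, y < z ∧ 0 < Ns y) ∧ (∃ y, z < y ∧ 0 < Ns y)
  ne : ¬ D'.ex → NE Z z F' r' Q n' D'.A D'.H D'.c D'.age
  E1 : ¬ D'.ex → ∀ h ≤ Z.hh z - D'.age,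
    AE Z F' r' z n' (al D'.c D'.H) h ∨ (PL Z F' r' Ns z h ∧ PR Z F' r' Ns z h)
  del1 : ¬ D'.ex → ¬ HoldOK Z z F' r' (al D'.c D'.A) (al D'.c D'.H) → 1 ≤ D'.del
  del2 : ¬ D'.ex → D'.del ≤ D'.age
  del3 : ¬ D'.ex → D'.del = 0 ∨ (D'.del = 1 ∧ ∃ p ∈ Nw, Z.zt p.1 = z) ∨
    (¬ (S.D z).ex ∧ D'.del = (S.D z).del + 1 ∧ 1 ≤ (S.D z).del)
  size : Q.card ≤ Z.ell z ^ 2 + Z.tt z ∨ (¬ ∃ y, y < z ∧ 0 < Ns y) ∨ (¬ ∃ y, z < y ∧ 0 < Ns y) ∨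
    (∃ h ≤ Z.hh z, (¬ PL Z F' r' Ns z h ∨ ¬ PR Z F' r' Ns z h) ∧ 3 * h < Ns z - Kc Z F' r' z h) ∨
    (¬ D'.ex ∧ 1 ≤ D'.del)

open Classical in
theorem zone_exists {Z : Zoning} {F F' : Set (ℤ × ℤ)} {r : ℤ} {S : FS} (hS : FI Z F r S)
    (hF : F ⊆ F') (Nw : Finset (ℤ × ℤ))
    (hN : ∀ p ∈ F', p ∈ F ∨ p ∈ Nw) (hN3 : Nw.card ≤ 3) (Rf : Finset ℤ) (Ns : ℤ → ℕ)
    (hRf : ∀ x, x ∈ Rf ↔ (x ∈ S.R ∨ x - 1 ∈ S.R ∨ x + 1 ∈ S.R) ∧ (x, r + 1) ∉ F')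
    (hNe : ∀ z, (S.D z).ex → Ns z = (Rf ∩ Z.zf z).card)
    (hNn : ∀ z, ¬ (S.D z).ex → Ns z = S.n z - dz Z F' r z)
    (hNd : ∀ z, S.n z ≤ Ns z + dz Z F' r z) (z : ℤ) :
    ∃ Q n' D', ZC Z F' (r + 1) Nw S Ns Rf z Q n' D' := by
  have hPL : ∀ h, PL Z F r S.n z (h + 1) → PL Z F' (r + 1) Ns z h := by
    rintro h ⟨Ys, h1, h2⟩
    exact ⟨Ys, h1, psum_step Z F F' r S.n Ns h Nw hN hN3 hNd Ys h2⟩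
  have hPR : ∀ h, PR Z F r S.n z (h + 1) → PR Z F' (r + 1) Ns z h := by
    rintro h ⟨Ys, h1, h2⟩
    exact ⟨Ys, h1, psum_step Z F F' r S.n Ns h Nw hN hN3 hNd Ys h2⟩
  have hspread : ∀ x ∈ Z.zf z, (x ∈ S.R ∨ x - 1 ∈ S.R ∨ x + 1 ∈ S.R) → (x, r + 1) ∉ F' →
      x ∈ Rf ∩ Z.zf z := fun x hx h1 h2 => Finset.mem_inter.2 ⟨(hRf x).2 ⟨h1, h2⟩, hx⟩
  -- case 0
  by_cases h0 : Ns z = 0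
  · refine ⟨∅, 0, ⟨∅, ∅, fun _ => 0, 0, 0, True⟩, ?_⟩
    constructor <;> simp [h0]
  have hpos : 0 < Ns z := Nat.pos_of_ne_zero h0
  have hdd : ¬ (S.D z).ex → Ns z + dz Z F' r z ≤ S.n z := by
    intro hex; have := hNn z hex; omega
  -- the step of the nonexact invariant
  have hne : ¬ (S.D z).ex → NE Z z F' (r + 1) (Rf ∩ Z.zf z) (Ns z) (S.D z).A (S.D z).H
      (fun x => (S.D z).c x + hit F' r x) ((S.D z).age + 1) := by
    intro hex
    obtain ⟨a, b⟩ := hS.ne z hex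
    exact NE_step hF Nw hN hN3 b hspread (hdd hex) a
  by_cases h1 : (¬ ∃ y, y < z ∧ 0 < Ns y) ∨ (¬ ∃ y, z < y ∧ 0 < Ns y)
  · have hle : Ns z ≤ (Rf ∩ Z.zf z).card := by
      by_cases hex : (S.D z).ex
      · exact le_of_eq (hNe z hex)
      · obtain ⟨a, b⟩ := hS.ne z hex
        have hA : AE Z F r z (S.n z) (al (S.D z).c (S.D z).H) (0 + 1) := by
          rcases hS.E1 z hex 1 (by omega) with h2 | ⟨h2, h3⟩
          · exact h2
          · exfalso
            rcases h1 with h1 | h1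
            · obtain ⟨Ys, e1, e2⟩ := hPL 0 h2
              obtain ⟨y, hy, hyp⟩ := Finset.exists_ne_zero_of_sum_ne_zero (Nat.ne_of_gt (lt_of_le_of_lt (Nat.zero_le _) e2))
              exact h1 ⟨y, e1 y hy, by omega⟩
            · obtain ⟨Ys, e1, e2⟩ := hPR 0 h3
              obtain ⟨y, hy, hyp⟩ := Finset.exists_ne_zero_of_sum_ne_zero (Nat.ne_of_gt (lt_of_le_of_lt (Nat.zero_le _) e2))
              exact h1 ⟨y, e1 y hy, by omega⟩
        have := AE_step Z F F' hF r z 0 _ _ (fun x hx => a.hA (a.hHA hx)) _ _ (hdd hex) hA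
        unfold AE at this
        rw [Kc_zero] at this
        refine le_trans this ?_
        rw [Nat.zero_add]
        apply Finset.card_le_card
        intro x hx
        rw [Finset.mem_filter] at hx
        exact (hne hex).I1 x hx.1
    refine ⟨Rf ∩ Z.zf z, (Rf ∩ Z.zf z).card, ⟨∅, ∅, fun _ => 0, 0, 0, True⟩, ?_⟩
    refine ⟨le_rfl, hle, fun h => absurd h h0, fun _ => rfl, fun _ h => ⟨trivial, rfl⟩, ?_, ?_, ?_,
        ?_, ?_, ?_, ?_, ?_, Or.inr (by rcases h1 with h1 | h1; exact Or.inl h1; exact Or.inr (Or.inl h1))⟩ <;>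
      exact fun h => absurd trivial h
  have hb : (∃ y, y < z ∧ 0 < Ns y) ∧ (∃ y, z < y ∧ 0 < Ns y) := by
    rw [not_or, not_not, not_not] at h1; exact h1
  -- holding
  have hold : ∀ A H : Finset ℤ, A ⊆ Z.zf z → H ⊆ Rf ∩ Z.zf z → Ns z ≤ A.card →
      HoldOK Z z F' (r + 1) A H →
      (∀ h ≤ Z.hh z, AE Z F' (r + 1) z (Ns z) H h ∨
        (PL Z F' (r + 1) Ns z h ∧ PR Z F' (r + 1) Ns z h)) →
      ∃ Q n' D', ZC Z F' (r + 1) Nw S Ns Rf z Q n' D' := by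
    intro A H hA hH hn hok hcr
    have ea : ∀ S, al (fun _ => 0) S = S := fun S => by simp [al]
    have := Z.ell_pos z
    refine ⟨H, Ns z, ⟨A, H, fun _ => 0, 0, 0, False⟩, ?_⟩
    refine ⟨hH, le_rfl, fun h => absurd h h0, fun h => h.elim, fun _ h => absurd h h1,
      fun _ => rfl, fun _ => ?_, fun _ => hb, fun _ => ?_, fun _ => ?_, fun _ h => ?_,
      fun _ => le_rfl, fun _ => Or.inl rfl, Or.inl hok.2.2.2⟩
    · show 0 < Z.hh z
      unfold Zoning.hh; omega
    · exact NE_init hA hok hn le_rfl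
    · simp only [ea]
      intro h hh
      exact hcr h (by omega)
    · simp only [ea] at h
      exact absurd hok h
  -- crit
  have crit : ∀ A H : Finset ℤ, A ⊆ Z.zf z → Ns z ≤ A.card →
      HoldOK Z z F' (r + 1) A H →
      ¬ (∀ h ≤ Z.hh z, AE Z F' (r + 1) z (Ns z) H h ∨
        (PL Z F' (r + 1) Ns z h ∧ PR Z F' (r + 1) Ns z h)) →
      ∃ h ≤ Z.hh z, (¬ PL Z F' (r + 1) Ns z h ∨ ¬ PR Z F' (r + 1) Ns z h) ∧
        3 * h < Ns z - Kc Z F' (r + 1) z h := by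
    intro A H hA hn hok hcr
    push Not at hcr
    obtain ⟨h, hh, h2, h3⟩ := hcr
    refine ⟨h, hh, ?_, crit_big Z F' (r + 1) z h A H hA hok _ hn hh h2⟩
    by_cases h4 : PL Z F' (r + 1) Ns z h
    · exact Or.inr (h3 h4)
    · exact Or.inl h4
  by_cases hx : (S.D z).ex ∨ (S.D z).age + 1 = Z.hh z
  · have hle : Ns z ≤ (Rf ∩ Z.zf z).card := by
      by_cases hex : (S.D z).ex
      · exact le_of_eq (hNe z hex)
      · have := hne hex
        rw [hx.resolve_left hex] at this
        have := NE_exact this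
        rwa [Finset.inter_assoc, Finset.inter_self] at this
    obtain ⟨H, hok⟩ := exists_hold Z z F' (r + 1) (Rf ∩ Z.zf z) Finset.inter_subset_right
    by_cases hcr : (∀ h ≤ Z.hh z, AE Z F' (r + 1) z (Ns z) H h ∨
        (PL Z F' (r + 1) Ns z h ∧ PR Z F' (r + 1) Ns z h))
    · exact hold _ H Finset.inter_subset_right hok.1 hle hok hcr
    · have := crit _ H Finset.inter_subset_right hle hok hcr
      refine ⟨Rf ∩ Z.zf z, (Rf ∩ Z.zf z).card, ⟨∅, ∅, fun _ => 0, 0, 0, True⟩, ?_⟩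
      refine ⟨le_rfl, hle, fun h => absurd h h0, fun _ => rfl, fun _ h => absurd h h1, ?_, ?_, ?_,
        ?_, ?_, ?_, ?_, ?_, Or.inr (Or.inr (Or.inr (Or.inl this)))⟩ <;>
      exact fun h => absurd trivial h
  · rw [not_or] at hx
    obtain ⟨hex, hage⟩ := hx
    have hst := hne hex
    obtain ⟨hne0, hlt⟩ := hS.ne z hex
    set c' : ℤ → ℕ := fun x => (S.D z).c x + hit F' r x with hc'
    have hn : Ns z ≤ (al c' (S.D z).A).card := by
      have j := hst.J
      have := card_le_al c' (S.D z).A _ hst.hA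
      omega
    have hAz : al c' (S.D z).A ⊆ Z.zf z := fun x hx => hst.hA (mem_al.1 hx).1
    by_cases hok : HoldOK Z z F' (r + 1) (al c' (S.D z).A) (al c' (S.D z).H) ∧
      (∀ h ≤ Z.hh z, AE Z F' (r + 1) z (Ns z) (al c' (S.D z).H) h ∨
        (PL Z F' (r + 1) Ns z h ∧ PR Z F' (r + 1) Ns z h))
    · exact hold _ _ hAz hst.I1 hn hok.1 hok.2
    · have hE1 : ∀ h ≤ Z.hh z - ((S.D z).age + 1),
          AE Z F' (r + 1) z (Ns z) (al c' (S.D z).H) h ∨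
          (PL Z F' (r + 1) Ns z h ∧ PR Z F' (r + 1) Ns z h) := by
        intro h hh
        rcases hS.E1 z hex (h + 1) (by omega) with h2 | ⟨h2, h3⟩
        · left
          exact AE_step Z F F' hF r z h _ _ (fun x hx => hne0.hA (hne0.hHA hx)) _ _ (hdd hex) h2
        · exact Or.inr ⟨hPL h h2, hPR h h3⟩
      by_cases hok1 : HoldOK Z z F' (r + 1) (al c' (S.D z).A) (al c' (S.D z).H)
      · have hcr := crit _ _ hAz hn hok1 (fun h => hok ⟨hok1, h⟩)
        refine ⟨Rf ∩ Z.zf z, Ns z, ⟨(S.D z).A, (S.D z).H, c', (S.D z).age + 1, 0, False⟩, ?_⟩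
        refine ⟨le_rfl, le_rfl, fun h => absurd h h0, fun h => h.elim, fun _ h => absurd h h1,
          fun _ => rfl, fun _ => ?_, fun _ => hb, fun _ => hst, fun _ => hE1, fun _ h => ?_,
          fun _ => ?_, fun _ => Or.inl rfl, Or.inr (Or.inr (Or.inr (Or.inl hcr)))⟩
        · show (S.D z).age + 1 < Z.hh z
          omega
        · exact absurd hok1 h
        · exact Nat.zero_le _
      · refine ⟨Rf ∩ Z.zf z, Ns z, ⟨(S.D z).A, (S.D z).H, c', (S.D z).age + 1,
          (S.D z).del + 1, False⟩, ?_⟩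
        refine ⟨le_rfl, le_rfl, fun h => absurd h h0, fun h => h.elim, fun _ h => absurd h h1,
          fun _ => rfl, fun _ => ?_, fun _ => hb, fun _ => hst, fun _ => hE1, fun _ h => ?_,
          fun _ => ?_, fun _ => ?_, Or.inr (Or.inr (Or.inr (Or.inr ⟨fun h => h, ?_⟩)))⟩
        · show (S.D z).age + 1 < Z.hh z
          omega
        · show 1 ≤ (S.D z).del + 1
          omega
        · show (S.D z).del + 1 ≤ (S.D z).age + 1
          have := hS.del2 z hex
          omega
        · right
          rcases Nat.eq_zero_or_pos (S.D z).del with hd | hd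
          · left
            refine ⟨by show (S.D z).del + 1 = 1; omega, ?_⟩
            by_contra hcon
            push Not at hcon
            have hok0 : HoldOK Z z F r (al (S.D z).c (S.D z).A) (al (S.D z).c (S.D z).H) := by
              by_contra h
              have := hS.del1 z hex h
              omega
            have := hold_step Z z F F' r _ _ hF Nw hN
              (fun x hx => hne0.hA (mem_al.1 hx).1) hcon hok0
            apply hok1
            have e : ∀ T, (al (S.D z).c T).filter (fun x => (x, r + 1) ∉ F') = al c' T := by
              intro T
              ext x
              rw [Finset.mem_filter, hc', al_hit]
            rw [e, e] at this
            exact this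
          · exact Or.inr ⟨hex, rfl, hd⟩
        · show 1 ≤ (S.D z).del + 1
          omega

end Contain

open Set

namespace Contain

open Classical in
theorem FI_bound {Z : Zoning} {F : Set (ℤ × ℤ)} {r : ℤ} {S : FS} (hS : FI Z F r S) {a b : ℤ}
    (ha : ∀ x ∈ S.R, a ≤ x) (hb : ∀ x ∈ S.R, x ≤ b) {z : ℤ} (hz : ¬ (S.D z).ex) {y : ℤ}
    (hy : y ∈ Z.zf z) : a < y ∧ y < b := by
  obtain ⟨⟨u, hu, huz⟩, ⟨v, hv, hvz⟩⟩ := hS.btw z hz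
  rw [Z.mem_zf] at hy
  constructor
  · have := ha u hu
    by_contra hcon
    have := Z.zt_mono (show y ≤ u by omega)
    omega
  · have := hb v hv
    by_contra hcon
    have := Z.zt_mono (show v ≤ y by omega)
    omega

open Classical in
theorem sum_zf_le (Z : Zoning) (I Ws : Finset ℤ) : ∑ z ∈ Ws, (I ∩ Z.zf z).card ≤ I.card := by
  rw [← Finset.card_biUnion]
  · apply Finset.card_le_card
    intro x hx
    rw [Finset.mem_biUnion] at hx
    obtain ⟨z, _, hz⟩ := hx
    exact (Finset.mem_inter.1 hz).1
  · intro x _ y _ hxy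
    rw [Function.onFun, Finset.disjoint_left]
    intro p hp hq
    rw [Finset.mem_inter, Z.mem_zf] at hp hq
    exact hxy (hp.2.symm.trans hq.2)

open Classical in
theorem sum_zf_ge (Z : Zoning) (I Ws : Finset ℤ) (h : ∀ x ∈ I, Z.zt x ∈ Ws) :
    I.card ≤ ∑ z ∈ Ws, (I ∩ Z.zf z).card := by
  refine le_trans (Finset.card_le_card ?_) Finset.card_biUnion_le
  intro x hx
  rw [Finset.mem_biUnion]
  exact ⟨Z.zt x, h x hx, Finset.mem_inter.2 ⟨hx, (Z.mem_zf _ _).2 rfl⟩⟩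

open Classical in
theorem FI_hull {Z : Zoning} {F : Set (ℤ × ℤ)} {r : ℤ} {S : FS} (hS : FI Z F r S) {a b : ℤ}
    (ha : ∀ x ∈ S.R, a ≤ x) (hb : ∀ x ∈ S.R, x ≤ b) :
    ∑ z ∈ S.Zs, S.n z ≤ (Finset.Icc a b).card := by
  refine le_trans (Finset.sum_le_sum ?_) (sum_zf_le Z (Finset.Icc a b) S.Zs)
  intro z _
  by_cases hex : (S.D z).ex
  · rw [hS.exn z hex]
    apply Finset.card_le_card
    intro x hx
    rw [Finset.mem_inter] at hx ⊢
    exact ⟨Finset.mem_Icc.2 ⟨ha x hx.1, hb x hx.1⟩, hx.2⟩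
  · obtain ⟨h1, _⟩ := hS.ne z hex
    have h2 := h1.J
    have h3 : (S.D z).A.card ≤ (Finset.Icc a b ∩ Z.zf z).card := by
      apply Finset.card_le_card
      intro x hx
      have hx := h1.hA hx
      have := FI_bound hS ha hb hex hx
      exact Finset.mem_inter.2 ⟨Finset.mem_Icc.2 ⟨by omega, by omega⟩, hx⟩
    omega

open Classical in
theorem FI_init (Z : Zoning) (F : Set (ℤ × ℤ)) (r : ℤ) (R : Finset ℤ) (hR : R.card ≤ 2) :
    ∃ S, FI Z F r S ∧ S.R = R ∧ ∑ z ∈ S.Zs, S.n z = R.card := by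
  refine ⟨⟨R, fun z => (R ∩ Z.zf z).card, fun _ => ⟨∅, ∅, fun _ => 0, 0, 0, True⟩, R.image Z.zt⟩,
    ?_, rfl, ?_⟩
  · constructor
    · intro z hz
      obtain ⟨x, hx⟩ := Finset.card_pos.1 hz
      rw [Finset.mem_inter, Z.mem_zf] at hx
      exact Finset.mem_image.2 ⟨x, hx⟩
    · intro x hx
      exact Finset.card_pos.2 ⟨x, Finset.mem_inter.2 ⟨hx, (Z.mem_zf _ _).2 rfl⟩⟩
    · intro z _; rfl
    · intro z _; trivial
    · intro z h; exact absurd trivial h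
    · intro z h; exact absurd trivial h
    · intro z h; exact absurd trivial h
    · intro z h; exact absurd trivial h
    · intro z h; exact absurd trivial h
    · intro k _
      simp
    · intro W Hm _
      rw [Finset.filter_false_of_mem]
      · simp
      · intro z _ h
        have h1 : (R ∩ Z.zf z).card ≤ R.card := Finset.card_le_card Finset.inter_subset_left
        have h2 := Z.ell_pos z
        unfold Zoning.tt Zoning.hh at h
        simp only at h
        omega
  · apply le_antisymm
    · exact sum_zf_le Z R _
    · exact sum_zf_ge Z R _ (fun x hx => Finset.mem_image_of_mem _ hx)

open Classical in
theorem front_step {Z : Zoning} {F F' : Set (ℤ × ℤ)} {r : ℤ} {S : FS} (hS : FI Z F r S)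
    (hF : F ⊆ F') (Nw : Finset (ℤ × ℤ))
    (hN : ∀ p ∈ F', p ∈ F ∨ p ∈ Nw) (hN3 : Nw.card ≤ 3) {a b : ℤ} (haR : a ∈ S.R) (hbR : b ∈ S.R)
    (ha : ∀ x ∈ S.R, a ≤ x) (hb : ∀ x ∈ S.R, x ≤ b) :
    ∃ S', FI Z F' (r + 1) S' ∧ (S'.R = ∅ → ∑ z ∈ S'.Zs, S'.n z = 0) ∧
      (∀ x ∈ S'.R, (x ∈ S.R ∨ x - 1 ∈ S.R ∨ x + 1 ∈ S.R) ∧ (x, r + 1) ∉ F') ∧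
      ((b + 1, r + 1) ∉ F' → b + 1 ∈ S'.R) ∧ ((a - 1, r + 1) ∉ F' → a - 1 ∈ S'.R) ∧
      ∑ z ∈ S.Zs, S.n z + 2 ≤ ∑ z ∈ S'.Zs, S'.n z +
        ((Finset.Icc (a - 1) (b + 1)).filter (fun x => (x, r + 1) ∈ F')).card := by
  set nb : Finset ℤ := S.R ∪ S.R.image (fun x => x + 1) ∪ S.R.image (fun x => x - 1) with hnb
  have hmnb : ∀ x, x ∈ nb ↔ (x ∈ S.R ∨ x - 1 ∈ S.R ∨ x + 1 ∈ S.R) := by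
    intro x
    simp only [hnb, Finset.mem_union, Finset.mem_image]
    constructor
    · rintro ((h | ⟨y, hy, rfl⟩) | ⟨y, hy, rfl⟩)
      · exact Or.inl h
      · right; left; simpa using hy
      · right; right; simpa using hy
    · rintro (h | h | h)
      · exact Or.inl (Or.inl h)
      · exact Or.inl (Or.inr ⟨_, h, by ring⟩)
      · exact Or.inr ⟨_, h, by ring⟩
  have hnbI : ∀ x ∈ nb, a - 1 ≤ x ∧ x ≤ b + 1 := by
    intro x hx
    rcases (hmnb x).1 hx with h | h | h <;> have h1 := ha _ h <;> have h2 := hb _ h <;> omega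
  set Rf : Finset ℤ := nb.filter (fun x => (x, r + 1) ∉ F') with hRfd
  have hRf : ∀ x, x ∈ Rf ↔ (x ∈ S.R ∨ x - 1 ∈ S.R ∨ x + 1 ∈ S.R) ∧ (x, r + 1) ∉ F' := by
    intro x; rw [hRfd, Finset.mem_filter, hmnb]
  set Ns : ℤ → ℕ := fun z => if (S.D z).ex then (Rf ∩ Z.zf z).card else S.n z - dz Z F' r z with hNs
  have hNe : ∀ z, (S.D z).ex → Ns z = (Rf ∩ Z.zf z).card := fun z h => by simp only [hNs, if_pos h]
  have hNn : ∀ z, ¬ (S.D z).ex → Ns z = S.n z - dz Z F' r z := fun z h => by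
    simp only [hNs, if_neg h]
  have hNd : ∀ z, S.n z ≤ Ns z + dz Z F' r z := by
    intro z
    by_cases hex : (S.D z).ex
    · rw [hNe z hex, hS.exn z hex]
      exact keep_step (Z.zf z) S.R Rf (fun x => (x, r + 1) ∈ F') (fun x _ h1 h2 => (hRf x).2 ⟨h1, h2⟩)
    · rw [hNn z hex]; omega
  choose Q n' D' hZC using zone_exists hS hF Nw hN hN3 Rf Ns hRf hNe hNn hNd
  set Zs' : Finset ℤ := S.Zs ∪ nb.image Z.zt with hZs'
  have hsupp : ∀ z, 0 < Ns z → z ∈ Zs' := by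
    intro z hz
    by_cases hex : (S.D z).ex
    · rw [hNe z hex] at hz
      obtain ⟨x, hx⟩ := Finset.card_pos.1 hz
      rw [Finset.mem_inter, Z.mem_zf] at hx
      exact Finset.mem_union_right _ (Finset.mem_image.2 ⟨x, (Finset.mem_filter.1 hx.1).1, hx.2⟩)
    · rw [hNn z hex] at hz
      exact Finset.mem_union_left _ (hS.supp z (by omega))
  set R' : Finset ℤ := Zs'.biUnion Q with hR'
  have hQz : ∀ z x, x ∈ Q z → Z.zt x = z := fun z x hx =>
    (Z.mem_zf _ _).1 (Finset.mem_inter.1 ((hZC z).sub hx)).2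
  have hmR' : ∀ x, x ∈ R' ↔ x ∈ Q (Z.zt x) := by
    intro x
    rw [hR', Finset.mem_biUnion]
    constructor
    · rintro ⟨z, _, hx⟩
      rw [hQz z x hx]; exact hx
    · intro hx
      refine ⟨Z.zt x, hsupp _ (Nat.pos_of_ne_zero ?_), hx⟩
      intro h0
      rw [((hZC _).zero h0).2.1] at hx
      simp at hx
  have hR'z : ∀ z, R' ∩ Z.zf z = Q z := by
    intro z
    ext x
    rw [Finset.mem_inter, hmR', Z.mem_zf]
    constructor
    · rintro ⟨h1, h2⟩; rwa [h2] at h1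
    · intro h
      have := hQz z x h
      rw [this]; exact ⟨h, rfl⟩
  have hpos' : ∀ z, 0 < n' z ↔ 0 < Ns z := by
    intro z
    constructor
    · intro h
      by_contra hcon
      have := ((hZC z).zero (by omega)).1
      omega
    · intro h; have := (hZC z).le; omega
  -- ends
  have hfirst : ∀ z, 0 < Ns z → ∃ x ∈ R', Z.zt x ≤ z := by
    intro z hz
    have hne : (Zs'.filter (fun y => 0 < Ns y ∧ y ≤ z)).Nonempty :=
      ⟨z, by rw [Finset.mem_filter]; exact ⟨hsupp z hz, hz, le_rfl⟩⟩
    set m := (Zs'.filter (fun y => 0 < Ns y ∧ y ≤ z)).min' hne with hm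
    have hmem := Finset.min'_mem _ hne
    rw [← hm, Finset.mem_filter] at hmem
    have hno : ¬ ∃ y, y < m ∧ 0 < Ns y := by
      rintro ⟨y, hy, hyp⟩
      have : m ≤ y := Finset.min'_le _ _ (by
        rw [Finset.mem_filter]; exact ⟨hsupp y hyp, hyp, by omega⟩)
      omega
    obtain ⟨e1, e2⟩ := (hZC m).ends hmem.2.1 (Or.inl hno)
    have e3 := (hZC m).exn e1
    have e4 := (hpos' m).2 hmem.2.1
    rw [e3] at e4
    obtain ⟨x, hx⟩ := Finset.card_pos.1 e4
    have hxm := hQz m x hx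
    exact ⟨x, (hmR' x).2 (by rw [hxm]; exact hx), by omega⟩
  have hlast : ∀ z, 0 < Ns z → ∃ x ∈ R', z ≤ Z.zt x := by
    intro z hz
    have hne : (Zs'.filter (fun y => 0 < Ns y ∧ z ≤ y)).Nonempty :=
      ⟨z, by rw [Finset.mem_filter]; exact ⟨hsupp z hz, hz, le_rfl⟩⟩
    set m := (Zs'.filter (fun y => 0 < Ns y ∧ z ≤ y)).max' hne with hm
    have hmem := Finset.max'_mem _ hne
    rw [← hm, Finset.mem_filter] at hmem
    have hno : ¬ ∃ y, m < y ∧ 0 < Ns y := by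
      rintro ⟨y, hy, hyp⟩
      have : y ≤ m := Finset.le_max' _ _ (by
        rw [Finset.mem_filter]; exact ⟨hsupp y hyp, hyp, by omega⟩)
      omega
    obtain ⟨e1, e2⟩ := (hZC m).ends hmem.2.1 (Or.inr hno)
    have e3 := (hZC m).exn e1
    have e4 := (hpos' m).2 hmem.2.1
    rw [e3] at e4
    obtain ⟨x, hx⟩ := Finset.card_pos.1 e4
    have hxm := hQz m x hx
    exact ⟨x, (hmR' x).2 (by rw [hxm]; exact hx), by omega⟩
  have hdel3 : ∀ k, 1 ≤ k → (Zs'.filter (fun z => ¬ (D' z).ex ∧ (D' z).del = k)).card ≤ 3 := by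
    intro k hk
    rcases Nat.lt_or_ge 1 k with hk1 | hk1
    · refine le_trans (Finset.card_le_card ?_) (hS.del3 (k - 1) (by omega))
      intro z hz
      rw [Finset.mem_filter] at hz ⊢
      rcases (hZC z).del3 hz.2.1 with h | h | h
      · omega
      · omega
      · refine ⟨hS.supp z (Nat.pos_of_ne_zero (fun h0 => h.1 (hS.zero z h0))), h.1, by omega⟩
    · refine le_trans (Finset.card_le_card (t := Nw.image (fun p => Z.zt p.1)) ?_)
        (le_trans Finset.card_image_le hN3)
      intro z hz
      rw [Finset.mem_filter] at hz
      rcases (hZC z).del3 hz.2.1 with h | h | h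
      · omega
      · obtain ⟨p, hp, hpz⟩ := h.2
        exact Finset.mem_image.2 ⟨p, hp, hpz⟩
      · omega
  refine ⟨⟨R', n', D', Zs'⟩, ?_, ?_, ?_, ?_, ?_, ?_⟩
  · constructor
    · intro z hz
      exact hsupp z ((hpos' z).1 hz)
    · intro x hx
      rw [hpos']
      apply Nat.pos_of_ne_zero
      intro h0
      have hx : x ∈ Q (Z.zt x) := (hmR' x).1 hx
      rw [((hZC _).zero h0).2.1] at hx
      simp at hx
    · intro z hz
      show n' z = (R' ∩ Z.zf z).card
      rw [hR'z]
      exact (hZC z).exn hz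
    · intro z hz
      have : ¬ 0 < n' z := by show ¬ 0 < n' z; have : n' z = 0 := hz; omega
      rw [hpos'] at this
      exact ((hZC z).zero (by omega)).2.2
    · intro z hz
      refine ⟨NE_congr ((hZC z).ne hz) ?_, (hZC z).age hz⟩
      intro x hx
      show x ∈ Q z ↔ x ∈ R'
      rw [← hR'z, Finset.mem_inter]
      exact ⟨fun h => h.1, fun h => ⟨h, hx⟩⟩
    · intro z hz h hh
      rcases (hZC z).E1 hz h hh with h1 | ⟨⟨Y1, h1, h2⟩, ⟨Y2, h3, h4⟩⟩
      · exact Or.inl h1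
      · right
        exact ⟨⟨Y1, h1, lt_of_lt_of_le h2 (psum_mono _ _ _ _ _ _ (fun y => (hZC y).le) _)⟩,
          ⟨Y2, h3, lt_of_lt_of_le h4 (psum_mono _ _ _ _ _ _ (fun y => (hZC y).le) _)⟩⟩
    · intro z hz
      obtain ⟨⟨y1, h1, h2⟩, ⟨y2, h3, h4⟩⟩ := (hZC z).btw hz
      obtain ⟨x1, hx1, e1⟩ := hfirst y1 h2
      obtain ⟨x2, hx2, e2⟩ := hlast y2 h4
      exact ⟨⟨x1, hx1, by omega⟩, ⟨x2, hx2, by omega⟩⟩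
    · intro z hz; exact (hZC z).del1 hz
    · intro z hz; exact (hZC z).del2 hz
    · exact hdel3
    · intro W Hm hW
      have hsub : W.filter (fun z => Z.ell z ^ 2 + Z.tt z < (R' ∩ Z.zf z).card) ⊆
          (W.filter (fun z => 0 < Ns z ∧ ¬ ∃ y, y < z ∧ 0 < Ns y) ∪
          W.filter (fun z => 0 < Ns z ∧ ¬ ∃ y, z < y ∧ 0 < Ns y)) ∪
          ((Finset.range (Hm + 1)).biUnion (fun h => W.filter (fun z => h ≤ Z.hh z ∧
            ¬ PL Z F' (r + 1) Ns z h ∧ 3 * h < Ns z - Kc Z F' (r + 1) z h)) ∪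
          (Finset.range (Hm + 1)).biUnion (fun h => W.filter (fun z => h ≤ Z.hh z ∧
            ¬ PR Z F' (r + 1) Ns z h ∧ 3 * h < Ns z - Kc Z F' (r + 1) z h))) ∪
          (Finset.Icc 1 Hm).biUnion (fun k => Zs'.filter (fun z => ¬ (D' z).ex ∧ (D' z).del = k)) := by
        intro z hz
        rw [Finset.mem_filter, hR'z] at hz
        obtain ⟨hzW, hbig⟩ := hz
        have hNp : 0 < Ns z := by
          apply Nat.pos_of_ne_zero
          intro h0
          rw [((hZC z).zero h0).2.1] at hbig
          simp at hbig
        rcases (hZC z).size with h | h | h | ⟨h, hh, hp, h3⟩ | ⟨hex, hd⟩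
        · omega
        · apply Finset.mem_union_left; apply Finset.mem_union_left; apply Finset.mem_union_left
          exact Finset.mem_filter.2 ⟨hzW, hNp, h⟩
        · apply Finset.mem_union_left; apply Finset.mem_union_left; apply Finset.mem_union_right
          exact Finset.mem_filter.2 ⟨hzW, hNp, h⟩
        · have := hW z hzW
          rcases hp with hp | hp
          · apply Finset.mem_union_left; apply Finset.mem_union_right; apply Finset.mem_union_left
            rw [Finset.mem_biUnion]
            exact ⟨h, Finset.mem_range.2 (by omega), Finset.mem_filter.2 ⟨hzW, hh, hp, h3⟩⟩
          · apply Finset.mem_union_left; apply Finset.mem_union_right; apply Finset.mem_union_right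
            rw [Finset.mem_biUnion]
            exact ⟨h, Finset.mem_range.2 (by omega), Finset.mem_filter.2 ⟨hzW, hh, hp, h3⟩⟩
        · apply Finset.mem_union_right
          rw [Finset.mem_biUnion]
          have h1 := (hZC z).del2 hex
          have h2 := (hZC z).age hex
          have := hW z hzW
          exact ⟨(D' z).del, Finset.mem_Icc.2 ⟨hd, by omega⟩,
            Finset.mem_filter.2 ⟨hsupp z hNp, hex, rfl⟩⟩
      have b1 : (W.filter (fun z => 0 < Ns z ∧ ¬ ∃ y, y < z ∧ 0 < Ns y)).card ≤ 1 := by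
        rw [Finset.card_le_one]
        intro u hu v hv
        rw [Finset.mem_filter] at hu hv
        rcases lt_trichotomy u v with h | h | h
        · exact absurd ⟨u, h, hu.2.1⟩ hv.2.2
        · exact h
        · exact absurd ⟨v, h, hv.2.1⟩ hu.2.2
      have b2 : (W.filter (fun z => 0 < Ns z ∧ ¬ ∃ y, z < y ∧ 0 < Ns y)).card ≤ 1 := by
        rw [Finset.card_le_one]
        intro u hu v hv
        rw [Finset.mem_filter] at hu hv
        rcases lt_trichotomy u v with h | h | h
        · exact absurd ⟨v, h, hv.2.1⟩ hu.2.2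
        · exact h
        · exact absurd ⟨u, h, hu.2.1⟩ hv.2.2
      have b3 : ((Finset.range (Hm + 1)).biUnion (fun h => W.filter (fun z => h ≤ Z.hh z ∧
            ¬ PL Z F' (r + 1) Ns z h ∧ 3 * h < Ns z - Kc Z F' (r + 1) z h))).card ≤ Hm + 1 := by
        refine le_trans (Finset.card_biUnion_le_card_mul _ _ 1 ?_) (by simp)
        intro h _
        have key : ∀ u v : ℤ, u < v → ¬ PL Z F' (r + 1) Ns v h →
            3 * h < Ns u - Kc Z F' (r + 1) u h → False := by
          intro u v huv h1 h2
          exact h1 ⟨{u}, by simpa using huv, by simpa using h2⟩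
        rw [Finset.card_le_one]
        intro u hu v hv
        rw [Finset.mem_filter] at hu hv
        rcases lt_trichotomy u v with h | h | h
        · exact (key u v h hv.2.2.1 hu.2.2.2).elim
        · exact h
        · exact (key v u h hu.2.2.1 hv.2.2.2).elim
      have b4 : ((Finset.range (Hm + 1)).biUnion (fun h => W.filter (fun z => h ≤ Z.hh z ∧
            ¬ PR Z F' (r + 1) Ns z h ∧ 3 * h < Ns z - Kc Z F' (r + 1) z h))).card ≤ Hm + 1 := by
        refine le_trans (Finset.card_biUnion_le_card_mul _ _ 1 ?_) (by simp)
        intro h _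
        have key : ∀ u v : ℤ, u < v → ¬ PR Z F' (r + 1) Ns u h →
            3 * h < Ns v - Kc Z F' (r + 1) v h → False := by
          intro u v huv h1 h2
          exact h1 ⟨{v}, by simpa using huv, by simpa using h2⟩
        rw [Finset.card_le_one]
        intro u hu v hv
        rw [Finset.mem_filter] at hu hv
        rcases lt_trichotomy u v with h | h | h
        · exact (key u v h hu.2.2.1 hv.2.2.2).elim
        · exact h
        · exact (key v u h hv.2.2.1 hu.2.2.2).elim
      have b5 : ((Finset.Icc 1 Hm).biUnion
          (fun k => Zs'.filter (fun z => ¬ (D' z).ex ∧ (D' z).del = k))).card ≤ Hm * 3 := by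
        refine le_trans (Finset.card_biUnion_le_card_mul _ _ 3 ?_) (by simp)
        intro k hk
        exact hdel3 k (Finset.mem_Icc.1 hk).1
      refine le_trans (Finset.card_le_card hsub) ?_
      refine le_trans (Finset.card_union_le _ _) ?_
      refine le_trans (Nat.add_le_add_right (Finset.card_union_le _ _) _) ?_
      have c1 := Finset.card_union_le (W.filter (fun z => 0 < Ns z ∧ ¬ ∃ y, y < z ∧ 0 < Ns y))
        (W.filter (fun z => 0 < Ns z ∧ ¬ ∃ y, z < y ∧ 0 < Ns y))
      have c2 := Finset.card_union_le ((Finset.range (Hm + 1)).biUnion (fun h => W.filter (fun z => h ≤ Z.hh z ∧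
            ¬ PL Z F' (r + 1) Ns z h ∧ 3 * h < Ns z - Kc Z F' (r + 1) z h)))
          ((Finset.range (Hm + 1)).biUnion (fun h => W.filter (fun z => h ≤ Z.hh z ∧
            ¬ PR Z F' (r + 1) Ns z h ∧ 3 * h < Ns z - Kc Z F' (r + 1) z h)))
      omega
  · intro he
    apply Finset.sum_eq_zero
    intro z _
    by_contra hne
    have hz : 0 < Ns z := (hpos' z).1 (Nat.pos_of_ne_zero hne)
    obtain ⟨x, hx, _⟩ := hfirst z hz
    have he : R' = ∅ := he
    rw [he] at hx
    simp at hx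
  · intro x hx
    have hx : x ∈ Q (Z.zt x) := (hmR' x).1 hx
    exact (hRf x).1 (Finset.mem_inter.1 ((hZC _).sub hx)).1
  · intro hbF
    have hbf : b + 1 ∈ Rf := (hRf _).2 ⟨Or.inr (Or.inl (by simpa using hbR)), hbF⟩
    have hex : (S.D (Z.zt (b + 1))).ex := by
      by_contra hex
      have := (FI_bound hS ha hb hex ((Z.mem_zf _ _).2 rfl : b + 1 ∈ _)).2
      omega
    have hp : 0 < Ns (Z.zt (b + 1)) := by
      rw [hNe _ hex]
      exact Finset.card_pos.2 ⟨b + 1, Finset.mem_inter.2 ⟨hbf, (Z.mem_zf _ _).2 rfl⟩⟩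
    have hno : ¬ ∃ y, Z.zt (b + 1) < y ∧ 0 < Ns y := by
      rintro ⟨y, hy, hyp⟩
      by_cases hey : (S.D y).ex
      · rw [hNe y hey] at hyp
        obtain ⟨x, hx⟩ := Finset.card_pos.1 hyp
        rw [Finset.mem_inter, Z.mem_zf] at hx
        have := hnbI x (Finset.mem_filter.1 hx.1).1
        have := Z.zt_mono this.2
        omega
      · obtain ⟨_, x, hx, hxy⟩ := hS.btw y hey
        have := hb x hx
        have := Z.zt_mono (show x ≤ b + 1 by omega)
        omega
    have := ((hZC _).ends hp (Or.inr hno)).2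
    show b + 1 ∈ R'
    rw [hmR', this]
    exact Finset.mem_inter.2 ⟨hbf, (Z.mem_zf _ _).2 rfl⟩
  · intro haF
    have haf : a - 1 ∈ Rf := (hRf _).2 ⟨Or.inr (Or.inr (by simpa using haR)), haF⟩
    have hex : (S.D (Z.zt (a - 1))).ex := by
      by_contra hex
      have := (FI_bound hS ha hb hex ((Z.mem_zf _ _).2 rfl : a - 1 ∈ _)).1
      omega
    have hp : 0 < Ns (Z.zt (a - 1)) := by
      rw [hNe _ hex]
      exact Finset.card_pos.2 ⟨a - 1, Finset.mem_inter.2 ⟨haf, (Z.mem_zf _ _).2 rfl⟩⟩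
    have hno : ¬ ∃ y, y < Z.zt (a - 1) ∧ 0 < Ns y := by
      rintro ⟨y, hy, hyp⟩
      by_cases hey : (S.D y).ex
      · rw [hNe y hey] at hyp
        obtain ⟨x, hx⟩ := Finset.card_pos.1 hyp
        rw [Finset.mem_inter, Z.mem_zf] at hx
        have := hnbI x (Finset.mem_filter.1 hx.1).1
        have := Z.zt_mono this.1
        omega
      · obtain ⟨⟨x, hx, hxy⟩, _⟩ := hS.btw y hey
        have := ha x hx
        have := Z.zt_mono (show a - 1 ≤ x by omega)
        omega
    have := ((hZC _).ends hp (Or.inl hno)).2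
    show a - 1 ∈ R'
    rw [hmR', this]
    exact Finset.mem_inter.2 ⟨haf, (Z.mem_zf _ _).2 rfl⟩
  · show ∑ z ∈ S.Zs, S.n z + 2 ≤ ∑ z ∈ Zs', n' z + _
    have s1 : ∑ z ∈ S.Zs, S.n z ≤ ∑ z ∈ Zs', S.n z :=
      Finset.sum_le_sum_of_subset Finset.subset_union_left
    have s2 : ∑ z ∈ Zs', Ns z ≤ ∑ z ∈ Zs', n' z := Finset.sum_le_sum (fun z _ => (hZC z).le)
    have hane : a - 1 ≠ b + 1 := by have := ha b hbR; omega
    have s3 : 2 ≤ ∑ z ∈ Zs', (({a - 1, b + 1} : Finset ℤ) ∩ Z.zf z).card := by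
      refine le_trans (le_of_eq (Finset.card_pair hane).symm) (sum_zf_ge Z _ _ ?_)
      intro x hx
      apply Finset.mem_union_right
      apply Finset.mem_image_of_mem
      rw [hmnb]
      rcases Finset.mem_insert.1 hx with rfl | hx
      · right; right; simpa using haR
      · rw [Finset.mem_singleton] at hx
        subst hx
        right; left; simpa using hbR
    have s4 := sum_zf_le Z ((Finset.Icc (a - 1) (b + 1)).filter (fun x => (x, r + 1) ∈ F')) Zs'
    have s5 : ∑ z ∈ Zs', (S.n z + (({a - 1, b + 1} : Finset ℤ) ∩ Z.zf z).card) ≤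
        ∑ z ∈ Zs', (Ns z + (((Finset.Icc (a - 1) (b + 1)).filter
          (fun x => (x, r + 1) ∈ F')) ∩ Z.zf z).card) := by
      apply Finset.sum_le_sum
      intro z _
      by_cases hex : (S.D z).ex
      · rw [hS.exn z hex, hNe z hex, ← Finset.card_union_of_disjoint]
        · refine le_trans (Finset.card_le_card ?_) (Finset.card_union_le _ _)
          intro x hx
          have hx2 : x ∈ nb ∧ x ∈ Z.zf z := by
            rw [Finset.mem_union, Finset.mem_inter, Finset.mem_inter] at hx
            rcases hx with hx | hx
            · exact ⟨(hmnb x).2 (Or.inl hx.1), hx.2⟩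
            · refine ⟨(hmnb x).2 ?_, hx.2⟩
              rcases Finset.mem_insert.1 hx.1 with rfl | hx
              · right; right; simpa using haR
              · rw [Finset.mem_singleton] at hx
                subst hx
                right; left; simpa using hbR
          rw [Finset.mem_union, Finset.mem_inter, Finset.mem_inter, Finset.mem_filter,
            Finset.mem_filter, Finset.mem_Icc]
          have := hnbI x hx2.1
          tauto
        · rw [Finset.disjoint_left]
          intro x hx hy
          rw [Finset.mem_inter] at hx hy
          have h1 := ha x hx.1
          have h2 := hb x hx.1
          have := hy.1
          rw [Finset.mem_insert, Finset.mem_singleton] at this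
          omega
      · have e0 : ({a - 1, b + 1} : Finset ℤ) ∩ Z.zf z = ∅ := by
          rw [Finset.eq_empty_iff_forall_notMem]
          intro x hx
          rw [Finset.mem_inter, Finset.mem_insert, Finset.mem_singleton] at hx
          have := FI_bound hS ha hb hex hx.2
          omega
        have e1 : ((Finset.Icc (a - 1) (b + 1)).filter (fun x => (x, r + 1) ∈ F')) ∩ Z.zf z =
            (Z.zf z).filter (fun x => (x, r + 1) ∈ F') := by
          ext x
          rw [Finset.mem_inter, Finset.mem_filter, Finset.mem_filter, Finset.mem_Icc]
          constructor
          · rintro ⟨⟨_, h⟩, h2⟩; exact ⟨h2, h⟩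
          · rintro ⟨h2, h⟩
            have := FI_bound hS ha hb hex h2
            exact ⟨⟨⟨by omega, by omega⟩, h⟩, h2⟩
        rw [e0, e1]
        exact hNd z
    rw [Finset.sum_add_distrib, Finset.sum_add_distrib] at s5
    omega

end Contain

open Set

namespace Contain

def lv (m : ℕ) : ℕ := Nat.log 128 m

theorem lv_le {m : ℕ} (hm : 1 ≤ m) : 128 ^ lv m ≤ m := Nat.pow_log_le_self 128 (by omega)
theorem lt_lv (m : ℕ) : m < 128 ^ (lv m + 1) := Nat.lt_pow_succ_log_self (by norm_num) m
theorem lv_mono {m n : ℕ} (h : m ≤ n) : lv m ≤ lv n := Nat.log_mono_right h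

/-- the left end of the interval of length `e ^ lv m` containing `m` -/
def pid (e m : ℕ) : ℕ := m / e ^ lv m * e ^ lv m

theorem pid_le (e m : ℕ) : pid e m ≤ m := Nat.div_mul_le_self _ _

theorem le_pid {e m : ℕ} (he : e ∣ 128) (hm : 1 ≤ m) : 128 ^ lv m ≤ pid e m := by
  have hd : e ^ lv m ∣ 128 ^ lv m := pow_dvd_pow_of_dvd he _
  obtain ⟨q, hq⟩ := hd
  have he0 : 0 < e ^ lv m := by
    apply Nat.pow_pos
    apply Nat.pos_of_ne_zero
    rintro rfl
    norm_num at he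
  have : q ≤ m / e ^ lv m := by
    rw [Nat.le_div_iff_mul_le he0]
    have := lv_le hm
    rw [hq] at this
    linarith
  unfold pid
  rw [hq]
  nlinarith

theorem lt_pid {e : ℕ} (he : 0 < e) (m : ℕ) : m < pid e m + e ^ lv m := by
  unfold pid
  have := Nat.lt_div_mul_add (a := m) (b := e ^ lv m) (Nat.pow_pos he)
  omega

theorem lv_pid {e m : ℕ} (he : e ∣ 128) (hm : 1 ≤ m) : lv (pid e m) = lv m := by
  have h1 := le_pid he hm
  apply le_antisymm (lv_mono (pid_le e m))
  have : lv (128 ^ lv m) = lv m := Nat.log_pow (by norm_num) _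
  rw [← this]
  exact (lv_mono h1).trans' (by rw [this])

theorem pid_mono {e m n : ℕ} (he : e ∣ 128) (hm : 1 ≤ m) (h : m ≤ n) : pid e m ≤ pid e n := by
  rcases Nat.lt_or_ge (lv m) (lv n) with hl | hl
  · have h1 := pid_le e m
    have h2 := lt_lv m
    have h3 := le_pid he (hm.trans h)
    have h4 : 128 ^ (lv m + 1) ≤ 128 ^ lv n := Nat.pow_le_pow_right (by norm_num) hl
    omega
  · have : lv m = lv n := le_antisymm (lv_mono h) hl
    unfold pid
    rw [this]
    exact Nat.mul_le_mul_right _ (Nat.div_le_div_right h)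

def wt (x : ℤ) : ℕ := if 0 ≤ x then (x + 1).toNat else (-x).toNat

theorem wt_pos (x : ℤ) : 1 ≤ wt x := by unfold wt; split_ifs <;> omega

def sid (e : ℕ) (x : ℤ) : ℤ := if 0 ≤ x then (pid e (wt x) : ℤ) else -(pid e (wt x) : ℤ)

theorem pid_pos {e : ℕ} (he : e ∣ 128) (x : ℤ) : 1 ≤ pid e (wt x) :=
  le_trans (Nat.one_le_pow _ _ (by norm_num)) (le_pid he (wt_pos x))

theorem sid_abs (e : ℕ) (x : ℤ) : (sid e x).natAbs = pid e (wt x) := by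
  unfold sid; split_ifs <;> simp

theorem sid_mono {e : ℕ} (he : e ∣ 128) : Monotone (sid e) := by
  intro x y h
  have px := pid_pos he x
  have py := pid_pos he y
  have h1 : 0 ≤ x → pid e (wt x) ≤ pid e (wt y) := fun hx =>
    pid_mono he (wt_pos x) (by unfold wt; split_ifs <;> omega)
  have h2 : y < 0 → pid e (wt y) ≤ pid e (wt x) := fun hx =>
    pid_mono he (wt_pos y) (by unfold wt; split_ifs <;> omega)
  unfold sid
  split_ifs <;> omega

theorem sid_sign {e : ℕ} (he : e ∣ 128) {x y : ℤ} (h : sid e x = sid e y) : 0 ≤ x ↔ 0 ≤ y := by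
  have px := pid_pos he x
  have py := pid_pos he y
  unfold sid at h
  split_ifs at h <;> omega

theorem wt_inj {x y : ℤ} (hs : 0 ≤ x ↔ 0 ≤ y) (h : wt x = wt y) : x = y := by
  unfold wt at h
  split_ifs at h <;> omega

noncomputable def sf (e : ℕ) (z : ℤ) : Finset ℤ :=
  (Finset.Icc (-(2 * (z.natAbs : ℤ))) (2 * (z.natAbs : ℤ))).filter (fun x => sid e x = z)

theorem mem_sf {e : ℕ} (he : e ∣ 128) (x z : ℤ) : x ∈ sf e z ↔ sid e x = z := by
  unfold sf
  rw [Finset.mem_filter, Finset.mem_Icc]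
  refine ⟨fun h => h.2, fun h => ⟨?_, h⟩⟩
  have h0 := sid_abs e x
  rw [h] at h0
  have he0 : 0 < e := Nat.pos_of_ne_zero (by rintro rfl; norm_num at he)
  have h1 := lt_pid he0 (wt x)
  have h2 := le_pid he (wt_pos x)
  have h3 : e ^ lv (wt x) ≤ 128 ^ lv (wt x) :=
    Nat.pow_le_pow_left (Nat.le_of_dvd (by norm_num) he) _
  have : wt x < 2 * z.natAbs := by omega
  unfold wt at this
  split_ifs at this <;> omega

theorem sf_wt {e : ℕ} (he : e ∣ 128) {x z : ℤ} (h : x ∈ sf e z) :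
    lv (wt x) = lv z.natAbs ∧ z.natAbs ≤ wt x ∧ wt x < z.natAbs + e ^ lv z.natAbs := by
  rw [mem_sf he] at h
  have h0 := sid_abs e x
  rw [h] at h0
  have he0 : 0 < e := Nat.pos_of_ne_zero (by rintro rfl; norm_num at he)
  have h1 := lt_pid he0 (wt x)
  have h4 : lv z.natAbs = lv (wt x) := by rw [h0, lv_pid he (wt_pos x)]
  rw [h4, h0]
  exact ⟨rfl, pid_le _ _, h1⟩

theorem sf_card {e : ℕ} (he : e ∣ 128) (z : ℤ) : (sf e z).card ≤ e ^ lv z.natAbs := by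
  have : (sf e z).card ≤ (Finset.Ico z.natAbs (z.natAbs + e ^ lv z.natAbs)).card := by
    apply Finset.card_le_card_of_injOn wt
    · intro x hx
      have := sf_wt he (Finset.mem_coe.1 hx)
      rw [Finset.mem_coe, Finset.mem_Ico]
      exact this.2
    · intro x hx y hy hxy
      have hx := (mem_sf he _ _).1 (Finset.mem_coe.1 hx)
      have hy := (mem_sf he _ _).1 (Finset.mem_coe.1 hy)
      exact wt_inj (sid_sign he (hx.trans hy.symm)) hxy
  simpa using this

theorem d2 : (2 : ℕ) ∣ 128 := by norm_num
theorem d8 : (8 : ℕ) ∣ 128 := by norm_num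

theorem bz_wt {x y : ℤ} (h : sid 2 x = sid 2 y) :
    lv (wt x) = lv (wt y) ∧ wt x / 2 ^ lv (wt x) = wt y / 2 ^ lv (wt x) := by
  have h0 : pid 2 (wt x) = pid 2 (wt y) := by rw [← sid_abs, ← sid_abs, h]
  have h1 : lv (wt x) = lv (wt y) := by
    rw [← lv_pid d2 (wt_pos x), ← lv_pid d2 (wt_pos y), h0]
  refine ⟨h1, ?_⟩
  unfold pid at h0
  rw [← h1] at h0
  exact Nat.eq_of_mul_eq_mul_right (Nat.pow_pos (by norm_num)) h0

theorem div8 (m k : ℕ) : m / 8 ^ k = m / 2 ^ k / 4 ^ k := by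
  rw [Nat.div_div_eq_div_mul, ← Nat.mul_pow]

theorem nb_le (z : ℤ) : ((sf 8 z).image (sid 2)).card ≤ (2 ^ lv z.natAbs) ^ 2 := by
  set k := lv z.natAbs with hk
  have hp : 0 < 2 ^ k := Nat.pow_pos (by norm_num)
  have h4 : (2 ^ k) ^ 2 = 4 ^ k := by rw [← pow_mul, mul_comm, pow_mul]; norm_num
  have h84 : (8 : ℕ) ^ k = 4 ^ k * 2 ^ k := by rw [← mul_pow]; norm_num
  have key : ∀ x ∈ sf 8 z, lv (wt x) = k ∧
      (sid 2 x).natAbs / 2 ^ k = wt x / 2 ^ k := by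
    intro x hx
    have h1 := sf_wt d8 hx
    refine ⟨h1.1, ?_⟩
    rw [sid_abs]
    unfold pid
    rw [h1.1, Nat.mul_div_cancel _ hp]
  have : ((sf 8 z).image (sid 2)).card ≤
      (Finset.Ico (z.natAbs / 2 ^ k) (z.natAbs / 2 ^ k + 4 ^ k)).card := by
    apply Finset.card_le_card_of_injOn (fun b => b.natAbs / 2 ^ k)
    · intro b hb
      obtain ⟨x, hx, rfl⟩ := Finset.mem_image.1 (Finset.mem_coe.1 hb)
      have h1 := sf_wt d8 hx
      rw [Finset.mem_coe, Finset.mem_Ico]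
      simp only
      rw [(key x hx).2]
      refine ⟨Nat.div_le_div_right h1.2.1, ?_⟩
      have h2 := h1.2.2
      rw [← hk, h84] at h2
      have h3 : (z.natAbs + 4 ^ k * 2 ^ k) / 2 ^ k = z.natAbs / 2 ^ k + 4 ^ k :=
        Nat.add_mul_div_right _ _ hp
      rw [← h3]
      have hz : pid 8 (wt x) = z.natAbs := by rw [← sid_abs, (mem_sf d8 _ _).1 hx]
      have hdv : 2 ^ k ∣ z.natAbs := by
        rw [← hz]
        unfold pid
        rw [h1.1, ← hk]
        exact Dvd.dvd.mul_left (pow_dvd_pow_of_dvd (by norm_num) _) _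
      rw [Nat.div_lt_iff_lt_mul hp, Nat.div_mul_cancel (Dvd.dvd.add hdv (Dvd.intro_left _ rfl))]
      exact h2
    · intro b hb b' hb' hbb
      obtain ⟨x, hx, rfl⟩ := Finset.mem_image.1 (Finset.mem_coe.1 hb)
      obtain ⟨y, hy, rfl⟩ := Finset.mem_image.1 (Finset.mem_coe.1 hb')
      simp only at hbb
      have hsg : 0 ≤ x ↔ 0 ≤ y := sid_sign d8 (((mem_sf d8 _ _).1 hx).trans ((mem_sf d8 _ _).1 hy).symm)
      rw [(key x hx).2, (key y hy).2] at hbb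
      have : pid 2 (wt x) = pid 2 (wt y) := by
        unfold pid
        rw [(key x hx).1, (key y hy).1, hbb]
      unfold sid
      rw [this]
      simp only [hsg]
  rw [h4]
  simpa using this

noncomputable def ZZ : Zoning where
  zt := sid 8
  zt_mono := sid_mono d8
  zf := sf 8
  mem_zf := mem_sf d8
  bt := sid 2
  bt_mono := sid_mono d2
  bf := sf 2
  mem_bf := mem_sf d2
  bt_zt := by
    intro x y h
    obtain ⟨h1, h2⟩ := bz_wt h
    have hs := sid_sign d2 h
    have : pid 8 (wt x) = pid 8 (wt y) := by
      unfold pid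
      rw [← h1, div8, div8, h2]
    unfold sid
    rw [this]
    simp only [hs]
  ell := fun z => 2 ^ lv z.natAbs
  ell_pos := fun z => Nat.one_le_pow _ _ (by norm_num)
  bf_card := by
    intro x
    refine le_trans (sf_card d2 _) ?_
    rw [sid_abs, sid_abs, lv_pid d2 (wt_pos x), lv_pid d8 (wt_pos x)]
  nb_card := nb_le
  zf_card := by
    intro z
    refine le_trans (sf_card d8 z) (le_of_eq ?_)
    rw [← pow_mul, mul_comm, pow_mul]; norm_num

theorem sum16 (K : ℕ) : ∑ k ∈ Finset.range (K + 1), 256 * 16 ^ k ≤ 512 * 16 ^ K := by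
  induction K with
  | zero => simp
  | succ K ih => rw [Finset.sum_range_succ]; rw [pow_succ]; omega

theorem zones_card (M : ℕ) :
    ((Finset.Icc (-(M : ℤ)) M).image (sid 8)).card ≤ 512 * 16 ^ lv (M + 1) := by
  refine le_trans ?_ (sum16 _)
  have hsub : (Finset.Icc (-(M : ℤ)) M).image (sid 8) ⊆
      (Finset.range (lv (M + 1) + 1)).biUnion (fun k =>
        (Finset.range (128 * 16 ^ k)).image (fun q => ((q * 8 ^ k : ℕ) : ℤ)) ∪
        (Finset.range (128 * 16 ^ k)).image (fun q => -((q * 8 ^ k : ℕ) : ℤ))) := by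
    intro z hz
    obtain ⟨x, hx, rfl⟩ := Finset.mem_image.1 hz
    rw [Finset.mem_Icc] at hx
    have hw : wt x ≤ M + 1 := by unfold wt; split_ifs <;> omega
    rw [Finset.mem_biUnion]
    refine ⟨lv (wt x), Finset.mem_range.2 (Nat.lt_succ_of_le (lv_mono hw)), ?_⟩
    have hq : wt x / 8 ^ lv (wt x) < 128 * 16 ^ lv (wt x) := by
      rw [Nat.div_lt_iff_lt_mul (Nat.pow_pos (by norm_num)), mul_assoc, ← mul_pow]
      have := lt_lv (wt x)
      rw [pow_succ] at this
      norm_num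
      omega
    rw [Finset.mem_union, Finset.mem_image, Finset.mem_image]
    unfold sid
    split_ifs
    · left; exact ⟨_, Finset.mem_range.2 hq, rfl⟩
    · right; exact ⟨_, Finset.mem_range.2 hq, rfl⟩
  refine le_trans (Finset.card_le_card hsub) (le_trans Finset.card_biUnion_le ?_)
  apply Finset.sum_le_sum
  intro k _
  refine le_trans (Finset.card_union_le _ _) ?_
  have h1 : ((Finset.range (128 * 16 ^ k)).image (fun q => ((q * 8 ^ k : ℕ) : ℤ))).card ≤ 128 * 16 ^ k :=
    le_trans Finset.card_image_le (by simp)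
  have h2 : ((Finset.range (128 * 16 ^ k)).image (fun q => -((q * 8 ^ k : ℕ) : ℤ))).card ≤ 128 * 16 ^ k :=
    le_trans Finset.card_image_le (by simp)
  omega

open Classical in
theorem size_bound {F : Set (ℤ × ℤ)} {r : ℤ} {S : FS} (hS : FI ZZ F r S) (M : ℕ)
    (hM : ∀ x ∈ S.R, -(M : ℤ) ≤ x ∧ x ≤ M) : S.R.card ≤ 7200 * 64 ^ lv (M + 1) := by
  set K := lv (M + 1) with hK
  set W := (Finset.Icc (-(M : ℤ)) M).image (sid 8) with hW
  have hk : ∀ z ∈ W, lv z.natAbs ≤ K := by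
    intro z hz
    obtain ⟨x, hx, rfl⟩ := Finset.mem_image.1 hz
    rw [Finset.mem_Icc] at hx
    rw [sid_abs, lv_pid d8 (wt_pos x)]
    exact lv_mono (by unfold wt; split_ifs <;> omega)
  have e2 : ∀ k, (2 : ℕ) ^ k ≤ 4 ^ k := fun k => Nat.pow_le_pow_left (by norm_num) k
  have e22 : ∀ k, ((2 : ℕ) ^ k) ^ 2 = 4 ^ k := fun k => by rw [← pow_mul, mul_comm, pow_mul]; norm_num
  have e4 : 1 ≤ 4 ^ K := Nat.one_le_pow _ _ (by norm_num)
  have hhh : ∀ z ∈ W, ZZ.hh z ≤ 4 * 4 ^ K := by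
    intro z hz
    show 2 ^ lv z.natAbs + 3 * (2 ^ lv z.natAbs) ^ 2 ≤ _
    have h1 : (4 : ℕ) ^ lv z.natAbs ≤ 4 ^ K := Nat.pow_le_pow_right (by norm_num) (hk z hz)
    have := e2 (lv z.natAbs)
    rw [e22]
    omega
  have hhold : ∀ z ∈ W, ZZ.ell z ^ 2 + ZZ.tt z ≤ 14 * 4 ^ K := by
    intro z hz
    have h1 : (4 : ℕ) ^ lv z.natAbs ≤ 4 ^ K := Nat.pow_le_pow_right (by norm_num) (hk z hz)
    have h2 := hhh z hz
    have h3 : ZZ.ell z ^ 2 = 4 ^ lv z.natAbs := e22 _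
    unfold Zoning.tt
    omega
  have hbig := hS.size W _ hhh
  have hzc : W.card ≤ 512 * 16 ^ K := zones_card M
  have hz8 : ∀ z ∈ W, (S.R ∩ ZZ.zf z).card ≤ 8 ^ K := by
    intro z hz
    refine le_trans (Finset.card_le_card Finset.inter_subset_right) ?_
    exact le_trans (sf_card d8 z) (Nat.pow_le_pow_right (by norm_num) (hk z hz))
  have h1 : S.R.card ≤ ∑ z ∈ W, (S.R ∩ ZZ.zf z).card := by
    apply sum_zf_ge
    intro x hx
    exact Finset.mem_image_of_mem _ (Finset.mem_Icc.2 (hM x hx))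
  have h2 : ∑ z ∈ W, (S.R ∩ ZZ.zf z).card ≤ ∑ z ∈ W, (14 * 4 ^ K +
      if ZZ.ell z ^ 2 + ZZ.tt z < (S.R ∩ ZZ.zf z).card then 8 ^ K else 0) := by
    apply Finset.sum_le_sum
    intro z hz
    have := hz8 z hz
    have := hhold z hz
    split_ifs <;> omega
  rw [Finset.sum_add_distrib, ← Finset.sum_filter, Finset.sum_const, Finset.sum_const, smul_eq_mul,
    smul_eq_mul] at h2
  have h3 : W.card * (14 * 4 ^ K) ≤ 7168 * 64 ^ K := by
    calc W.card * (14 * 4 ^ K) ≤ 512 * 16 ^ K * (14 * 4 ^ K) := Nat.mul_le_mul_right _ hzc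
      _ = 7168 * (16 ^ K * 4 ^ K) := by ring
      _ = 7168 * 64 ^ K := by rw [← mul_pow]; norm_num
  have h4 : (W.filter (fun z => ZZ.ell z ^ 2 + ZZ.tt z < (S.R ∩ ZZ.zf z).card)).card * 8 ^ K ≤
      24 * 64 ^ K := by
    calc _ ≤ (24 * 4 ^ K) * 8 ^ K := Nat.mul_le_mul_right _ (by omega)
      _ = 24 * (4 ^ K * 8 ^ K) := by ring
      _ = 24 * 32 ^ K := by rw [← mul_pow]; norm_num
      _ ≤ 24 * 64 ^ K := Nat.mul_le_mul_left _ (Nat.pow_le_pow_left (by norm_num) _)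
  omega

theorem rp_bound (m : ℕ) (hm : 1 ≤ m) : ((64 ^ lv m : ℕ) : ℝ) ≤ (m : ℝ) ^ ((6 : ℝ) / 7) := by
  have h1 : ((128 ^ lv m : ℕ) : ℝ) ≤ m := by exact_mod_cast lv_le hm
  have h2 : ((64 ^ lv m : ℕ) : ℝ) = ((128 ^ lv m : ℕ) : ℝ) ^ ((6 : ℝ) / 7) := by
    push_cast
    rw [← Real.rpow_natCast (128 : ℝ), ← Real.rpow_natCast (64 : ℝ),
      show (128 : ℝ) = 2 ^ (7 : ℝ) by norm_num, show (64 : ℝ) = 2 ^ (6 : ℝ) by norm_num,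
      ← Real.rpow_mul (by norm_num), ← Real.rpow_mul (by norm_num), ← Real.rpow_mul (by norm_num)]
    congr 1
    ring
  rw [h2]
  exact Real.rpow_le_rpow (by positivity) h1 (by norm_num)

/-! ### Front interface -/

def Front (F : Set (ℤ × ℤ)) (r : ℤ) (R : Finset ℤ) (n : ℕ) : Prop :=
  ∃ S, FI ZZ F r S ∧ S.R = R ∧ ∑ z ∈ S.Zs, S.n z = n ∧ R.Nonempty

theorem Front.ne {F : Set (ℤ × ℤ)} {r : ℤ} {R : Finset ℤ} {n : ℕ} (h : Front F r R n) :
    R.Nonempty := by obtain ⟨S, _, _, _, h⟩ := h; exact h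

theorem Front.pos {F : Set (ℤ × ℤ)} {r : ℤ} {R : Finset ℤ} {n : ℕ} (h : Front F r R n) :
    1 ≤ n := by
  obtain ⟨S, h1, rfl, rfl, x, hx⟩ := h
  have := h1.rpos x hx
  exact le_trans this (Finset.single_le_sum (f := S.n) (fun _ _ => Nat.zero_le _) (h1.supp _ this))

theorem Front.hull {F : Set (ℤ × ℤ)} {r : ℤ} {R : Finset ℤ} {n : ℕ} (h : Front F r R n) {a b : ℤ}
    (ha : ∀ x ∈ R, a ≤ x) (hb : ∀ x ∈ R, x ≤ b) : (n : ℤ) ≤ b - a + 1 := by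
  obtain ⟨S, h1, rfl, rfl, x, hx⟩ := h
  have h2 := FI_hull h1 ha hb
  have := ha x hx
  have := hb x hx
  rw [Int.card_Icc] at h2
  omega

theorem Front.size {F : Set (ℤ × ℤ)} {r : ℤ} {R : Finset ℤ} {n : ℕ} (h : Front F r R n) (M : ℕ)
    (hM : ∀ x ∈ R, -(M : ℤ) ≤ x ∧ x ≤ M) : R.card ≤ 7200 * 64 ^ lv (M + 1) := by
  obtain ⟨S, h1, rfl, rfl, _⟩ := h
  exact size_bound h1 M hM

theorem Front.init (F : Set (ℤ × ℤ)) (r : ℤ) (R : Finset ℤ) (hR : R.card ≤ 2) (h : R.Nonempty) :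
    Front F r R R.card := by
  obtain ⟨S, h1, h2, h3⟩ := FI_init ZZ F r R hR
  exact ⟨S, h1, h2, h3, h⟩

open Classical in
theorem Front.step {F F' : Set (ℤ × ℤ)} {r : ℤ} {R : Finset ℤ} {n : ℕ} (h : Front F r R n)
    (hF : F ⊆ F') (Nw : Finset (ℤ × ℤ))
    (hN : ∀ p ∈ F', p ∈ F ∨ p ∈ Nw) (hN3 : Nw.card ≤ 3) :
    ∃ R' n', ((R' = ∅ ∧ n' = 0) ∨ Front F' (r + 1) R' n') ∧
      (∀ x ∈ R', (x ∈ R ∨ x - 1 ∈ R ∨ x + 1 ∈ R) ∧ (x, r + 1) ∉ F') ∧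
      (∀ b ∈ R, (∀ x ∈ R, x ≤ b) → (b + 1, r + 1) ∉ F' → b + 1 ∈ R') ∧
      (∀ a ∈ R, (∀ x ∈ R, a ≤ x) → (a - 1, r + 1) ∉ F' → a - 1 ∈ R') ∧
      (∀ a b, (∀ x ∈ R, a ≤ x) → (∀ x ∈ R, x ≤ b) → n + 2 ≤ n' +
        ((Finset.Icc (a - 1) (b + 1)).filter (fun x => (x, r + 1) ∈ F')).card) := by
  obtain ⟨S, h1, rfl, rfl, hne⟩ := h
  obtain ⟨S', e1, e2, e3, e4, e5, e6⟩ := front_step h1 hF Nw hN hN3 (Finset.min'_mem _ hne)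
    (Finset.max'_mem _ hne) (fun x hx => Finset.min'_le _ x hx) (fun x hx => Finset.le_max' _ x hx)
  refine ⟨S'.R, ∑ z ∈ S'.Zs, S'.n z, ?_, e3, ?_, ?_, ?_⟩
  · rcases S'.R.eq_empty_or_nonempty with h | h
    · exact Or.inl ⟨h, e2 h⟩
    · exact Or.inr ⟨S', e1, rfl, rfl, h⟩
  · intro b hb hbm
    have : b = S.R.max' hne := le_antisymm (Finset.le_max' _ _ hb) (hbm _ (Finset.max'_mem _ hne))
    rw [this]; exact e4
  · intro b hb hbm
    have : b = S.R.min' hne := le_antisymm (hbm _ (Finset.min'_mem _ hne)) (Finset.min'_le _ _ hb)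
    rw [this]; exact e5
  · intro a b ha hb
    refine le_trans e6 (Nat.add_le_add_left (Finset.card_le_card ?_) _)
    apply Finset.filter_subset_filter
    apply Finset.Icc_subset_Icc
    · have := ha _ (Finset.min'_mem _ hne); omega
    · have := hb _ (Finset.max'_mem _ hne); omega

end Contain

open Set

namespace Contain

/-! ### Global argument: four fronts -/

def psi (i : Fin 4) (u : ℤ × ℤ) : ℤ × ℤ :=
  match i with
  | 0 => (u.1, u.2)
  | 1 => (u.2, -u.1)
  | 2 => (-u.1, -u.2)
  | 3 => (-u.2, u.1)

def row (i : Fin 4) (v : ℤ × ℤ) : ℤ :=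
  match i with
  | 0 => v.2
  | 1 => v.1
  | 2 => -v.2
  | 3 => -v.1

theorem row_psi0 (i : Fin 4) (a b : ℤ) : row i (psi i (a, b)) = b := by
  fin_cases i <;> simp [row, psi]
theorem row_psi1 (i : Fin 4) (a b : ℤ) : row (i + 1) (psi i (a, b)) = a := by
  fin_cases i <;> simp [row, psi]
theorem row_psi2 (i : Fin 4) (a b : ℤ) : row (i + 2) (psi i (a, b)) = -b := by
  fin_cases i <;> simp [row, psi]
theorem row_psi3 (i : Fin 4) (a b : ℤ) : row (i + 3) (psi i (a, b)) = -a := by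
  fin_cases i <;> simp [row, psi]
theorem row_add2 (i : Fin 4) (v : ℤ × ℤ) : row (i + 2) v = - row i v := by
  fin_cases i <;> simp [row]
theorem row_add3 (i : Fin 4) (v : ℤ × ℤ) : row (i + 3) v = - row (i + 1) v := by
  fin_cases i <;> simp [row]
theorem psi_row (i : Fin 4) (v : ℤ × ℤ) : psi i (row (i + 1) v, row i v) = v := by
  fin_cases i <;> simp [row, psi]
theorem psi_next (i : Fin 4) (a b : ℤ) : psi i (a, b) = psi (i + 1) (-b, a) := by
  fin_cases i <;> simp [psi]
theorem psi_inj (i : Fin 4) : Function.Injective (psi i) := by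
  rintro ⟨a, b⟩ ⟨c, d⟩ h
  have h1 := row_psi0 i a b
  have h2 := row_psi1 i a b
  rw [h, row_psi0] at h1
  rw [h, row_psi1] at h2
  rw [h1, h2]
theorem row_all {P : Fin 4 → Prop} (i : Fin 4) (h0 : P i) (h1 : P (i + 1)) (h2 : P (i + 2))
    (h3 : P (i + 3)) : ∀ k, P k := by
  intro k
  have : k = i ∨ k = i + 1 ∨ k = i + 2 ∨ k = i + 3 := by clear h0 h1 h2 h3; revert i k; decide
  rcases this with rfl | rfl | rfl | rfl <;> assumption

theorem adj_psi (i : Fin 4) {a a' b : ℤ} (h : a' = a ∨ a' = a - 1 ∨ a' = a + 1) :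
    adjStrong (psi i (a', b)) (psi i (a, b + 1)) := by
  fin_cases i <;> rcases h with rfl | rfl | rfl <;> simp [adjStrong, psi]

structure St where
  p : Fin 4 → ℤ
  R : Fin 4 → Finset ℤ
  n : Fin 4 → ℕ
  D : Finset (ℤ × ℤ)

def alf (R : Finset ℤ) : ℤ := if R.Nonempty then 1 else 0

theorem alf_pos {R : Finset ℤ} (h : R.Nonempty) : alf R = 1 := by simp [alf, h]
theorem alf_nn (R : Finset ℤ) : 0 ≤ alf R := by unfold alf; split_ifs <;> simp
theorem alf_le (R : Finset ℤ) : alf R ≤ 1 := by unfold alf; split_ifs <;> simp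
theorem alf_cases (R : Finset ℤ) : (R.Nonempty ∧ alf R = 1) ∨ (R = ∅ ∧ alf R = 0) := by
  rcases R.eq_empty_or_nonempty with h | h
  · right; simp [alf, h]
  · left; simp [alf, h]

def kap (s : St) (i : Fin 4) : ℤ :=
  if s.p (i + 1) ∈ s.R i ∧ -s.p i ∈ s.R (i + 1) then 1 else 0

def pre (i : Fin 4) (F : Finset (ℤ × ℤ)) : Set (ℤ × ℤ) := {u | psi i u ∈ F}

structure Inv0 (t : ℕ) (F : Finset (ℤ × ℤ)) (B : Set (ℤ × ℤ)) (s : St) : Prop where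
  fr : ∀ i, (s.R i = ∅ ∧ s.n i = 0) ∨ Front (pre i F) (s.p i) (s.R i) (s.n i)
  box : ∀ v ∈ B, ∀ i, row i v ≤ s.p i
  occ : ∀ i, ∀ x ∈ s.R i, psi i (x, s.p i) ∈ B
  cor : ∀ i j, j = i + 1 → (s.R i).Nonempty → (s.R j).Nonempty →
    (s.p j ∈ s.R i ↔ -s.p i ∈ s.R j)
  p0 : ∀ i, 0 ≤ s.p i
  p1 : ∀ i, s.p i ≤ t + 1
  Dsub : s.D ⊆ F
  Dbox : ∀ v ∈ s.D, ∀ i, row i v ≤ s.p i + 1 - alf (s.R i)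
  Fc : F.card ≤ 3 * t

theorem Inv0.rng {t : ℕ} {F : Finset (ℤ × ℤ)} {B : Set (ℤ × ℤ)} {s : St} (h : Inv0 t F B s)
    {i : Fin 4} {x : ℤ} (hx : x ∈ s.R i) : -s.p (i + 3) ≤ x ∧ x ≤ s.p (i + 1) := by
  have h1 := h.box _ (h.occ i x hx) (i + 1)
  have h2 := h.box _ (h.occ i x hx) (i + 3)
  rw [row_psi1] at h1
  rw [row_psi3] at h2
  omega

theorem Inv0.stepi {t : ℕ} {F F' : Finset (ℤ × ℤ)} {B : Set (ℤ × ℤ)} {s : St} (h : Inv0 t F B s)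
    (hF : F ⊆ F') (h3 : (F' \ F).card ≤ 3) (i : Fin 4) :
    ∃ (A : Finset ℤ) (m : ℕ) (X : Finset (ℤ × ℤ)), (s.R i = ∅ → A = ∅ ∧ m = 0) ∧
      ((A = ∅ ∧ m = 0) ∨ Front (pre i F') (s.p i + 1) A m) ∧
      (∀ x ∈ A, (x ∈ s.R i ∨ x - 1 ∈ s.R i ∨ x + 1 ∈ s.R i) ∧ psi i (x, s.p i + 1) ∉ F') ∧
      (s.p (i + 1) ∈ s.R i → psi i (s.p (i + 1) + 1, s.p i + 1) ∉ F' → s.p (i + 1) + 1 ∈ A) ∧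
      (-s.p (i + 3) ∈ s.R i → psi i (-(s.p (i + 3) + 1), s.p i + 1) ∉ F' →
        -(s.p (i + 3) + 1) ∈ A) ∧
      (∀ v ∈ X, v ∈ F' ∧ row i v = s.p i + 1 ∧ (s.R i).Nonempty ∧
        (∃ x ∈ s.R i, row (i + 1) v ≤ x + 1) ∧ ∃ x ∈ s.R i, x - 1 ≤ row (i + 1) v) ∧
      ((s.n i : ℤ) + 2 * alf (s.R i) ≤ m + X.card) := by
  classical
  rcases h.fr i with ⟨h1, h2⟩ | hf
  · refine ⟨∅, 0, ∅, ?_⟩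
    simp [h1, h2, alf]
  · have hN : ∀ p ∈ pre i F', p ∈ pre i F ∨
        p ∈ (F' \ F).image (fun v => (row (i + 1) v, row i v)) := by
      rintro ⟨a, b⟩ hp
      by_cases hh : psi i (a, b) ∈ F
      · left; exact hh
      · right
        refine Finset.mem_image.2 ⟨psi i (a, b), Finset.mem_sdiff.2 ⟨hp, hh⟩, ?_⟩
        rw [row_psi0, row_psi1]
    obtain ⟨A, m, e1, e2, e3, e4, e5⟩ := hf.step (F' := pre i F') (fun u hu => hF hu) _ hN
      (le_trans Finset.card_image_le h3)
    have hne := hf.ne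
    have e5 := e5 ((s.R i).min' hne) ((s.R i).max' hne) (fun x hx => Finset.min'_le _ x hx)
      (fun x hx => Finset.le_max' _ x hx)
    refine ⟨A, m, ((Finset.Icc ((s.R i).min' hne - 1) ((s.R i).max' hne + 1)).filter
      (fun x => (x, s.p i + 1) ∈ pre i F')).image (fun x => psi i (x, s.p i + 1)),
      ?_, e1, e2, ?_, ?_, ?_, ?_⟩
    · intro h0; simp [h0] at hne
    · intro hx; exact e3 _ hx (fun y hy => (h.rng hy).2)
    · intro hx hy
      have e : -(s.p (i + 3) + 1) = -s.p (i + 3) - 1 := by ring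
      rw [e] at hy ⊢
      exact e4 _ hx (fun y hy => (h.rng hy).1) hy
    · intro v hv
      obtain ⟨x, hx, rfl⟩ := Finset.mem_image.1 hv
      obtain ⟨hx1, hx2⟩ := Finset.mem_filter.1 hx
      rw [Finset.mem_Icc] at hx1
      refine ⟨hx2, row_psi0 _ _ _, hne, ⟨_, Finset.max'_mem _ hne, ?_⟩,
        ⟨_, Finset.min'_mem _ hne, ?_⟩⟩
      · rw [row_psi1]; exact hx1.2
      · rw [row_psi1]; exact hx1.1
    · rw [Finset.card_image_of_injective]
      · rw [alf_pos hne]; exact_mod_cast e5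
      · intro a b hab
        have := psi_inj i hab
        simpa using this

end Contain

open Set

namespace Contain

theorem f31 (i : Fin 4) : i + 3 + 1 = i := by revert i; decide
theorem f11 (i : Fin 4) : i + 1 + 1 = i + 2 := by revert i; decide
theorem ftri (i j : Fin 4) (h : i ≠ j) : j = i + 1 ∨ j = i + 2 ∨ i = j + 1 := by
  revert i j; decide
theorem f13 (i : Fin 4) : i + 1 + 3 = i := by revert i; decide
theorem f4 (i : Fin 4) : i = i + 3 + 1 := by revert i; decide

theorem Inv0.turn {t : ℕ} {F F' : Finset (ℤ × ℤ)} {B : Set (ℤ × ℤ)} {s : St} (h : Inv0 t F B s)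
    (hF : F ⊆ F') (h3 : (F' \ F).card ≤ 3) :
    ∃ (s' : St) (N : Finset (ℤ × ℤ)), Inv0 (t + 1) F' (B ∪ N) s' ∧
      (∀ i, (s'.R i).Nonempty → N.Nonempty) ∧
      (∀ v ∈ N, v ∉ F' ∧ v ∉ B ∧ ∃ u ∈ B, adjStrong u v) ∧
      N.card ≤ 28800 * 64 ^ lv (t + 3) ∧
      (∀ i, s'.p i = s.p i + alf (s'.R i)) ∧
      (∑ i, (s.n i : ℤ) - ∑ i, kap s i + 2 * ∑ i, alf (s.R i) ≤
        ∑ i, (s'.n i : ℤ) - ∑ i, kap s' i + (s'.D.card - s.D.card)) ∧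
      (∀ i, (s.n i : ℤ) + s.n (i + 2) + 2 * (alf (s.R i) + alf (s.R (i + 2))) ≤
        s'.n i + s'.n (i + 2) + (s'.D.card - s.D.card)) := by
  classical
  choose A m X a1 a2 a3 a4 a5 a6 a7 using h.stepi hF h3
  have hFc : F'.card ≤ 3 * (t + 1) := by
    have := Finset.card_sdiff_add_card_eq_card hF
    have := h.Fc
    omega
  have hp := h.p0
  have Aact : ∀ i x, x ∈ A i → (s.R i).Nonempty := by
    intro i x hx
    rcases (s.R i).eq_empty_or_nonempty with h0 | h0
    · rw [(a1 i h0).1] at hx; simp at hx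
    · exact h0
  have Arng : ∀ i x, x ∈ A i → -(s.p (i + 3) + 1) ≤ x ∧ x ≤ s.p (i + 1) + 1 := by
    intro i x hx
    rcases (a3 i x hx).1 with h1 | h1 | h1 <;> have := h.rng h1 <;> omega
  have Artop : ∀ i j, j = i + 1 → s.p j + 1 ∈ A i → s.p j ∈ s.R i := by
    rintro i j rfl hx
    rcases (a3 i _ hx).1 with h1 | h1 | h1
    · have := h.rng h1; omega
    · simpa using h1
    · have := h.rng h1; omega
  have Arbot : ∀ i j, j = i + 1 → -(s.p i + 1) ∈ A j → -s.p i ∈ s.R j := by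
    rintro i j rfl hx
    rcases (a3 _ _ hx).1 with h1 | h1 | h1
    · have := h.rng h1; rw [f13] at this; omega
    · have := h.rng h1; rw [f13] at this; omega
    · have e : -(s.p i + 1) + 1 = -s.p i := by ring
      rwa [e] at h1
  have pcor : ∀ i j, j = i + 1 → psi i (s.p j + 1, s.p i + 1) = psi j (-(s.p i + 1), s.p j + 1) := by
    rintro i j rfl
    exact psi_next i _ _
  -- reborn fronts
  let Reb : Fin 4 → Finset ℤ := fun i =>
    (if -(s.p i + 1) ∈ A (i + 1) then {s.p (i + 1) + 1} else ∅) ∪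
    (if s.p i + 1 ∈ A (i + 3) then {-(s.p (i + 3) + 1)} else ∅)
  have hReb : ∀ i x, x ∈ Reb i ↔ (-(s.p i + 1) ∈ A (i + 1) ∧ x = s.p (i + 1) + 1) ∨
      (s.p i + 1 ∈ A (i + 3) ∧ x = -(s.p (i + 3) + 1)) := by
    intro i x
    simp only [Reb, Finset.mem_union]
    split_ifs <;> simp_all
  have hRebc : ∀ i, (Reb i).card ≤ 2 := by
    intro i
    refine le_trans (Finset.card_union_le _ _) ?_
    split_ifs <;> simp
  obtain ⟨R', hR'⟩ : ∃ R' : Fin 4 → Finset ℤ, ∀ i, R' i = if (s.R i).Nonempty then A i else Reb i :=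
    ⟨_, fun _ => rfl⟩
  obtain ⟨n', hn'⟩ : ∃ n' : Fin 4 → ℕ, ∀ i, n' i = if (s.R i).Nonempty then m i else (Reb i).card :=
    ⟨_, fun _ => rfl⟩
  have R1 : ∀ i, (s.R i).Nonempty → R' i = A i := fun i hi => by rw [hR', if_pos hi]
  have R0 : ∀ i, ¬ (s.R i).Nonempty → R' i = Reb i := fun i hi => by rw [hR', if_neg hi]
  have n1 : ∀ i, (s.R i).Nonempty → n' i = m i := fun i hi => by rw [hn', if_pos hi]
  have n0 : ∀ i, ¬ (s.R i).Nonempty → n' i = (Reb i).card := fun i hi => by rw [hn', if_neg hi]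
  have AR : ∀ i x, x ∈ A i → x ∈ R' i := fun i x hx => by rw [R1 i (Aact i x hx)]; exact hx
  have K1 : ∀ i j, j = i + 1 → s.p j + 1 ∈ A i → -(s.p i + 1) ∈ R' j := by
    rintro i j hj hx
    have hi := Aact _ _ hx
    by_cases hjn : (s.R j).Nonempty
    · have h1 := (h.cor i j hj hi hjn).1 (Artop i j hj hx)
      have h2 := (a3 i _ hx).2
      rw [pcor i j hj] at h2
      have h4 := a5 j
      have e : j + 3 = i := by rw [hj]; exact f13 i
      rw [e] at h4
      exact AR _ _ (h4 h1 h2)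
    · rw [R0 j hjn, hReb]
      right
      have e : j + 3 = i := by rw [hj]; exact f13 i
      rw [e]
      exact ⟨hx, rfl⟩
  have K2 : ∀ i j, j = i + 1 → -(s.p i + 1) ∈ A j → s.p j + 1 ∈ R' i := by
    rintro i j hj hx
    have hjn := Aact _ _ hx
    by_cases hi : (s.R i).Nonempty
    · have h1 := (h.cor i j hj hi hjn).2 (Arbot i j hj hx)
      have h2 := (a3 j _ hx).2
      rw [← pcor i j hj] at h2
      have h4 := a4 i
      rw [← hj] at h4
      exact AR _ _ (h4 h1 h2)
    · rw [R0 i hi, hReb]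
      left
      rw [← hj]
      exact ⟨hx, rfl⟩
  have K3 : ∀ i j, j = i + 1 → s.p j + 1 ∈ R' i → -(s.p i + 1) ∈ R' j := by
    intro i j hj hx
    by_cases hi : (s.R i).Nonempty
    · rw [R1 i hi] at hx; exact K1 i j hj hx
    · rw [R0 i hi, hReb, ← hj] at hx
      rcases hx with ⟨hx, _⟩ | ⟨_, hx⟩
      · exact AR _ _ hx
      · have := hp j; have := hp (i + 3); omega
  have K4 : ∀ i j, j = i + 1 → -(s.p i + 1) ∈ R' j → s.p j + 1 ∈ R' i := by
    intro i j hj hx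
    by_cases hjn : (s.R j).Nonempty
    · rw [R1 j hjn] at hx; exact K2 i j hj hx
    · have e : j + 3 = i := by rw [hj]; exact f13 i
      rw [R0 j hjn, hReb, e] at hx
      rcases hx with ⟨_, hx⟩ | ⟨hx, _⟩
      · have := hp i; have := hp (j + 1); omega
      · exact AR _ _ hx
  -- new cells
  let N : Finset (ℤ × ℤ) := Finset.univ.biUnion fun i => (A i).image fun x => psi i (x, s.p i + 1)
  have hN : ∀ v, v ∈ N ↔ ∃ i, ∃ x ∈ A i, psi i (x, s.p i + 1) = v := by
    intro v; simp [N]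
  have occN : ∀ i, ∀ x ∈ R' i, psi i (x, s.p i + 1) ∈ N := by
    intro i x hx
    rw [hN]
    by_cases hi : (s.R i).Nonempty
    · rw [R1 i hi] at hx; exact ⟨i, x, hx, rfl⟩
    · rw [R0 i hi, hReb] at hx
      rcases hx with ⟨hx, rfl⟩ | ⟨hx, rfl⟩
      · exact ⟨i + 1, _, hx, (pcor i _ rfl).symm⟩
      · exact ⟨i + 3, _, hx, pcor (i + 3) i (f4 i)⟩
  have p'1 : ∀ i, (R' i).Nonempty → s.p i + alf (R' i) = s.p i + 1 := fun i hi => by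
    rw [alf_pos hi]
  have p'0 : ∀ i, s.p i ≤ s.p i + alf (R' i) := fun i => by have := alf_nn (R' i); omega
  -- deleted cells
  have Xdis : ∀ i, Disjoint s.D (X i) := by
    intro i
    rw [Finset.disjoint_left]
    intro v hv hv'
    obtain ⟨_, h1, h2, _⟩ := a6 i v hv'
    have := h.Dbox v hv i
    rw [alf_pos h2] at this
    omega
  have Xrow : ∀ i, ∀ v ∈ X i, ∀ k, row k v ≤ s.p k + 1 := by
    intro i v hv
    obtain ⟨_, h1, h2, ⟨x, hx, hx'⟩, ⟨y, hy, hy'⟩⟩ := a6 i v hv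
    have := h.rng hx
    have := h.rng hy
    refine row_all (P := fun k => row k v ≤ s.p k + 1) i ?_ ?_ ?_ ?_
    · omega
    · omega
    · rw [row_add2]; have := hp i; have := hp (i + 2); omega
    · rw [row_add3]; omega
  have Xopp : ∀ i, Disjoint (X i) (X (i + 2)) := by
    intro i
    rw [Finset.disjoint_left]
    intro v hv hv'
    obtain ⟨_, h1, _⟩ := a6 i v hv
    obtain ⟨_, h2, _⟩ := a6 _ v hv'
    rw [row_add2] at h2
    have := hp i; have := hp (i + 2); omega
  obtain ⟨dup, hdup⟩ : ∃ dup : Fin 4 → ℕ, ∀ i, dup i = if (s.p (i + 1) ∈ s.R i ∧ -s.p i ∈ s.R (i + 1))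
    ∧ psi i (s.p (i + 1) + 1, s.p i + 1) ∈ F' then 1 else 0 := ⟨_, fun _ => rfl⟩
  have Xadj : ∀ i, (X i ∩ X (i + 1)).card ≤ dup i := by
    intro i
    have hsub : ∀ v ∈ X i ∩ X (i + 1), v = psi i (s.p (i + 1) + 1, s.p i + 1) ∧
        s.p (i + 1) ∈ s.R i ∧ -s.p i ∈ s.R (i + 1) := by
      intro v hv
      rw [Finset.mem_inter] at hv
      obtain ⟨_, h1, h2, ⟨x, hx, hx'⟩, _⟩ := a6 _ v hv.1
      obtain ⟨_, h1', h2', _, ⟨y, hy, hy'⟩⟩ := a6 _ v hv.2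
      have r1 := h.rng hx
      have r2 := h.rng hy
      rw [f13] at r2
      have e2 : row (i + 1 + 1) v = - row i v := by
        rw [← row_add2, f11]
      rw [e2] at hy'
      refine ⟨?_, ?_, ?_⟩
      · rw [← h1, ← h1', psi_row]
      · have : x = s.p (i + 1) := by omega
        rwa [← this]
      · have : y = -s.p i := by omega
        rwa [← this]
    rcases (X i ∩ X (i + 1)).eq_empty_or_nonempty with h0 | ⟨v, hv⟩
    · rw [h0]; simp
    · obtain ⟨e, e1⟩ := hsub v hv
      have : v ∈ F' := (a6 i v (Finset.mem_inter.1 hv).1).1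
      rw [hdup, if_pos ⟨e1, e ▸ this⟩, Finset.card_le_one]
      intro a ha b hb
      rw [(hsub a ha).1, (hsub b hb).1]
  let XX : Finset (ℤ × ℤ) := Finset.univ.biUnion X
  have XXdis : Disjoint s.D XX := by
    rw [Finset.disjoint_biUnion_right]; intro i _; exact Xdis i
  have XXc : ∑ i, (X i).card ≤ XX.card + ∑ i, dup i := by
    have hY : ∑ i, (X i \ X (i + 1)).card ≤ XX.card := by
      rw [← Finset.card_biUnion]
      · apply Finset.card_le_card
        apply Finset.biUnion_mono
        intro i _; exact Finset.sdiff_subset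
      · intro i _ j _ hij
        have : j = i + 1 ∨ j = i + 2 ∨ i = j + 1 := ftri i j hij
        rcases this with rfl | rfl | rfl
        · refine Finset.disjoint_left.2 ?_; intro v hv hv'
          exact (Finset.mem_sdiff.1 hv).2 (Finset.mem_sdiff.1 hv').1
        · exact Finset.disjoint_of_subset_left Finset.sdiff_subset
            (Finset.disjoint_of_subset_right Finset.sdiff_subset (Xopp i))
        · refine Finset.disjoint_left.2 ?_; intro v hv hv'
          exact (Finset.mem_sdiff.1 hv').2 (Finset.mem_sdiff.1 hv).1
    refine le_trans ?_ (Nat.add_le_add_right hY _)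
    rw [← Finset.sum_add_distrib]
    apply Finset.sum_le_sum
    intro i _
    have := Finset.card_sdiff_add_card_inter (X i) (X (i + 1))
    have := Xadj i
    omega
  have XX2 : ∀ i, (X i).card + (X (i + 2)).card ≤ XX.card := by
    intro i
    rw [← Finset.card_union_of_disjoint (Xopp i)]
    apply Finset.card_le_card
    apply Finset.union_subset <;> exact Finset.subset_biUnion_of_mem X (Finset.mem_univ _)
  obtain ⟨s', hs'⟩ : ∃ s' : St, s' = ⟨fun i => s.p i + alf (R' i), R', n', s.D ∪ XX⟩ := ⟨_, rfl⟩
  have sR : ∀ i, s'.R i = R' i := fun i => by rw [hs']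
  have sp : ∀ i, s'.p i = s.p i + alf (R' i) := fun i => by rw [hs']
  have sn : ∀ i, s'.n i = n' i := fun i => by rw [hs']
  have sD : s'.D = s.D ∪ XX := by rw [hs']
  have sDc : (s'.D.card : ℤ) = s.D.card + XX.card := by
    rw [sD, Finset.card_union_of_disjoint XXdis]; push_cast; rfl
  clear hs'
  have hk' : ∀ i, kap s' i = 1 ∧ (s.p (i + 1) + 1 ∈ R' i ∧ -(s.p i + 1) ∈ R' (i + 1)) ∨
      kap s' i = 0 := by
    intro i
    unfold kap
    split_ifs with hh
    · left
      refine ⟨rfl, ?_⟩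
      rw [sp, sp, sR, sR] at hh
      have h1 : (R' i).Nonempty := ⟨_, hh.1⟩
      have h2 : (R' (i + 1)).Nonempty := ⟨_, hh.2⟩
      rwa [p'1 _ h1, p'1 _ h2] at hh
    · right; rfl
  have hk0 : ∀ i, 0 ≤ kap s i := by intro i; unfold kap; split_ifs <;> simp
  refine ⟨s', N, ⟨?_, ?_, ?_, ?_, ?_, ?_, ?_, ?_, hFc⟩, ?_, ?_, ?_, ?_, ?_, ?_⟩
  · intro i
    rw [sR, sn, sp]
    rcases (R' i).eq_empty_or_nonempty with h0 | h0
    · left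
      refine ⟨h0, ?_⟩
      by_cases hi : (s.R i).Nonempty
      · rw [n1 i hi]
        rw [R1 i hi] at h0
        rcases a2 i with h1 | h1
        · exact h1.2
        · have := h1.ne; rw [h0] at this; simp at this
      · rw [n0 i hi, ← R0 i hi, h0]; rfl
    · right
      rw [p'1 i h0]
      by_cases hi : (s.R i).Nonempty
      · rw [n1 i hi, R1 i hi]
        rcases a2 i with h1 | h1
        · rw [R1 i hi, h1.1] at h0; simp at h0
        · exact h1
      · rw [n0 i hi, R0 i hi]
        rw [R0 i hi] at h0
        exact Front.init _ _ _ (hRebc i) h0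
  · intro v hv
    rcases hv with hv | hv
    · intro i; rw [sp]; exact le_trans (h.box v hv i) (p'0 i)
    · obtain ⟨i, x, hx, rfl⟩ := (hN v).1 hv
      have hr := Arng i x hx
      refine row_all (P := fun k => row k (psi i (x, s.p i + 1)) ≤ s'.p k) i ?_ ?_ ?_ ?_
      · rw [row_psi0, sp, p'1 i ⟨x, AR i x hx⟩]
      · rw [row_psi1, sp]
        by_cases e : x = s.p (i + 1) + 1
        · rw [p'1 (i + 1) ⟨_, K1 i _ rfl (e ▸ hx)⟩]; omega
        · have := p'0 (i + 1); omega
      · rw [row_psi2, sp]; have := p'0 (i + 2); have := hp i; have := hp (i + 2); omega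
      · rw [row_psi3, sp]
        by_cases e : x = -(s.p (i + 3) + 1)
        · rw [p'1 (i + 3) ⟨_, K2 (i + 3) i (f4 i) (e ▸ hx)⟩]; omega
        · have := p'0 (i + 3); omega
  · intro i x hx
    rw [sR] at hx
    rw [sp, p'1 i ⟨x, hx⟩]
    right; exact occN i x hx
  · intro i j hj hi hjn
    rw [sR] at hi hjn
    rw [sp, sp, sR, sR, p'1 i hi, p'1 j hjn]
    exact ⟨K3 i j hj, K4 i j hj⟩
  · intro i; rw [sp]; exact le_trans (hp i) (p'0 i)
  · intro i; rw [sp]; have := h.p1 i; have := alf_le (R' i); push_cast; omega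
  · rw [sD]
    apply Finset.union_subset (h.Dsub.trans hF)
    intro v hv
    obtain ⟨i, _, hi⟩ := Finset.mem_biUnion.1 hv
    exact (a6 i v hi).1
  · intro v hv i
    rw [sp, sR]
    rw [sD, Finset.mem_union] at hv
    rcases hv with hv | hv
    · have := h.Dbox v hv i
      have := alf_nn (s.R i)
      omega
    · obtain ⟨k, _, hk⟩ := Finset.mem_biUnion.1 hv
      have := Xrow k v hk i
      omega
  · intro i hi
    rw [sR] at hi
    obtain ⟨x, hx⟩ := hi
    exact ⟨_, occN i x hx⟩
  · intro v hv
    obtain ⟨i, x, hx, rfl⟩ := (hN v).1 hv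
    refine ⟨(a3 i x hx).2, ?_, ?_⟩
    · intro hB
      have := h.box _ hB i
      rw [row_psi0] at this
      omega
    · rcases (a3 i x hx).1 with h1 | h1 | h1
      · exact ⟨_, h.occ i _ h1, adj_psi i (Or.inl rfl)⟩
      · exact ⟨_, h.occ i _ h1, adj_psi i (Or.inr (Or.inl rfl))⟩
      · exact ⟨_, h.occ i _ h1, adj_psi i (Or.inr (Or.inr rfl))⟩
  · have hAc : ∀ i, (A i).card ≤ 7200 * 64 ^ lv (t + 3) := by
      intro i
      rcases a2 i with h1 | h1
      · rw [h1.1]; simp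
      · refine h1.size (t + 2) ?_
        intro x hx
        have := Arng i x hx
        have := h.p1 (i + 1)
        have := h.p1 (i + 3)
        push_cast
        omega
    calc N.card ≤ ∑ i, ((A i).image fun x => psi i (x, s.p i + 1)).card := Finset.card_biUnion_le
      _ ≤ ∑ _i : Fin 4, 7200 * 64 ^ lv (t + 3) :=
        Finset.sum_le_sum fun i _ => le_trans Finset.card_image_le (hAc i)
      _ = 28800 * 64 ^ lv (t + 3) := by simp; ring
  · intro i; rw [sp, sR]
  · have key : ∀ i, (s.n i : ℤ) + 2 * alf (s.R i) + (if (s.R i).Nonempty then 0 else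
        kap s' i + kap s' (i + 3)) ≤ s'.n i + (X i).card := by
      intro i
      rw [sn]
      by_cases hi : (s.R i).Nonempty
      · rw [if_pos hi, n1 i hi]; have := a7 i; omega
      · rw [if_neg hi, n0 i hi, alf, if_neg hi]
        have hn : s.n i = 0 := by
          rcases h.fr i with h1 | h1
          · exact h1.2
          · exact absurd h1.ne hi
        have hpp := hp (i + 1)
        have hpp3 := hp (i + 3)
        have e1 := hk' i
        have e2 := hk' (i + 3)
        rw [f31, R0 i hi] at e2
        rw [R0 i hi] at e1
        have c1 : ∀ x, x ∈ Reb i → 1 ≤ (Reb i).card := fun x hx => Finset.card_pos.2 ⟨x, hx⟩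
        rcases e1 with ⟨e1, e1', _⟩ | e1 <;> rcases e2 with ⟨e2, _, e2'⟩ | e2
        · have : 2 ≤ (Reb i).card := by
            apply Finset.one_lt_card.2
            exact ⟨_, e1', _, e2', by omega⟩
          omega
        · have := c1 _ e1'; omega
        · have := c1 _ e2'; omega
        · omega
    have kk : ∀ i, kap s' i + dup i ≤ kap s i + (if (s.R i).Nonempty then 0 else kap s' i) +
        (if (s.R (i + 1)).Nonempty then 0 else kap s' i) := by
      intro i
      by_cases hi : (s.R i).Nonempty <;> by_cases hj : (s.R (i + 1)).Nonempty
      · rw [if_pos hi, if_pos hj]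
        have e1 := hk' i
        rw [R1 i hi, R1 _ hj] at e1
        rcases e1 with ⟨e1, e2, e3⟩ | e1
        · have f1 := Artop i _ rfl e2
          have f2 := Arbot i _ rfl e3
          have f3 := (a3 i _ e2).2
          have g1 : kap s i = 1 := by unfold kap; rw [if_pos ⟨f1, f2⟩]
          have g2 : dup i = 0 := by rw [hdup, if_neg]; rintro ⟨_, h5⟩; exact f3 h5
          rw [e1, g1, g2]; simp
        · rw [e1, hdup]
          unfold kap
          by_cases hh : s.p (i + 1) ∈ s.R i ∧ -s.p i ∈ s.R (i + 1)
          · rw [if_pos hh]; split_ifs <;> simp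
          · rw [if_neg hh, if_neg (fun h5 => hh h5.1)]; simp
      all_goals
        have hd : dup i = 0 := by
          rw [hdup, if_neg]
          rintro ⟨⟨h5, h6⟩, _⟩
          first
          | exact hi ⟨_, h5⟩
          | exact hj ⟨_, h6⟩
        have := hk0 i
        rw [hd]
      · rw [if_pos hi, if_neg hj]; push_cast; omega
      · rw [if_neg hi, if_pos hj]; push_cast; omega
      · rw [if_neg hi, if_neg hj]
        have : 0 ≤ kap s' i := by rcases hk' i with h1 | h1 <;> omega
        push_cast; omega
    have q1 := key 0
    have q2 := key 1
    have q3 := key 2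
    have q4 := key 3
    have r1 := kk 0
    have r2 := kk 1
    have r3 := kk 2
    have r4 := kk 3
    have z1 : (0 : Fin 4) + 3 = 3 := by decide
    have z2 : (1 : Fin 4) + 3 = 0 := by decide
    have z3 : (2 : Fin 4) + 3 = 1 := by decide
    have z4 : (3 : Fin 4) + 3 = 2 := by decide
    have w1 : (0 : Fin 4) + 1 = 1 := by decide
    have w2 : (1 : Fin 4) + 1 = 2 := by decide
    have w3 : (2 : Fin 4) + 1 = 3 := by decide
    have w4 : (3 : Fin 4) + 1 = 0 := by decide
    rw [z1] at q1
    rw [z2] at q2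
    rw [z3] at q3
    rw [z4] at q4
    rw [w1] at r1
    rw [w2] at r2
    rw [w3] at r3
    rw [w4] at r4
    rw [sDc]
    simp only [Fin.sum_univ_four] at XXc ⊢
    zify at XXc
    split_ifs at q1 q2 q3 q4 r1 r2 r3 r4 <;> linarith
  · intro i
    rw [sDc, sn, sn]
    have hm : ∀ i, (s.n i : ℤ) + 2 * alf (s.R i) ≤ n' i + (X i).card := by
      intro i
      by_cases hi : (s.R i).Nonempty
      · rw [n1 i hi]; exact a7 i
      · rw [alf, if_neg hi]
        have hn : s.n i = 0 := by
          rcases h.fr i with h1 | h1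
          · exact h1.2
          · exact absurd h1.ne hi
        rw [hn]; simp; positivity
    have := hm i
    have := hm (i + 2)
    have := XX2 i
    omega

end Contain

open Set

namespace Contain

/-- `Θ` for the extent in directions `i, i + 2`. -/
def Th (t : ℕ) (s : St) (i : Fin 4) : ℤ :=
  ∑ k, (s.n k : ℤ) - ∑ k, kap s k - (s.p i + s.p (i + 2) + 1) - (3 * t - s.D.card) +
    alf (s.R i) + alf (s.R (i + 2))

def Av (t : ℕ) (s : St) (i : Fin 4) : ℤ :=
  (s.n i : ℤ) + s.n (i + 2) - (s.p (i + 1) + s.p (i + 3) + 1) - (3 * t - s.D.card) +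
    alf (s.R (i + 1)) + alf (s.R (i + 3))

structure Inv (t : ℕ) (F : Finset (ℤ × ℤ)) (B : Set (ℤ × ℤ)) (s : St) : Prop where
  i0 : Inv0 t F B s
  iv : 2 ≤ Th t s 0 ∨ 4 ≤ Th t s 0 + Av t s 0
  ih : 2 ≤ Th t s 1 ∨ 4 ≤ Th t s 1 + Av t s 1

theorem Inv0.facts {t : ℕ} {F : Finset (ℤ × ℤ)} {B : Set (ℤ × ℤ)} {s : St} (h : Inv0 t F B s)
    (i : Fin 4) : (alf (s.R i) = 0 ∧ s.n i = 0 ∨ alf (s.R i) = 1 ∧ 1 ≤ s.n i) ∧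
      (s.n i : ℤ) ≤ s.p (i + 1) + s.p (i + 3) + 1 ∧
      0 ≤ kap s i ∧ kap s i ≤ alf (s.R i) ∧ kap s i ≤ alf (s.R (i + 1)) := by
  refine ⟨?_, ?_, ?_, ?_, ?_⟩
  · rcases h.fr i with ⟨h1, h2⟩ | h1
    · left; rw [h1]; exact ⟨rfl, h2⟩
    · right; exact ⟨alf_pos h1.ne, h1.pos⟩
  · rcases h.fr i with ⟨h1, h2⟩ | h1
    · rw [h2]; have := h.p0 (i + 1); have := h.p0 (i + 3); push_cast; omega
    · have := h1.hull (fun x hx => (h.rng hx).1) (fun x hx => (h.rng hx).2); omega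
  · unfold kap; split_ifs <;> simp
  · unfold kap; split_ifs with hh
    · rw [alf_pos ⟨_, hh.1⟩]
    · exact alf_nn _
  · unfold kap; split_ifs with hh
    · rw [alf_pos ⟨_, hh.2⟩]
    · exact alf_nn _

theorem arith {a0 a1 a2 a3 n0 n1 n2 n3 k0 k1 k2 k3 p0 p1 p2 p3 q b0 b1 b2 b3 U' m0 m1 m2 m3 e : ℤ}
    (A0 : a0 = 0 ∧ n0 = 0 ∨ a0 = 1 ∧ 1 ≤ n0) (A1 : a1 = 0 ∧ n1 = 0 ∨ a1 = 1 ∧ 1 ≤ n1)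
    (A2 : a2 = 0 ∧ n2 = 0 ∨ a2 = 1 ∧ 1 ≤ n2) (A3 : a3 = 0 ∧ n3 = 0 ∨ a3 = 1 ∧ 1 ≤ n3)
    (N0 : n0 ≤ p1 + p3 + 1) (N1 : n1 ≤ p2 + p0 + 1) (N2 : n2 ≤ p3 + p1 + 1)
    (N3 : n3 ≤ p0 + p2 + 1)
    (K0 : 0 ≤ k0 ∧ k0 ≤ a0 ∧ k0 ≤ a1) (K1 : 0 ≤ k1 ∧ k1 ≤ a1 ∧ k1 ≤ a2)
    (K2 : 0 ≤ k2 ∧ k2 ≤ a2 ∧ k2 ≤ a3) (K3 : 0 ≤ k3 ∧ k3 ≤ a3 ∧ k3 ≤ a0)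
    (hq : 0 ≤ q) (P0 : 0 ≤ p0) (P1 : 0 ≤ p1) (P2 : 0 ≤ p2) (P3 : 0 ≤ p3)
    (hU : n0 + n1 + n2 + n3 - (k0 + k1 + k2 + k3) + 2 * (a0 + a1 + a2 + a3) ≤ U' + e)
    (hm0 : n0 + n2 + 2 * (a0 + a2) ≤ m0 + m2 + e) (hm1 : n1 + n3 + 2 * (a1 + a3) ≤ m1 + m3 + e)
    (iv : 2 ≤ n0 + n1 + n2 + n3 - (k0 + k1 + k2 + k3) - (p0 + p2 + 1) - q + a0 + a2 ∨
      4 ≤ (n0 + n1 + n2 + n3 - (k0 + k1 + k2 + k3) - (p0 + p2 + 1) - q + a0 + a2) +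
        (n0 + n2 - (p1 + p3 + 1) - q + a1 + a3))
    (ih : 2 ≤ n0 + n1 + n2 + n3 - (k0 + k1 + k2 + k3) - (p1 + p3 + 1) - q + a1 + a3 ∨
      4 ≤ (n0 + n1 + n2 + n3 - (k0 + k1 + k2 + k3) - (p1 + p3 + 1) - q + a1 + a3) +
        (n1 + n3 - (p2 + p0 + 1) - q + a2 + a0)) :
    (2 ≤ U' - (p0 + b0 + (p2 + b2) + 1) - (q + 3 - e) + b0 + b2 ∨
      4 ≤ (U' - (p0 + b0 + (p2 + b2) + 1) - (q + 3 - e) + b0 + b2) +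
        (m0 + m2 - (p1 + b1 + (p3 + b3) + 1) - (q + 3 - e) + b1 + b3)) ∧
    (2 ≤ U' - (p1 + b1 + (p3 + b3) + 1) - (q + 3 - e) + b1 + b3 ∨
      4 ≤ (U' - (p1 + b1 + (p3 + b3) + 1) - (q + 3 - e) + b1 + b3) +
        (m1 + m3 - (p2 + b2 + (p0 + b0) + 1) - (q + 3 - e) + b2 + b0)) := by
  rcases A0 with ⟨rfl, A0⟩ | ⟨rfl, A0⟩ <;> rcases A1 with ⟨rfl, A1⟩ | ⟨rfl, A1⟩ <;>
  rcases A2 with ⟨rfl, A2⟩ | ⟨rfl, A2⟩ <;> rcases A3 with ⟨rfl, A3⟩ | ⟨rfl, A3⟩ <;> omega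

theorem Inv.active {t : ℕ} {F : Finset (ℤ × ℤ)} {B : Set (ℤ × ℤ)} {s : St} (h : Inv t F B s) :
    ∃ i, (s.R i).Nonempty := by
  by_contra hc
  push Not at hc
  have hq : s.D.card ≤ 3 * t := le_trans (Finset.card_le_card h.i0.Dsub) h.i0.Fc
  have e : ∀ i, alf (s.R i) = 0 ∧ s.n i = 0 ∧ kap s i = 0 := by
    intro i
    obtain ⟨f1, f2, f3, f4, f5⟩ := h.i0.facts i
    have : alf (s.R i) = 0 := by rw [hc i]; rfl
    omega
  have p0 := h.i0.p0 0
  have p1 := h.i0.p0 1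
  have p2 := h.i0.p0 2
  have p3 := h.i0.p0 3
  have iv := h.iv
  simp only [Th, Av, e, zero_add] at iv
  simp at iv
  omega

theorem Inv.turn {t : ℕ} {F F' : Finset (ℤ × ℤ)} {B : Set (ℤ × ℤ)} {s : St} (h : Inv t F B s)
    (hF : F ⊆ F') (h3 : (F' \ F).card ≤ 3) :
    ∃ (s' : St) (N : Finset (ℤ × ℤ)), Inv (t + 1) F' (B ∪ N) s' ∧
      N.Nonempty ∧
      (∀ v ∈ N, v ∉ F' ∧ v ∉ B ∧ ∃ u ∈ B, adjStrong u v) ∧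
      N.card ≤ 28800 * 64 ^ lv (t + 3) := by
  obtain ⟨s', N, g0, g1, g2, g3, g4, g5, g6⟩ := h.i0.turn hF h3
  have hI : Inv (t + 1) F' (B ∪ N) s' := by
    have hq : s.D.card ≤ 3 * t := le_trans (Finset.card_le_card h.i0.Dsub) h.i0.Fc
    have f0 := h.i0.facts 0
    have f1 := h.i0.facts 1
    have f2 := h.i0.facts 2
    have f3 := h.i0.facts 3
    have m0 := g6 0
    have m1 := g6 1
    have z13 : (1 : Fin 4) + 3 = 0 := by decide
    have z12 : (1 : Fin 4) + 2 = 3 := by decide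
    have z21 : (2 : Fin 4) + 1 = 3 := by decide
    have z23 : (2 : Fin 4) + 3 = 1 := by decide
    have z31 : (3 : Fin 4) + 1 = 0 := by decide
    have z33 : (3 : Fin 4) + 3 = 2 := by decide
    have z11 : (1 : Fin 4) + 1 = 2 := by decide
    have iv := h.iv
    have ih := h.ih
    have p0 := h.i0.p0 0
    have p1 := h.i0.p0 1
    have p2 := h.i0.p0 2
    have p3 := h.i0.p0 3
    simp only [Th, Av, Fin.sum_univ_four, zero_add, z11, z12, z13, z21, z23, z31, z33] at *
    have hqq : (0 : ℤ) ≤ 3 * t - s.D.card := by omega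
    have key := arith (b0 := alf (s'.R 0)) (b1 := alf (s'.R 1)) (b2 := alf (s'.R 2))
      (b3 := alf (s'.R 3)) (n0 := s.n 0) (n1 := s.n 1) (n2 := s.n 2) (n3 := s.n 3)
      (by omega) (by omega) (by omega) (by omega)
      f0.2.1 f1.2.1 f2.2.1 f3.2.1 f0.2.2 f1.2.2 f2.2.2 f3.2.2 hqq p0 p1 p2 p3 g5 m0 m1 iv ih
    rw [← g4 0, ← g4 1, ← g4 2, ← g4 3] at key
    have e : (3 * (t : ℤ) - s.D.card) + 3 - (s'.D.card - s.D.card) = 3 * ((t + 1 : ℕ) : ℤ) - s'.D.card := by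
      push_cast; ring
    rw [e] at key
    refine ⟨g0, ?_, ?_⟩
    · simp only [Th, Av, Fin.sum_univ_four, zero_add, z11, z12, z13]
      exact key.1
    · simp only [Th, Av, Fin.sum_univ_four, zero_add, z11, z12, z13]
      exact key.2
  obtain ⟨i, hi⟩ := hI.active
  exact ⟨s', N, hI, g1 i hi, g2, g3⟩

def pI (i : Fin 4) : ℤ :=
  match i with
  | 0 => 1
  | 1 => 1
  | 2 => 0
  | 3 => 0

noncomputable def sI : St := ⟨pI, fun i => Finset.Icc (-pI (i + 3)) (pI (i + 1)), fun _ => 2, ∅⟩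

def BI : Set (ℤ × ℤ) := {v | ∀ i, row i v ≤ pI i}

theorem BI_fin : BI.Finite := by
  apply Set.Finite.subset (Set.finite_Icc ((0 : ℤ), (0 : ℤ)) (1, 1))
  intro v hv
  have h0 := hv 0
  have h1 := hv 1
  have h2 := hv 2
  have h3 := hv 3
  simp only [row, pI] at h0 h1 h2 h3
  rw [Set.mem_Icc, Prod.le_def, Prod.le_def]
  simp only
  omega

theorem pI_b (i : Fin 4) : 0 ≤ pI i ∧ pI i ≤ 1 := by
  fin_cases i <;> simp [pI]

theorem pI_s (i : Fin 4) : pI i + pI (i + 2) = 1 := by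
  fin_cases i <;> simp [pI]

theorem sI_card (i : Fin 4) : (sI.R i).card = 2 := by
  have := pI_s (i + 1)
  have e : i + 1 + 2 = i + 3 := by revert i; decide
  rw [e] at this
  simp only [sI, Int.card_Icc]
  omega

theorem Inv_init : Inv 0 ∅ BI sI := by
  have hne : ∀ i, (sI.R i).Nonempty := fun i => by
    rw [← Finset.card_pos, sI_card]; norm_num
  have hk : ∀ i, kap sI i = 1 := by
    intro i
    unfold kap
    rw [if_pos]
    have b1 := pI_b (i + 1)
    have b2 := pI_b (i + 3)
    have b3 := pI_b i
    have b4 := pI_b (i + 1 + 1)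
    simp only [sI, Finset.mem_Icc, f13]
    omega
  refine ⟨⟨?_, ?_, ?_, ?_, ?_, ?_, ?_, ?_, ?_⟩, ?_, ?_⟩
  · intro i
    right
    have := Front.init (pre i ∅) (sI.p i) (sI.R i) (sI_card i).le (hne i)
    rw [sI_card] at this
    exact this
  · intro v hv; exact hv
  · intro i x hx
    simp only [sI, Finset.mem_Icc] at hx
    refine row_all (P := fun k => row k (psi i (x, sI.p i)) ≤ pI k) i ?_ ?_ ?_ ?_
    · rw [row_psi0]; exact le_refl _
    · rw [row_psi1]; omega
    · rw [row_psi2]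
      have b1 := pI_b i
      have b2 := pI_b (i + 2)
      simp only [sI]; omega
    · rw [row_psi3]; omega
  · rintro i j rfl _ _
    have b1 := pI_b (i + 1)
    have b2 := pI_b (i + 3)
    have b3 := pI_b i
    have b4 := pI_b (i + 1 + 1)
    simp only [sI, Finset.mem_Icc, f13]
    omega
  · intro i; exact (pI_b i).1
  · intro i; simpa [sI] using (pI_b i).2
  · simp [sI]
  · simp [sI]
  · simp
  · left
    simp only [Th, hk, alf_pos (hne _)]
    simp [sI, pI]
  · left
    simp only [Th, hk, alf_pos (hne _)]
    simp [sI, pI]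

end Contain

open Set

namespace Contain

structure Cfg where
  t : ℕ
  F : Finset (ℤ × ℤ)
  B : Set (ℤ × ℤ)
  s : St

def Cfg.ok (c : Cfg) : Prop := Inv c.t c.F c.B c.s

def Good (c : Cfg) (G : Set (ℤ × ℤ)) (F' : Finset (ℤ × ℤ)) : Prop :=
  c.ok ∧ (F' : Set (ℤ × ℤ)) = G ∧ c.F ⊆ F' ∧ (F' \ c.F).card ≤ 3

def Res (c : Cfg) (G : Set (ℤ × ℤ)) (o : Cfg × Finset (ℤ × ℤ)) : Prop :=
  o.1.ok ∧ o.1.t = c.t + 1 ∧ (o.1.F : Set (ℤ × ℤ)) = G ∧ o.1.B = c.B ∪ o.2 ∧ o.2.Nonempty ∧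
    (∀ v ∈ o.2, v ∉ G ∧ v ∉ c.B ∧ ∃ u ∈ c.B, adjStrong u v) ∧
    o.2.card ≤ 28800 * 64 ^ lv (c.t + 3)

theorem res_ex {c : Cfg} {G : Set (ℤ × ℤ)} (h : ∃ F', Good c G F') : ∃ o, Res c G o := by
  obtain ⟨F', h1, rfl, h3, h4⟩ := h
  obtain ⟨s', N, g1, g2, g3, g4⟩ := Inv.turn h1 h3 h4
  exact ⟨(⟨c.t + 1, F', c.B ∪ N, s'⟩, N), g1, rfl, rfl, rfl, g2, by simpa using g3, g4⟩

open Classical in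
noncomputable def stp (o : Option Cfg) (G : Set (ℤ × ℤ)) : Option Cfg × Set (ℤ × ℤ) :=
  match o with
  | none => (none, ∅)
  | some c => if h : ∃ F', Good c G F' then
      (some (res_ex h).choose.1, ((res_ex h).choose.2 : Set (ℤ × ℤ))) else (none, ∅)

theorem stp_some {c : Cfg} {G : Set (ℤ × ℤ)} (h : ∃ F', Good c G F') :
    ∃ o, Res c G o ∧ stp (some c) G = (some o.1, (o.2 : Set (ℤ × ℤ))) :=
  ⟨(res_ex h).choose, (res_ex h).choose_spec, by simp only [stp]; rw [dif_pos h]⟩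

theorem stp_none {c : Cfg} {G : Set (ℤ × ℤ)} (h : ¬ ∃ F', Good c G F') :
    stp (some c) G = (none, ∅) := by simp only [stp]; rw [dif_neg h]

noncomputable def run (l : List (Set (ℤ × ℤ))) : Option Cfg × Set (ℤ × ℤ) :=
  l.foldl (fun st G => stp st.1 G) (some ⟨0, ∅, BI, sI⟩, ∅)

noncomputable def strat (l : List (Set (ℤ × ℤ))) : Set (ℤ × ℤ) := (run l).2

theorem run_succ (f : ℕ → Set (ℤ × ℤ)) (t : ℕ) :
    run ((List.range (t + 1)).map f) = stp (run ((List.range t).map f)).1 (f t) := by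
  unfold run
  rw [List.range_succ, List.map_append, List.foldl_append]
  rfl

noncomputable def cfgAt (F : ℕ → Set (ℤ × ℤ)) (t : ℕ) : Option Cfg :=
  (run ((List.range t).map fun i => F (i + 1))).1

theorem cfg_succ (F : ℕ → Set (ℤ × ℤ)) (t : ℕ) :
    cfgAt F (t + 1) = (stp (cfgAt F t) (F (t + 1))).1 := by
  unfold cfgAt; rw [run_succ]

theorem occ_succ (F : ℕ → Set (ℤ × ℤ)) (t : ℕ) :
    occSets strat BI F (t + 1) = occSets strat BI F t ∪ (stp (cfgAt F t) (F (t + 1))).2 := by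
  have : occSets strat BI F (t + 1) = occSets strat BI F t ∪
    strat ((List.range (t + 1)).map fun i => F (i + 1)) := rfl
  rw [this, strat, run_succ]; rfl

theorem cfg_inv (F : ℕ → Set (ℤ × ℤ)) (h0 : F 0 = ∅) (t : ℕ) : ∀ c, cfgAt F t = some c →
    c.ok ∧ c.t = t ∧ c.B = occSets strat BI F t ∧ (c.F : Set (ℤ × ℤ)) = F t := by
  induction t with
  | zero =>
    intro c hc
    have : c = ⟨0, ∅, BI, sI⟩ := by
      simp [cfgAt, run] at hc; exact hc.symm
    subst this
    exact ⟨Inv_init, rfl, rfl, by simp [h0]⟩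
  | succ t ih =>
    intro c hc
    rw [cfg_succ] at hc
    rcases hd : cfgAt F t with _ | d
    · rw [hd] at hc; simp [stp] at hc
    · rw [hd] at hc
      obtain ⟨e1, e2, e3, e4⟩ := ih d hd
      by_cases hg : ∃ F', Good d (F (t + 1)) F'
      · obtain ⟨o, ho, hs⟩ := stp_some hg
        rw [hs] at hc
        simp only [Option.some.injEq] at hc
        subst hc
        obtain ⟨r1, r2, r3, r4, _⟩ := ho
        refine ⟨r1, by rw [r2, e2], ?_, r3⟩
        rw [occ_succ, hd, hs, r4, e3]
      · rw [stp_none hg] at hc; simp at hc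

noncomputable def gC (t : ℕ) : ℕ∞ := (⌈(86400 : ℝ) * (t : ℝ) ^ ((6 : ℝ) / 7)⌉₊ : ℕ∞)

theorem size_le (t : ℕ) : 28800 * 64 ^ lv (t + 3) ≤ ⌈(86400 : ℝ) * ((t + 1 : ℕ) : ℝ) ^ ((6 : ℝ) / 7)⌉₊ := by
  have h1 := rp_bound (t + 3) (by omega)
  have h2 : (((t + 3 : ℕ) : ℝ)) ^ ((6 : ℝ) / 7) ≤ 3 * ((t + 1 : ℕ) : ℝ) ^ ((6 : ℝ) / 7) := by
    calc (((t + 3 : ℕ) : ℝ)) ^ ((6 : ℝ) / 7) ≤ (3 * ((t + 1 : ℕ) : ℝ)) ^ ((6 : ℝ) / 7) := by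
          apply Real.rpow_le_rpow (by positivity) _ (by norm_num)
          push_cast
          have : (0 : ℝ) ≤ t := Nat.cast_nonneg t
          linarith
      _ = (3 : ℝ) ^ ((6 : ℝ) / 7) * ((t + 1 : ℕ) : ℝ) ^ ((6 : ℝ) / 7) :=
          Real.mul_rpow (by norm_num) (by positivity)
      _ ≤ 3 * ((t + 1 : ℕ) : ℝ) ^ ((6 : ℝ) / 7) := by
          apply mul_le_mul_of_nonneg_right _ (by positivity)
          calc (3 : ℝ) ^ ((6 : ℝ) / 7) ≤ (3 : ℝ) ^ (1 : ℝ) :=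
                Real.rpow_le_rpow_of_exponent_le (by norm_num) (by norm_num)
            _ = 3 := Real.rpow_one 3
  have h3 : ((28800 * 64 ^ lv (t + 3) : ℕ) : ℝ) ≤
      (⌈(86400 : ℝ) * ((t + 1 : ℕ) : ℝ) ^ ((6 : ℝ) / 7)⌉₊ : ℝ) := by
    refine le_trans ?_ (Nat.le_ceil _)
    rw [Nat.cast_mul]
    have h4 : ((28800 : ℕ) : ℝ) = 28800 := by norm_num
    rw [h4]
    linarith
  exact_mod_cast h3

theorem strat_legal (F : ℕ → Set (ℤ × ℤ)) (h0 : F 0 = ∅) :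
    SpreaderLegal adjStrong gC F (occSets strat BI F) := by
  intro t
  rw [occ_succ]
  refine ⟨subset_union_left, ?_⟩
  rw [union_sdiff_left]
  rcases hd : cfgAt F t with _ | d
  · simp [stp]
  · obtain ⟨e1, e2, e3, e4⟩ := cfg_inv F h0 t d hd
    by_cases hg : ∃ F', Good d (F (t + 1)) F'
    · obtain ⟨o, ⟨r1, r2, r3, r4, r5, r6, r7⟩, hs⟩ := stp_some hg
      rw [hs, ← e3]
      refine ⟨?_, ?_⟩
      · refine le_trans (encard_le_encard sdiff_subset) ?_
        rw [encard_coe_eq_coe_finsetCard, gC]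
        have := size_le t
        rw [e2] at r7
        exact_mod_cast le_trans r7 this
      · intro v hv
        have := r6 v hv.1
        exact ⟨this.1, this.2.2⟩
    · rw [stp_none hg]; simp

theorem strat_new (F : ℕ → Set (ℤ × ℤ)) (h0 : F 0 = ∅)
    (hF : ∀ t, F t ⊆ F (t + 1) ∧ (F (t + 1) \ F t).encard ≤ 3) (t : ℕ) :
    occSets strat BI F (t + 1) ≠ occSets strat BI F t := by
  have hgood : ∀ t d, cfgAt F t = some d → ∃ F', Good d (F (t + 1)) F' := by
    intro t d hd
    obtain ⟨e1, e2, e3, e4⟩ := cfg_inv F h0 t d hd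
    obtain ⟨h1, h2⟩ := hF t
    have hfin : (F (t + 1) \ F t).Finite := by
      apply Set.finite_of_encard_le_coe (k := 3)
      exact_mod_cast h2
    have hfin' : (F (t + 1)).Finite := by
      have h5 : (F t).Finite := by rw [← e4]; exact d.F.finite_toSet
      rw [← Set.sdiff_union_of_subset h1]
      exact hfin.union h5
    refine ⟨hfin'.toFinset, e1, by simp, ?_, ?_⟩
    · rw [← Finset.coe_subset, e4]; simpa using h1
    · rw [← ENat.natCast_le_natCast, ← encard_coe_eq_coe_finsetCard]
      simp only [Finset.coe_sdiff, Set.Finite.coe_toFinset, e4]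
      exact_mod_cast h2
  have hsome : ∀ t, ∃ d, cfgAt F t = some d := by
    intro t
    induction t with
    | zero => exact ⟨_, rfl⟩
    | succ t ih =>
      obtain ⟨d, hd⟩ := ih
      obtain ⟨o, _, hs⟩ := stp_some (hgood t d hd)
      rw [cfg_succ, hd, hs]
      exact ⟨_, rfl⟩
  obtain ⟨d, hd⟩ := hsome t
  obtain ⟨e1, e2, e3, e4⟩ := cfg_inv F h0 t d hd
  obtain ⟨o, ⟨r1, r2, r3, r4, ⟨v, hv⟩, r6, r7⟩, hs⟩ := stp_some (hgood t d hd)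
  rw [occ_succ, hd, hs, ← e3]
  intro he
  apply (r6 v hv).2.1
  rw [← he]
  exact Or.inr hv

theorem budget3 (t : ℕ) : budget 3 t = 3 := by
  unfold budget
  have h1 : (t : ℝ) * 3 = ((t * 3 : ℤ) : ℝ) := by push_cast; ring
  have h2 : ((t : ℝ) - 1) * 3 = (((t - 1) * 3 : ℤ) : ℝ) := by push_cast; ring
  rw [h1, h2, Int.floor_intCast, Int.floor_intCast]
  omega

theorem wins : SpreaderWins adjStrong 3 gC BI := by
  refine ⟨strat, ?_⟩
  rintro F ⟨h0, h1⟩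
  refine ⟨strat_legal F h0, fun T => ⟨T + 1, by omega, strat_new F h0 (fun t => ⟨(h1 t).1, ?_⟩) T⟩⟩
  have := (h1 t).2.1
  rw [budget3] at this
  exact_mod_cast this

structure Play where
  bh : List (Set (ℤ × ℤ))
  fh : List (Set (ℤ × ℤ))
  B : Set (ℤ × ℤ)
  D : Set (ℤ × ℤ)

noncomputable def play (σ : List (Set (ℤ × ℤ)) → Set (ℤ × ℤ)) : ℕ → Play
  | 0 => ⟨[BI], [], BI, ∅⟩
  | t + 1 =>
    let P := play σ t
    let f := P.D ∪ σ P.bh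
    let b := P.B ∪ strat (P.fh ++ [f])
    ⟨P.bh ++ [b], P.fh ++ [f], b, f⟩

theorem play_ex (σ : List (Set (ℤ × ℤ)) → Set (ℤ × ℤ)) :
    ∃ B : ℕ → Set (ℤ × ℤ), B = occSets strat BI (delSets σ B) := by
  refine ⟨fun t => (play σ t).B, ?_⟩
  have hb : ∀ t, (play σ t).bh = (List.range (t + 1)).map fun t => (play σ t).B := by
    intro t
    induction t with
    | zero => rfl
    | succ t ih =>
      rw [List.range_succ, List.map_append, ← ih]; rfl
  have hf : ∀ t, (play σ t).fh = (List.range t).map fun t => (play σ (t + 1)).D := by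
    intro t
    induction t with
    | zero => rfl
    | succ t ih =>
      rw [List.range_succ, List.map_append, ← ih]; rfl
  have hD : ∀ t, delSets σ (fun t => (play σ t).B) t = (play σ t).D := by
    intro t
    induction t with
    | zero => rfl
    | succ t ih =>
      simp only [delSets]
      rw [ih, ← hb]; rfl
  have hD' : delSets σ (fun t => (play σ t).B) = fun t => (play σ t).D := funext hD
  rw [hD']
  funext t
  induction t with
  | zero => rfl
  | succ t ih =>
    simp only [occSets]
    rw [← ih, ← hf]; rfl

theorem not_q : (3 : ℝ) ∉ qSet adjStrong gC := by
  rintro ⟨_, h⟩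
  obtain ⟨σ, hσ⟩ := h BI BI_fin
  obtain ⟨B, hB⟩ := play_ex σ
  have hB0 : B 0 = BI := by rw [hB]; rfl
  have hL := strat_legal (delSets σ B) rfl
  rw [← hB] at hL
  obtain ⟨h1, _, T, hT⟩ := hσ B hB0 hL
  have := strat_new (delSets σ B) rfl ?_ T
  · rw [← hB] at this
    exact this (hT (T + 1) (by omega))
  · intro t
    simp only [delSets]
    refine ⟨subset_union_left, ?_⟩
    rw [union_sdiff_left]
    have h2 := (h1 t).2
    rw [budget3] at h2
    exact le_trans (encard_le_encard sdiff_subset) (by exact_mod_cast h2)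

end Contain

theorem spreader_wins_strong_sublinear :
    ∃ C : ℝ, 0 < C ∧
      (∃ B₀ : Set (ℤ × ℤ), B₀.Finite ∧
        SpreaderWins adjStrong 3 (fun t => (⌈C * (t : ℝ) ^ ((6 : ℝ) / 7)⌉₊ : ℕ∞)) B₀) ∧
      (3 : ℝ) ∉ qSet adjStrong (fun t => (⌈C * (t : ℝ) ^ ((6 : ℝ) / 7)⌉₊ : ℕ∞)) :=
  ⟨86400, by norm_num, ⟨Contain.BI, Contain.BI_fin, Contain.wins⟩, Contain.not_q⟩
end

section
/- Let h ≥ 1 and let p ≤ m be integers with m − p + 1 ≤ h. Let F ⊆ ℤ² be a finite set. Suppose there exists a sequence p₁, …, p_h of integers with p₁ = p, p_{j+1} − p_j ∈ {0,1} for every j = 1, …, h−1, p_h ≤ m, and (p_j, j−1) ∉ F for every j = 1, …, h. Let R := {x ∈ ℤ : x ≤ m and there exists a sequence q₁, …, q_h of integers with q₁ = p, q_{j+1} − q_j ∈ {0,1} for every j, (q_j, j−1) ∉ F for every j, and q_h = x}. Then m − p + 1 ≤ |R| + |F ∩ ({p, p+1, …, m} × {0, 1, …, h−1})|. -/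
open Classical in
noncomputable def reachU (m : ℤ) (S : Finset ℤ) : Finset ℤ :=
  (S ∪ S.image (fun x => x + 1)).filter (fun x => x ≤ m)

open Classical in
noncomputable def reachT (F : Set (ℤ × ℤ)) (p m : ℤ) : ℕ → Finset ℤ
  | 0 => {p}
  | n + 1 => (reachU m (reachT F p m n)).filter (fun x => (x, ((n + 1 : ℕ) : ℤ)) ∉ F)

lemma mem_reachU (m : ℤ) (S : Finset ℤ) (x : ℤ) :
    x ∈ reachU m S ↔ (x ∈ S ∨ x - 1 ∈ S) ∧ x ≤ m := by
  simp only [reachU, Finset.mem_filter, Finset.mem_union, Finset.mem_image]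
  constructor
  · rintro ⟨h1 | ⟨a, ha, rfl⟩, h2⟩
    · exact ⟨Or.inl h1, h2⟩
    · exact ⟨Or.inr (by simpa using ha), h2⟩
  · rintro ⟨h1 | h1, h2⟩
    · exact ⟨Or.inl h1, h2⟩
    · exact ⟨Or.inr ⟨_, h1, by ring⟩, h2⟩

lemma mem_reachT_succ (F : Set (ℤ × ℤ)) (p m : ℤ) (n : ℕ) (x : ℤ) :
    x ∈ reachT F p m (n + 1) ↔
      ((x ∈ reachT F p m n ∨ x - 1 ∈ reachT F p m n) ∧ x ≤ m) ∧
        (x, ((n + 1 : ℕ) : ℤ)) ∉ F := by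
  classical
  rw [reachT, Finset.mem_filter, mem_reachU]

lemma reachT_bounds (F : Set (ℤ × ℤ)) (p m : ℤ) (hpm : p ≤ m) (n : ℕ) :
    ∀ x ∈ reachT F p m n, p ≤ x ∧ x ≤ m ∧ x ≤ p + n := by
  induction n with
  | zero => intro x hx; simp [reachT] at hx; subst hx; simp [hpm]
  | succ n ih =>
    intro x hx
    rw [mem_reachT_succ] at hx
    obtain ⟨⟨h1 | h1, h2⟩, -⟩ := hx
    · have := ih _ h1; push_cast; omega
    · have := ih _ h1; push_cast; omega

lemma reachT_path (F : Set (ℤ × ℤ)) (p m : ℤ) (h0 : (p, (0 : ℤ)) ∉ F) (n : ℕ) :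
    ∀ x ∈ reachT F p m n, ∃ qs : ℕ → ℤ, qs 0 = p ∧
      (∀ j : ℕ, j < n → qs (j + 1) - qs j ∈ ({0, 1} : Set ℤ)) ∧
      (∀ j : ℕ, j ≤ n → ((qs j, (j : ℤ)) : ℤ × ℤ) ∉ F) ∧ qs n = x := by
  induction n with
  | zero =>
    intro x hx
    simp [reachT] at hx
    subst hx
    refine ⟨fun _ => x, rfl, by simp, ?_, rfl⟩
    intro j hj
    obtain rfl : j = 0 := by omega
    simpa using h0
  | succ n ih =>
    intro x hx
    rw [mem_reachT_succ] at hx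
    obtain ⟨⟨h1, h2⟩, h3⟩ := hx
    obtain ⟨y, hy, hxy⟩ : ∃ y ∈ reachT F p m n, x - y = 0 ∨ x - y = 1 := by
      rcases h1 with h1 | h1
      · exact ⟨x, h1, by simp⟩
      · exact ⟨x - 1, h1, by simp⟩
    obtain ⟨qs, a, b, c, d⟩ := ih y hy
    refine ⟨fun j => if j ≤ n then qs j else x, by simp [a], ?_, ?_, by simp⟩
    · intro j hj
      by_cases hjn : j < n
      · have := b j hjn
        simpa [hjn.le, Nat.succ_le_of_lt hjn] using this
      · obtain rfl : j = n := by omega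
        simpa [d] using hxy
    · intro j hj
      by_cases hjn : j ≤ n
      · simpa [hjn] using c j hjn
      · obtain rfl : j = n + 1 := by omega
        simpa using h3

lemma path_reachT (F : Set (ℤ × ℤ)) (p m : ℤ) (n : ℕ) (qs : ℕ → ℤ) (a : qs 0 = p)
    (b : ∀ j : ℕ, j < n → qs (j + 1) - qs j ∈ ({0, 1} : Set ℤ))
    (c : ∀ j : ℕ, j ≤ n → ((qs j, (j : ℤ)) : ℤ × ℤ) ∉ F) (d : qs n ≤ m) :
    ∀ j ≤ n, qs j ∈ reachT F p m j := by
  have hb : ∀ j < n, qs (j + 1) = qs j ∨ qs (j + 1) = qs j + 1 := by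
    intro j hj
    have := b j hj
    simp only [Set.mem_insert_iff, Set.mem_singleton_iff] at this
    omega
  have hm : ∀ k j, j + k = n → qs j ≤ m := by
    intro k
    induction k with
    | zero => intro j hj; obtain rfl : j = n := by omega
              exact d
    | succ k ih =>
      intro j hj
      have := ih (j + 1) (by omega)
      have := hb j (by omega)
      omega
  intro j
  induction j with
  | zero => intro _; simp [reachT, a]
  | succ j ih =>
    intro hj
    rw [mem_reachT_succ]
    refine ⟨⟨?_, hm (n - (j + 1)) _ (by omega)⟩, c _ hj⟩
    rcases hb j (by omega) with e | e
    · left; rw [e]; exact ih (by omega)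
    · right; rw [e]; simpa using ih (by omega)

open Classical in
noncomputable def boxG (F : Set (ℤ × ℤ)) (hF : F.Finite) (p m : ℤ) (n : ℕ) : Finset (ℤ × ℤ) :=
  hF.toFinset.filter (fun pt => p ≤ pt.1 ∧ pt.1 ≤ m ∧ 0 ≤ pt.2 ∧ pt.2 ≤ (n : ℤ))

open Classical in
lemma count_step (F : Set (ℤ × ℤ)) (hF : F.Finite) (p m : ℤ) (hpm : p ≤ m) (n : ℕ) :
    (reachU m (reachT F p m n)).card + (boxG F hF p m n).card ≤
      (reachT F p m (n + 1)).card + (boxG F hF p m (n + 1)).card := by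
  set U := reachU m (reachT F p m n) with hU
  have h1 := Finset.card_filter_add_card_filter_not (s := U)
    (fun x => (x, ((n + 1 : ℕ) : ℤ)) ∉ F)
  set D := U.filter (fun x => ¬ (x, ((n + 1 : ℕ) : ℤ)) ∉ F) with hD
  have h2 : (D.image (fun x => (x, ((n + 1 : ℕ) : ℤ)))).card = D.card :=
    Finset.card_image_of_injective _ (fun x y hxy => by simpa using hxy)
  have h3 : Disjoint (boxG F hF p m n) (D.image (fun x => (x, ((n + 1 : ℕ) : ℤ)))) := by
    rw [Finset.disjoint_left]
    intro pt ha hb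
    simp only [boxG, Finset.mem_filter] at ha
    simp only [Finset.mem_image] at hb
    obtain ⟨x, -, rfl⟩ := hb
    have := ha.2.2.2.2
    push_cast at this
    omega
  have h4 : boxG F hF p m n ∪ (D.image (fun x => (x, ((n + 1 : ℕ) : ℤ)))) ⊆
      boxG F hF p m (n + 1) := by
    intro pt hpt
    rw [Finset.mem_union] at hpt
    rcases hpt with ha | hb
    · simp only [boxG, Finset.mem_filter] at ha ⊢
      refine ⟨ha.1, ha.2.1, ha.2.2.1, ha.2.2.2.1, ?_⟩
      have := ha.2.2.2.2
      push_cast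
      omega
    · simp only [Finset.mem_image] at hb
      obtain ⟨x, hx, rfl⟩ := hb
      rw [hD, Finset.mem_filter, not_not, hU, mem_reachU] at hx
      obtain ⟨⟨hx1, hx2⟩, hx3⟩ := hx
      simp only [boxG, Finset.mem_filter, Set.Finite.mem_toFinset]
      refine ⟨hx3, ?_, hx2, by positivity, le_refl _⟩
      rcases hx1 with e | e
      · exact (reachT_bounds F p m hpm n _ e).1
      · have := (reachT_bounds F p m hpm n _ e).1
        omega
  have h5 := Finset.card_le_card h4
  rw [Finset.card_union_of_disjoint h3, h2] at h5
  have h6 : (reachT F p m (n + 1)).card =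
    (U.filter (fun x => (x, ((n + 1 : ℕ) : ℤ)) ∉ F)).card := by rw [reachT]
  omega

lemma count_main (F : Set (ℤ × ℤ)) (hF : F.Finite) (p m : ℤ) (hpm : p ≤ m) (N : ℕ)
    (hne : ∀ j ≤ N, (reachT F p m j).Nonempty) : ∀ n ≤ N,
    min (m - p + 1) ((n : ℤ) + 1) ≤
      ((reachT F p m n).card : ℤ) + ((boxG F hF p m n).card : ℤ) := by
  intro n
  induction n with
  | zero => intro _; simp [reachT]
  | succ n ih =>
    intro hn
    have ih := ih (by omega)
    have hs := count_step F hF p m hpm n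
    have hsub : reachT F p m n ⊆ reachU m (reachT F p m n) := by
      intro x hx
      rw [mem_reachU]
      exact ⟨Or.inl hx, (reachT_bounds F p m hpm n x hx).2.1⟩
    by_cases hmem : m ∈ reachT F p m n
    · have := (reachT_bounds F p m hpm n m hmem).2.2
      have := Finset.card_le_card hsub
      push_cast
      omega
    · have hN := hne n (by omega)
      have hmax := Finset.max'_mem _ hN
      set M := (reachT F p m n).max' hN with hM
      have hMm : M ≠ m := fun e => hmem (e ▸ hmax)
      have hb := (reachT_bounds F p m hpm n M hmax).2.1
      have hlt : (reachT F p m n).card < (reachU m (reachT F p m n)).card := by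
        apply Finset.card_lt_card
        refine (Finset.ssubset_iff_of_subset hsub).2 ⟨M + 1, ?_, ?_⟩
        · rw [mem_reachU]
          exact ⟨Or.inr (by simpa using hmax), by omega⟩
        · intro hc
          have := Finset.le_max' _ _ hc
          omega
      push_cast
      omega


/-- **Claim.** Let `h ≥ 1`, `p ≤ m` with `m − p + 1 ≤ h`, and let `F ⊆ ℤ²` be finite.
If some up-or-up-right lattice path of height `h` from `(p, 0)` avoiding `F` ends at a
column `≤ m`, then the width `m − p + 1` of `[p, m]` is at most the number of columns
`x ≤ m` reachable at row `h − 1` by such `F`-avoiding paths, plus the number of points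
of `F` in the box `[p, m] × [0, h − 1]`. -/
theorem width_le_reachable_add_deleted (h : ℕ) (hh : 1 ≤ h) (p m : ℤ) (hpm : p ≤ m)
    (hwidth : m - p + 1 ≤ (h : ℤ)) (F : Set (ℤ × ℤ)) (hF : F.Finite)
    (hex : ∃ ps : ℕ → ℤ, ps 0 = p ∧
      (∀ j : ℕ, j + 1 < h → ps (j + 1) - ps j ∈ ({0, 1} : Set ℤ)) ∧
      ps (h - 1) ≤ m ∧
      ∀ j : ℕ, j < h → ((ps j, (j : ℤ)) : ℤ × ℤ) ∉ F) :
    m - p + 1 ≤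
      (({x : ℤ | x ≤ m ∧ ∃ qs : ℕ → ℤ, qs 0 = p ∧
          (∀ j : ℕ, j + 1 < h → qs (j + 1) - qs j ∈ ({0, 1} : Set ℤ)) ∧
          (∀ j : ℕ, j < h → ((qs j, (j : ℤ)) : ℤ × ℤ) ∉ F) ∧
          qs (h - 1) = x}).ncard : ℤ) +
      ((F ∩ {pt : ℤ × ℤ | p ≤ pt.1 ∧ pt.1 ≤ m ∧ 0 ≤ pt.2 ∧ pt.2 ≤ (h : ℤ) - 1}).ncard
        : ℤ) := by
  obtain ⟨N, rfl⟩ : ∃ N, h = N + 1 := ⟨h - 1, by omega⟩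
  obtain ⟨ps, a, b, c, d⟩ := hex
  have h0 : (p, (0 : ℤ)) ∉ F := by
    have := d 0 (by omega)
    simpa [a] using this
  have hne : ∀ j ≤ N, (reachT F p m j).Nonempty := fun j hj =>
    ⟨_, path_reachT F p m N ps a (fun j hj => b j (by omega)) (fun j hj => d j (by omega))
      (by simpa using c) j hj⟩
  have key := count_main F hF p m hpm N hne N le_rfl
  have e1 : {x : ℤ | x ≤ m ∧ ∃ qs : ℕ → ℤ, qs 0 = p ∧
          (∀ j : ℕ, j + 1 < N + 1 → qs (j + 1) - qs j ∈ ({0, 1} : Set ℤ)) ∧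
          (∀ j : ℕ, j < N + 1 → ((qs j, (j : ℤ)) : ℤ × ℤ) ∉ F) ∧
          qs (N + 1 - 1) = x} = (reachT F p m N : Set ℤ) := by
    ext x
    simp only [Set.mem_ofPred_eq, Finset.mem_coe, Nat.add_sub_cancel]
    constructor
    · rintro ⟨hx, qs, q1, q2, q3, q4⟩
      rw [← q4]
      exact path_reachT F p m N qs q1 (fun j hj => q2 j (by omega))
        (fun j hj => q3 j (by omega)) (by omega) N le_rfl
    · intro hx
      obtain ⟨qs, q1, q2, q3, q4⟩ := reachT_path F p m h0 N x hx
      exact ⟨(reachT_bounds F p m hpm N x hx).2.1, qs, q1, fun j hj => q2 j (by omega),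
        fun j hj => q3 j (by omega), q4⟩
  have e2 : F ∩ {pt : ℤ × ℤ | p ≤ pt.1 ∧ pt.1 ≤ m ∧ 0 ≤ pt.2 ∧
      pt.2 ≤ ((N + 1 : ℕ) : ℤ) - 1} = (boxG F hF p m N : Set (ℤ × ℤ)) := by
    ext pt
    simp [boxG]
    tauto
  rw [e1, e2, Set.ncard_coe_finset, Set.ncard_coe_finset]
  push_cast at hwidth
  omega
end
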